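/- arXiv:2508.09114 — 2 statements merged into one kernel-verified Lean document; each statement's English description precedes it below -/
import Mathlib

section
/- Let S be a finitely generated semigroup, under composition, of morphisms f : ℙ^n_K → ℙ^n_K of projective n-space over a field K. If x ∈ ℙ^n(K̄) satisfies x ∈ Per(g) for every g ∈ S, then the orbit S·x = {g(x) : g ∈ S} is finite. -/
open MvPolynomial

noncomputable section

/-- A self-map `φ` of `ℙ^n(K̄)` is induced by a morphism `ℙ^n_K → ℙ^n_K`: it is given by
`n+1` homogeneous polynomials over `K` of a common degree with no common nontrivial zero
over `K̄`. -/
def IsProjMorphism (K : Type*) [Field K] (n : ℕ)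
    (φ : Function.End (Projectivization (AlgebraicClosure K) (Fin (n + 1) → AlgebraicClosure K))) :
    Prop :=
  ∃ (d : ℕ) (ps : Fin (n + 1) → MvPolynomial (Fin (n + 1)) K),
    (∀ i, (ps i).IsHomogeneous d) ∧
    (∀ v : Fin (n + 1) → AlgebraicClosure K, v ≠ 0 → (fun i => aeval v (ps i)) ≠ 0) ∧
    ∀ (v : Fin (n + 1) → AlgebraicClosure K) (hv : v ≠ 0)
      (hw : (fun i => aeval v (ps i)) ≠ 0),
      φ (Projectivization.mk (AlgebraicClosure K) v hv) =
        Projectivization.mk (AlgebraicClosure K) (fun i => aeval v (ps i)) hw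

universe u v

section Parallel
variable {κ R Ω : Type*}

/-- Two coordinate vectors are parallel when all their `2 × 2` minors vanish. -/
def Parallel [CommRing R] (u v : κ → R) : Prop := ∀ i j, u i * v j = u j * v i

theorem parallel_smul_left [CommRing R] (c : R) (v : κ → R) : Parallel (c • v) v :=
  fun i j => by simp only [Pi.smul_apply, smul_eq_mul]; ring

theorem parallel_iff_exists_smul [Field Ω] {u v : κ → Ω} (hv : v ≠ 0) :
    Parallel u v ↔ ∃ c : Ω, u = c • v := by
  constructor
  · intro h
    obtain ⟨j, hj⟩ := Function.ne_iff.1 hv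
    refine ⟨u j / v j, funext fun i => ?_⟩
    have := h i j
    simp only [Pi.zero_apply] at hj
    simp only [Pi.smul_apply, smul_eq_mul]
    field_simp
    linear_combination this
  · rintro ⟨c, rfl⟩
    exact parallel_smul_left c v

theorem parallel_map_iff [CommRing R] [CommRing Ω] {f : R →+* Ω} (hf : Function.Injective f)
    {u v : κ → R} : Parallel (f ∘ u) (f ∘ v) ↔ Parallel u v := by
  simp only [Parallel, Function.comp_apply, ← map_mul, hf.eq_iff]

end Parallel

section Matrix
open scoped Matrix
variable {κ R Ω : Type*} [Fintype κ] [DecidableEq κ]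

theorem Matrix.pow_apply_mem_ideal_pow [CommRing R] {I : Ideal R} {z : Matrix κ κ R}
    (hz : ∀ i j, z i j ∈ I) (n : ℕ) : ∀ i j, (z ^ n) i j ∈ I ^ n := by
  induction n with
  | zero => intro i j; simp
  | succ n ih =>
    intro i j
    rw [pow_succ z, Matrix.mul_apply, pow_succ I]
    exact Ideal.sum_mem _ fun k _ => Ideal.mul_mem_mul (ih i k) (hz k j)

theorem Matrix.mulVec_sub_mem_of_pow_char_pow [CommRing R] (p : ℕ) [Fact p.Prime] [CharP R p]
    {I : Ideal R} {y : Matrix κ κ R} (hy : ∀ i j, (y - 1) i j ∈ I) (X : κ → R) (a : ℕ) (i : κ) :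
    ((y ^ p ^ a) *ᵥ X) i - X i ∈ I ^ p ^ a := by
  rcases isEmpty_or_nonempty κ with h | h
  · exact h.elim i
  have h1 : y ^ p ^ a - 1 = (y - 1) ^ p ^ a := by
    rw [sub_pow_char_pow_of_commute p _ (Commute.one_right y), one_pow]
  have h2 : ((y ^ p ^ a) *ᵥ X) i - X i = ((y - 1) ^ p ^ a *ᵥ X) i := by
    rw [← h1, Matrix.sub_mulVec]; simp
  rw [h2]
  exact Ideal.sum_mem _ fun k _ => Ideal.mul_mem_right _ _ (Matrix.pow_apply_mem_ideal_pow hy _ i k)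

theorem Matrix.pow_char_pow_mulVec_eq_smul [Field Ω] [IsAlgClosed Ω] (p : ℕ) [Fact p.Prime]
    [CharP Ω p] (y : Matrix κ κ Ω) (X : κ → Ω) {a e : ℕ} (he : Fintype.card κ ≤ p ^ e)
    (h : ∃ c : Ω, (y ^ p ^ a) *ᵥ X = c • X) : ∃ c : Ω, (y ^ p ^ e) *ᵥ X = c • X := by
  rcases isEmpty_or_nonempty κ with hκ | hκ
  · exact ⟨0, Subsingleton.elim _ _⟩
  obtain ⟨c, hc⟩ := h
  obtain ⟨ν, rfl⟩ := IsAlgClosed.exists_pow_nat_eq c (pow_pos (Fact.out : p.Prime).pos a)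
  have key : ∀ a, (y - Matrix.scalar κ ν) ^ p ^ a = y ^ p ^ a - Matrix.scalar κ (ν ^ p ^ a) := by
    intro a
    rw [sub_pow_char_pow_of_commute p _ ((Matrix.scalar_commute ν (Commute.all _) y).symm), map_pow]
  have hs : ∀ d : Ω, (Matrix.scalar κ d) *ᵥ X = d • X := by
    intro d; ext i; simp [Matrix.scalar_apply, Matrix.mulVec_diagonal]
  have e1 : ((y - Matrix.scalar κ ν) ^ p ^ a) *ᵥ X = 0 := by
    rw [key, Matrix.sub_mulVec, hc, hs, sub_self]
  set T := (y - Matrix.scalar κ ν).mulVecLin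
  have hT : ∀ n, T ^ n = ((y - Matrix.scalar κ ν) ^ n).mulVecLin := by
    intro n
    have := Matrix.toLin'_pow (y - Matrix.scalar κ ν) n
    simpa [T, Matrix.toLin'_apply'] using this.symm
  have e2 : (T ^ p ^ a) X = 0 := by rw [hT]; exact e1
  have e3 : (T ^ (Module.finrank Ω (κ → Ω))) X = 0 := by
    have := Module.End.ker_pow_le_ker_pow_finrank T (p ^ a)
    exact this e2
  have e4 : (T ^ p ^ e) X = 0 := by
    rw [Module.finrank_fintype_fun_eq_card] at e3
    obtain ⟨k, hk⟩ := Nat.exists_eq_add_of_le he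
    rw [hk, add_comm, pow_add, Module.End.mul_apply, e3, map_zero]
  rw [hT] at e4
  refine ⟨ν ^ p ^ e, ?_⟩
  have : ((y - Matrix.scalar κ ν) ^ p ^ e) *ᵥ X = 0 := e4
  rw [key, Matrix.sub_mulVec, hs, sub_eq_zero] at this
  exact this

end Matrix

section Uniform
open scoped Matrix
variable {κ R Ω : Type*} [Fintype κ] [DecidableEq κ]

theorem Matrix.pow_mulVec_eq_smul [CommRing R] {A : Matrix κ κ R} {X : κ → R} {c : R}
    (h : A *ᵥ X = c • X) (n : ℕ) : (A ^ n) *ᵥ X = c ^ n • X := by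
  induction n with
  | zero => simp
  | succ n ih =>
    rw [pow_succ, ← Matrix.mulVec_mulVec, h, Matrix.mulVec_smul, ih, smul_smul, pow_succ, mul_comm]

theorem Ideal.eq_zero_of_forall_mem_pow [CommRing R] {m : Ideal R} (hm : ⨅ n, m ^ n = ⊥)
    {f : ℕ → ℕ} (hf : ∀ n, n ≤ f n) {r : R} (hr : ∀ n, r ∈ m ^ f n) : r = 0 := by
  have : r ∈ ⨅ n, m ^ n := (Submodule.mem_iInf _).2 fun n => Ideal.pow_le_pow_right (hf n) (hr n)
  simpa [hm] using this

theorem Nat.exists_prime_pow_add_eq {p : ℕ} (hp : p.Prime) {k : ℕ} (hk : 1 ≤ k) :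
    ∃ b : ℕ, ∀ j : ℕ, ∃ a q : ℕ, j ≤ a ∧ p ^ a = p ^ b + k * q := by
  obtain ⟨b, k', hk', rfl⟩ := Nat.exists_eq_pow_mul_and_not_dvd (by omega : k ≠ 0) p hp.ne_one
  have hk0 : 0 < k' := Nat.pos_of_ne_zero fun h => by simp [h] at hk
  refine ⟨b, fun j => ?_⟩
  have hc : Nat.Coprime p k' := (Nat.Prime.coprime_iff_not_dvd hp).2 hk'
  have h1 : 1 ≡ p ^ (j * k'.totient) [MOD k'] := by
    rw [mul_comm, pow_mul]
    simpa using ((Nat.ModEq.pow_totient hc).pow j).symm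
  obtain ⟨q, hq⟩ := (Nat.modEq_iff_dvd' (Nat.one_le_pow _ _ hp.pos)).1 h1
  refine ⟨b + j * k'.totient, q, ?_, ?_⟩
  · have := Nat.totient_pos.2 hk0
    nlinarith
  · have h2 : 1 ≤ p ^ (j * k'.totient) := Nat.one_le_pow _ _ hp.pos
    have h3 : p ^ (j * k'.totient) = 1 + k' * q := by omega
    rw [pow_add, h3]; ring

theorem Matrix.exists_uniform_projective_exponent [CommRing R] [IsDomain R] [Field Ω]
    [IsAlgClosed Ω] (p : ℕ) [Fact p.Prime] [CharP R p] [CharP Ω p] {f : R →+* Ω}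
    (hf : Function.Injective f) (m : Ideal R) [Finite (R ⧸ m)] (hm : ⨅ n, m ^ n = ⊥) :
    ∃ N : ℕ, 1 ≤ N ∧ ∀ w : Matrix κ κ R, IsUnit w → ∀ X : κ → R, X ≠ 0 →
      (∃ k, 1 ≤ k ∧ Parallel ((w ^ k) *ᵥ X) X) → Parallel ((w ^ N) *ᵥ X) X := by
  have hpp : p.Prime := Fact.out
  have : Finite (Matrix κ κ (R ⧸ m)) := inferInstanceAs (Finite (κ → κ → R ⧸ m))
  set M := Nat.card (Matrix κ κ (R ⧸ m))ˣ with hM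
  obtain ⟨e, he⟩ : ∃ e, Fintype.card κ ≤ p ^ e :=
    ⟨Fintype.card κ, (Nat.lt_pow_self hpp.one_lt).le⟩
  refine ⟨M * p ^ e, Nat.mul_pos Nat.card_pos (pow_pos hpp.pos _), ?_⟩
  rintro w hw X hX ⟨k, hk, hpar⟩
  have hy : ∀ i j, (w ^ M - 1) i j ∈ m := by
    have h1 : ((Ideal.Quotient.mk m).mapMatrix w) ^ M = 1 := by
      obtain ⟨u, hu⟩ := hw.map (Ideal.Quotient.mk m).mapMatrix
      rw [← hu, ← Units.val_pow_eq_pow_val, hM, pow_card_eq_one', Units.val_one]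
    have h2 : (Ideal.Quotient.mk m).mapMatrix (w ^ M - 1) = 0 := by
      rw [map_sub, map_pow, h1, map_one, sub_self]
    intro i j
    have := congrFun (congrFun h2 i) j
    simpa using Ideal.Quotient.eq_zero_iff_mem.1 this
  have hmap : ∀ (A : Matrix κ κ R) (v : κ → R), f ∘ (A *ᵥ v) = (f.mapMatrix A) *ᵥ (f ∘ v) :=
    fun A v => funext fun i => RingHom.map_mulVec f A v i
  have hfX : f ∘ X ≠ 0 := fun h => hX <| funext fun i => hf <| by
    simpa using congrFun h i
  have hpar_iff : ∀ A : Matrix κ κ R, Parallel (A *ᵥ X) X ↔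
      ∃ c : Ω, (f.mapMatrix A) *ᵥ (f ∘ X) = c • (f ∘ X) := fun A => by
    rw [← parallel_map_iff hf, hmap, parallel_iff_exists_smul hfX]
  have hyk : ∃ c : Ω, ((f.mapMatrix (w ^ M)) ^ k) *ᵥ (f ∘ X) = c • (f ∘ X) := by
    obtain ⟨c, hc⟩ := (hpar_iff _).1 hpar
    refine ⟨c ^ M, ?_⟩
    rw [← Matrix.pow_mulVec_eq_smul hc, map_pow, map_pow, ← pow_mul, ← pow_mul, mul_comm]
  rw [hpar_iff, pow_mul, map_pow]
  obtain ⟨b, hb⟩ := Nat.exists_prime_pow_add_eq hpp hk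
  refine Matrix.pow_char_pow_mulVec_eq_smul p _ _ (a := b) he ?_
  rw [← map_pow, ← hpar_iff]
  intro i j
  rw [← sub_eq_zero]
  set y := w ^ M
  choose a q hja hpa using hb
  refine Ideal.eq_zero_of_forall_mem_pow hm (f := fun j => p ^ a j)
    (fun n => (hja n).trans (Nat.lt_pow_self hpp.one_lt).le) fun n => ?_
  have hpar2 : Parallel ((y ^ p ^ a n) *ᵥ X) ((y ^ p ^ b) *ᵥ X) := by
    obtain ⟨c, hc⟩ := hyk
    rw [← parallel_map_iff hf, hmap, hmap, hpa, pow_add, map_mul, pow_mul, ← Matrix.mulVec_mulVec,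
      map_pow f.mapMatrix (y ^ k), map_pow f.mapMatrix y k, Matrix.pow_mulVec_eq_smul hc,
      Matrix.mulVec_smul]
    exact parallel_smul_left _ _
  have hi := Matrix.mulVec_sub_mem_of_pow_char_pow p hy X (a n) i
  have hj := Matrix.mulVec_sub_mem_of_pow_char_pow p hy X (a n) j
  have h3 := hpar2 i j
  have : ((y ^ p ^ b) *ᵥ X) i * X j - ((y ^ p ^ b) *ᵥ X) j * X i =
    ((y ^ p ^ b) *ᵥ X) j * (((y ^ p ^ a n) *ᵥ X) i - X i) -
      ((y ^ p ^ b) *ᵥ X) i * (((y ^ p ^ a n) *ᵥ X) j - X j) := by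
    linear_combination -h3
  rw [this]
  exact Ideal.sub_mem _ (Ideal.mul_mem_left _ _ hi) (Ideal.mul_mem_left _ _ hj)

end Uniform

section FGRing
variable {Ω : Type*} [Field Ω]

theorem exists_subring_finite_residue (p : ℕ) [Fact p.Prime] [CharP Ω p] (s : Set Ω)
    (hs : s.Finite) : ∃ R : Subring Ω, s ⊆ R ∧ ∃ m : Ideal R, (∀ n, Finite (R ⧸ m ^ n)) ∧
      ⨅ n, m ^ n = ⊥ := by
  let _ := ZMod.algebra Ω p
  let A : Subalgebra (ZMod p) Ω := Algebra.adjoin (ZMod p) s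
  have hft : Algebra.FiniteType (ZMod p) A :=
    (Subalgebra.fg_iff_finiteType A).1 (Subalgebra.fg_def.2 ⟨s, hs, rfl⟩)
  have hN : IsNoetherianRing A := Algebra.FiniteType.isNoetherianRing (ZMod p) A
  obtain ⟨m, hm⟩ := Ideal.exists_maximal A
  let _ := Ideal.Quotient.field m
  have hft' : Algebra.FiniteType (ZMod p) (A ⧸ m) := inferInstance
  have hfin : Module.Finite (ZMod p) (A ⧸ m) :=
    finite_of_finite_type_of_isJacobsonRing (ZMod p) (A ⧸ m)
  have hfin' : Finite (A ⧸ m) := Module.finite_of_finite (ZMod p)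
  have h1 : ∀ n, Finite (A ⧸ m ^ n) := fun n =>
    Ideal.finite_quotient_pow (IsNoetherian.noetherian m) n
  exact ⟨A.toSubring, Algebra.subset_adjoin, m, h1, Ideal.iInf_pow_eq_bot_of_isDomain m hm.ne_top⟩

end FGRing

section Words
open scoped Matrix
variable {κ Ω ι : Type*} [Fintype κ] [DecidableEq κ] [Field Ω]

theorem Matrix.exists_lift_subring (R : Subring Ω) (A : Matrix κ κ Ω) (hA : ∀ i j, A i j ∈ R) :
    ∃ B : Matrix κ κ R, R.subtype.mapMatrix B = A :=
  ⟨fun i j => ⟨A i j, hA i j⟩, rfl⟩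

theorem Matrix.exists_uniform_word_exponent [IsAlgClosed Ω] [Finite ι] (p : ℕ) [Fact p.Prime]
    [CharP Ω p]
    (A : ι → Matrix κ κ Ω) (hA : ∀ t, IsUnit (A t)) (X : κ → Ω) (hX : X ≠ 0)
    (hper : ∀ l : List ι, l ≠ [] → ∃ k, 1 ≤ k ∧ ∃ c : Ω, ((l.map A).prod ^ k) *ᵥ X = c • X) :
    ∃ N, 1 ≤ N ∧ ∀ l s : List ι, ∃ c : Ω,
      ((l.map A).prod ^ N) *ᵥ ((s.map A).prod *ᵥ X) = c • ((s.map A).prod *ᵥ X) := by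
  choose A' hA1 hA2 using fun t => isUnit_iff_exists.1 (hA t)
  obtain ⟨R, hR, m, hfin, hm⟩ := exists_subring_finite_residue p
    ((Set.range fun q : ι × κ × κ => A q.1 q.2.1 q.2.2) ∪
      (Set.range fun q : ι × κ × κ => A' q.1 q.2.1 q.2.2) ∪ Set.range X)
    (((Set.finite_range _).union (Set.finite_range _)).union (Set.finite_range _))
  have hf : Function.Injective R.subtype := Subtype.val_injective
  have hfM : Function.Injective (R.subtype.mapMatrix (m := κ)) := fun a b h => by
    ext i j; exact congrFun (congrFun h i) j
  choose B hB using fun t => Matrix.exists_lift_subring R (A t)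
    fun i j => hR (Or.inl (Or.inl ⟨(t, i, j), rfl⟩))
  choose B' hB' using fun t => Matrix.exists_lift_subring R (A' t)
    fun i j => hR (Or.inl (Or.inr ⟨(t, i, j), rfl⟩))
  let Y : κ → R := fun i => ⟨X i, hR (Or.inr ⟨i, rfl⟩)⟩
  have hY : R.subtype ∘ Y = X := rfl
  have hBu : ∀ t, IsUnit (B t) := fun t => isUnit_iff_exists.2 ⟨B' t, hfM <| by
    rw [map_mul, hB, hB', hA1, map_one], hfM <| by rw [map_mul, hB, hB', hA2, map_one]⟩
  have hY0 : Y ≠ 0 := fun h => hX <| by rw [← hY, h]; ext; simp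
  have hcharR : CharP R p := inferInstance
  have hW : ∀ l : List ι, R.subtype.mapMatrix (l.map B).prod = (l.map A).prod := fun l => by
    rw [map_list_prod, List.map_map]; congr 1; exact List.map_congr_left fun t _ => hB t
  have hWu : ∀ l : List ι, IsUnit (l.map B).prod := fun l => by
    induction l with
    | nil => simp
    | cons t l ih => rw [List.map_cons, List.prod_cons]; exact (hBu t).mul ih
  have hmap : ∀ (C : Matrix κ κ R) (v : κ → R),
      R.subtype ∘ (C *ᵥ v) = (R.subtype.mapMatrix C) *ᵥ (R.subtype ∘ v) :=
    fun C v => funext fun i => RingHom.map_mulVec R.subtype C v i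
  have h1 : Finite (R ⧸ m) := by simpa using hfin 1
  obtain ⟨N, hN, hu⟩ := Matrix.exists_uniform_projective_exponent (κ := κ) p hf m hm
  refine ⟨N, hN, fun l s => ?_⟩
  have hsX : (s.map A).prod *ᵥ X ≠ 0 := by
    have hus : IsUnit (s.map A).prod := by rw [← hW]; exact (hWu s).map _
    obtain ⟨C, -, hC⟩ := isUnit_iff_exists.1 hus
    intro h
    apply hX
    rw [← Matrix.one_mulVec X, ← hC, ← Matrix.mulVec_mulVec, h, Matrix.mulVec_zero]
  rw [← parallel_iff_exists_smul hsX, ← hW, ← hW, ← hY, ← hmap, ← map_pow, ← hmap,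
    parallel_map_iff hf]
  intro i j
  rw [← sub_eq_zero]
  refine Ideal.eq_zero_of_forall_mem_pow hm (f := id) (fun n => le_rfl) fun n => ?_
  have hfinM : Finite (Matrix κ κ (R ⧸ m ^ n)) :=
    inferInstanceAs (Finite (κ → κ → R ⧸ m ^ n))
  set S := (s.map B).prod with hS
  set L := (l.map B).prod
  let π := (Ideal.Quotient.mk (m ^ n)).mapMatrix (m := κ)
  obtain ⟨K, hK0, hK⟩ : ∃ K, 1 ≤ K ∧ π S ^ K = 1 := by
    obtain ⟨u, hu⟩ := (hWu s).map π
    refine ⟨Nat.card (Matrix κ κ (R ⧸ m ^ n))ˣ, Nat.card_pos, ?_⟩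
    rw [← hu, ← Units.val_pow_eq_pow_val, pow_card_eq_one', Units.val_one]
  set Z := S ^ (K - 1) * (L * S) with hZ
  have hZper : Parallel ((Z ^ N) *ᵥ Y) Y := by
    by_cases hnil : l = [] ∧ s = []
    · have : Z = 1 := by simp [hZ, S, L, hnil.1, hnil.2]
      rw [this, one_pow, Matrix.one_mulVec]
      exact fun i j => mul_comm _ _
    · have hl : ∃ r : List ι, r ≠ [] ∧ (r.map B).prod = Z := by
        refine ⟨(List.replicate (K - 1) s).flatten ++ (l ++ s), ?_, ?_⟩
        · intro h
          simp only [List.append_eq_nil_iff] at h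
          exact hnil h.2
        · rw [List.map_append, List.prod_append, List.map_append, List.prod_append, hZ]
          congr 1
          simp [List.map_flatten, List.prod_flatten, List.map_replicate, List.prod_replicate, hS]
      obtain ⟨r, hr, hrZ⟩ := hl
      rw [← hrZ]
      refine hu _ (hWu r) Y hY0 ?_
      obtain ⟨k, hk, hc⟩ := hper r hr
      refine ⟨k, hk, ?_⟩
      rwa [← parallel_map_iff hf, hmap, map_pow, hW, hY, parallel_iff_exists_smul hX]
  have hcomm : π (S * Z ^ N) = π (L ^ N * S) := by
    have e1 : π S * π Z = π L * π S := by
      rw [hZ, map_mul, map_mul, map_pow, ← mul_assoc, ← pow_succ', Nat.sub_add_cancel hK0, hK,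
        one_mul]
    rw [map_mul, map_mul, map_pow, map_pow]
    exact SemiconjBy.pow_right (a := π S) (x := π Z) (y := π L) e1 N
  have hpar2 : Parallel (S *ᵥ (Z ^ N *ᵥ Y)) (S *ᵥ Y) := by
    rw [← parallel_map_iff hf, hmap, hmap, hmap, hY]
    rw [← parallel_map_iff hf, hmap, hY, parallel_iff_exists_smul hX] at hZper
    obtain ⟨c, hc⟩ := hZper
    rw [hc, Matrix.mulVec_smul]
    exact parallel_smul_left _ _
  have hdiff : ∀ i, ((L ^ N *ᵥ (S *ᵥ Y)) i - (S *ᵥ (Z ^ N *ᵥ Y)) i) ∈ m ^ n := fun i => by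
    rw [Matrix.mulVec_mulVec, Matrix.mulVec_mulVec, ← Pi.sub_apply, ← Matrix.sub_mulVec]
    refine Ideal.sum_mem _ fun k _ => Ideal.mul_mem_right _ _ ?_
    have e := sub_eq_zero.2 hcomm.symm
    rw [← map_sub] at e
    exact Ideal.Quotient.eq_zero_iff_mem.1 (congrFun (congrFun e i) k)
  have h3 := hpar2 i j
  have : (L ^ N *ᵥ (S *ᵥ Y)) i * (S *ᵥ Y) j - (L ^ N *ᵥ (S *ᵥ Y)) j * (S *ᵥ Y) i =
      (S *ᵥ Y) j * ((L ^ N *ᵥ (S *ᵥ Y)) i - (S *ᵥ (Z ^ N *ᵥ Y)) i) -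
      (S *ᵥ Y) i * ((L ^ N *ᵥ (S *ᵥ Y)) j - (S *ᵥ (Z ^ N *ᵥ Y)) j) := by
    linear_combination h3
  rw [this]
  exact Ideal.sub_mem _ (Ideal.mul_mem_left _ _ (hdiff i)) (Ideal.mul_mem_left _ _ (hdiff j))

end Words

section Burnside
open scoped Matrix
variable {Ω : Type*} [Field Ω] [IsAlgClosed Ω]

theorem Matrix.finite_trace_of_pow_eq_one {d N : ℕ} (hN : 1 ≤ N) :
    {c : Ω | ∃ g : Matrix (Fin d) (Fin d) Ω, g ^ N = 1 ∧ g.trace = c}.Finite := by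
  have hroots : {c : Ω | c ^ N = 1}.Finite := by
    refine (Multiset.finite_toSet (Polynomial.nthRoots N (1 : Ω))).subset fun c hc => ?_
    simpa [Polynomial.mem_nthRoots (show 0 < N from hN)] using hc
  have : Finite {c : Ω | c ^ N = 1} := hroots
  refine ((List.finite_length_eq {c : Ω | c ^ N = 1} d).image
    fun l => (l.map Subtype.val).sum).subset ?_
  rintro c ⟨g, hg, rfl⟩
  have hr : ∀ μ ∈ g.charpoly.roots, μ ^ N = 1 := by
    intro μ hμ
    have h1 : (Matrix.scalar (Fin d) μ - g).det = 0 := by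
      rw [← Matrix.eval_charpoly]; exact Polynomial.isRoot_of_mem_roots hμ
    obtain ⟨v, hv, hgv⟩ := Matrix.exists_mulVec_eq_zero_iff.2 h1
    have h2 : g *ᵥ v = μ • v := by
      rw [Matrix.sub_mulVec, sub_eq_zero] at hgv
      rw [← hgv]; ext i; simp [Matrix.scalar_apply, Matrix.mulVec_diagonal]
    have h3 := Matrix.pow_mulVec_eq_smul h2 N
    rw [hg, Matrix.one_mulVec] at h3
    obtain ⟨i, hi⟩ := Function.ne_iff.1 hv
    have h4 := congrFun h3 i
    simp only [Pi.smul_apply, smul_eq_mul] at h4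
    exact (mul_right_cancel₀ hi (by rw [one_mul]; exact h4)).symm
  refine ⟨g.charpoly.roots.toList.pmap (fun c hc => ⟨c, hc⟩)
    (fun μ hμ => hr μ (Multiset.mem_toList.1 hμ)), ?_, ?_⟩
  · have : g.charpoly.roots.card = g.charpoly.natDegree :=
      (IsAlgClosed.splits g.charpoly).natDegree_eq_card_roots.symm
    simpa using this
  · rw [Matrix.trace_eq_sum_roots_charpoly]
    simp only [List.map_pmap]
    rw [List.pmap_eq_map]
    simp [Multiset.sum_toList]

theorem Matrix.finite_of_span_eq_top_of_pow_eq_one {d N : ℕ} (hN : 1 ≤ N)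
    (G : Set (Matrix (Fin d) (Fin d) Ω)) (hG : ∀ g ∈ G, g ^ N = 1)
    (hmul : ∀ g ∈ G, ∀ h ∈ G, g * h ∈ G) (hspan : Submodule.span Ω G = ⊤) : G.Finite := by
  have hfg : (Submodule.span Ω G).FG := by rw [hspan]; exact Module.finite_def.1 inferInstance
  obtain ⟨t, ht, hts⟩ := (Submodule.fg_span_iff_fg_span_finset_subset G).1 hfg
  have hinj : Function.Injective fun (g : Matrix (Fin d) (Fin d) Ω) (h : t) => (g * h.1).trace := by
    intro g g' hgg
    refine Matrix.ext_iff_trace_mul_right.2 fun x => ?_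
    have hx : x ∈ Submodule.span Ω (t : Set (Matrix (Fin d) (Fin d) Ω)) := by
      rw [← hts, hspan]; trivial
    induction hx using Submodule.span_induction with
    | mem x hx => exact congrFun hgg ⟨x, hx⟩
    | zero => simp
    | add x y _ _ hx hy => rw [mul_add, mul_add, Matrix.trace_add, Matrix.trace_add, hx, hy]
    | smul c x _ hx => rw [mul_smul_comm, mul_smul_comm, Matrix.trace_smul, Matrix.trace_smul, hx]
  refine Set.Finite.of_finite_image (f := fun g (h : t) => (g * h.1).trace) ?_ hinj.injOn
  refine (Set.Finite.pi fun _ : t => Matrix.finite_trace_of_pow_eq_one (d := d) hN).subset ?_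
  rintro _ ⟨g, hg, rfl⟩ h -
  exact ⟨g * h.1, hG _ (hmul _ hg _ (ht h.2)), rfl⟩

variable {𝔄 : Type*} [Ring 𝔄] [Algebra Ω 𝔄] [FiniteDimensional Ω 𝔄]

theorem finite_image_quotient_jacobson {N : ℕ} (hN : 1 ≤ N) (G : Set 𝔄)
    (hG : ∀ g ∈ G, g ^ N = 1) (hmul : ∀ g ∈ G, ∀ h ∈ G, g * h ∈ G)
    (hspan : Submodule.span Ω G = ⊤) :
    (Ideal.Quotient.mk (Ring.jacobson 𝔄) '' G).Finite := by
  have : IsArtinianRing 𝔄 := IsArtinianRing.of_finite Ω 𝔄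
  obtain ⟨n, d, -, ⟨e⟩⟩ :=
    IsSemisimpleRing.exists_algEquiv_pi_matrix_of_isAlgClosed Ω (𝔄 ⧸ Ring.jacobson 𝔄)
  let ρ : ∀ i, 𝔄 →ₐ[Ω] Matrix (Fin (d i)) (Fin (d i)) Ω := fun i =>
    ((Pi.evalAlgHom Ω _ i).comp e.toAlgHom).comp (Ideal.Quotient.mkₐ Ω (Ring.jacobson 𝔄))
  have hρ : ∀ i, Function.Surjective (ρ i) := fun i =>
    ((Function.surjective_eval i).comp e.surjective).comp (Ideal.Quotient.mkₐ_surjective Ω _)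
  have hfin : ∀ i, (ρ i '' G).Finite := fun i => by
    refine Matrix.finite_of_span_eq_top_of_pow_eq_one hN _ ?_ ?_ ?_
    · rintro _ ⟨g, hg, rfl⟩
      rw [← map_pow, hG g hg, map_one]
    · rintro _ ⟨g, hg, rfl⟩ _ ⟨h, hh, rfl⟩
      exact ⟨g * h, hmul g hg h hh, map_mul _ _ _⟩
    · have := Submodule.map_span (ρ i).toLinearMap G
      rw [hspan, Submodule.map_top, LinearMap.range_eq_top.2 (hρ i)] at this
      exact this.symm
  refine Set.Finite.of_finite_image (f := e) ?_ e.injective.injOn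
  refine (Set.Finite.pi hfin).subset ?_
  rintro _ ⟨_, ⟨g, hg, rfl⟩, rfl⟩ i -
  exact ⟨g, hg, rfl⟩

end Burnside

section Burnside
variable {Ω : Type*} [Field Ω] {𝔄 : Type*} [Ring 𝔄] {ι : Type*}

theorem List.exists_flatten_of_prefix_eq {C : Type*} [Ring C] (q : 𝔄 →+* C) (a : ι → 𝔄)
    (hunit : ∀ l : List ι, IsUnit (l.map a).prod) (l : List ι) (is : List ℕ) (i : ℕ)
    (hlt : (i :: is).Pairwise (· < ·)) (hle : ∀ j ∈ i :: is, j ≤ l.length)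
    (heq : ∀ j ∈ is, q ((l.take j).map a).prod = q ((l.take i).map a).prod) :
    ∃ (hs : List (List ι)) (b : List ι), l.drop i = hs.flatten ++ b ∧ hs.length = is.length ∧
      ∀ h ∈ hs, h ≠ [] ∧ q (h.map a).prod = 1 := by
  induction is generalizing i with
  | nil => exact ⟨[], l.drop i, by simp⟩
  | cons j is ih =>
    obtain ⟨h1, h2⟩ := List.pairwise_cons.1 hlt
    have hij : i < j := h1 j (by simp)
    have hj : j ≤ l.length := hle j (by simp)
    have heqj := heq j (by simp)
    obtain ⟨hs, b, hdrop, hlen, hhs⟩ := ih j h2 (fun k hk => hle k (List.mem_cons_of_mem _ hk))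
      fun k hk => by rw [heqj]; exact heq k (List.mem_cons_of_mem _ hk)
    have hsplit : l.drop i = (l.drop i).take (j - i) ++ l.drop j := by
      conv_lhs => rw [← List.take_append_drop (j - i) (l.drop i)]
      rw [List.drop_drop, Nat.add_sub_cancel' hij.le]
    have htake : l.take j = l.take i ++ (l.drop i).take (j - i) := by
      rw [← List.take_add, Nat.add_sub_cancel' hij.le]
    refine ⟨(l.drop i).take (j - i) :: hs, b, ?_, by simp [hlen], ?_⟩
    · rw [List.flatten_cons, List.append_assoc, ← hdrop]; exact hsplit
    · intro h hh
      rcases List.mem_cons.1 hh with rfl | hh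
      · constructor
        · intro h0
          have := congrArg List.length h0
          simp at this
          omega
        · rw [htake, List.map_append, List.prod_append, map_mul] at heqj
          exact ((hunit (l.take i)).map q).mul_left_cancel (by rw [heqj, mul_one])
      · exact hhs h hh

/-- The `𝔽_p`-span of the products of all words of length less than `n`. -/
def shortSpan (p : ℕ) [Algebra (ZMod p) 𝔄] (a : ι → 𝔄) (n : ℕ) : Submodule (ZMod p) 𝔄 :=
  Submodule.span (ZMod p) ((fun l : List ι => (l.map a).prod) '' {l | l.length < n})

theorem prod_mem_shortSpan {p : ℕ} [Algebra (ZMod p) 𝔄] (a : ι → 𝔄) {l : List ι} {n : ℕ}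
    (h : l.length < n) : (l.map a).prod ∈ shortSpan p a n :=
  Submodule.subset_span ⟨l, h, rfl⟩

theorem shortSpan_mono {p : ℕ} [Algebra (ZMod p) 𝔄] (a : ι → 𝔄) {m n : ℕ} (h : m ≤ n) :
    shortSpan p a m ≤ shortSpan p a n :=
  Submodule.span_mono (Set.image_mono fun _ hl => lt_of_lt_of_le hl h)

theorem word_mul_mem_shortSpan {p : ℕ} [Algebra (ZMod p) 𝔄] (a : ι → 𝔄) (u v : List ι) {n : ℕ}
    {r : 𝔄} (hr : r ∈ shortSpan p a n) :
    (u.map a).prod * r * (v.map a).prod ∈ shortSpan p a (u.length + n + v.length) := by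
  induction hr using Submodule.span_induction with
  | mem x hx =>
    obtain ⟨l, hl, rfl⟩ := hx
    have h1 : (u ++ l ++ v).length < u.length + n + v.length := by
      have : l.length < n := hl
      simp only [List.length_append]
      omega
    simpa [mul_assoc] using prod_mem_shortSpan (p := p) a h1
  | zero => simp
  | add x y _ _ hx hy => rw [mul_add, add_mul]; exact Submodule.add_mem _ hx hy
  | smul c x _ hx => rw [mul_smul_comm, smul_mul_assoc]; exact Submodule.smul_mem _ _ hx

theorem flatten_sub_prod_mem_shortSpan {p : ℕ} [Algebra (ZMod p) 𝔄] (a : ι → 𝔄)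
    (hs : List (List ι)) (hne : ∀ h ∈ hs, h ≠ []) :
    (hs.flatten.map a).prod - (hs.map fun h => (h.map a).prod - 1).prod ∈
      shortSpan p a hs.flatten.length := by
  induction hs with
  | nil => simp
  | cons h t ih =>
    have ih' := ih fun k hk => hne k (List.mem_cons_of_mem _ hk)
    have hpos : 0 < h.length := List.length_pos_iff.2 (hne h (by simp))
    have hlen : (h :: t).flatten.length = h.length + t.flatten.length := by simp
    have e1 := word_mul_mem_shortSpan a h [] ih'
    have e2 : (t.flatten.map a).prod ∈ shortSpan p a (h :: t).flatten.length :=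
      prod_mem_shortSpan a (by omega)
    have e3 := shortSpan_mono (p := p) a (by omega : t.flatten.length ≤ (h :: t).flatten.length) ih'
    have e4 := Submodule.add_mem _ (shortSpan_mono a (by simp) e1) (Submodule.sub_mem _ e2 e3)
    convert e4 using 1
    simp only [List.flatten_cons, List.map_append, List.prod_append, List.map_cons, List.prod_cons,
      List.map_nil, List.prod_nil, mul_one]
    noncomm_ring

theorem List.prod_mem_pow {I : Ideal 𝔄} [I.IsTwoSided] (hs : List 𝔄) (h : ∀ x ∈ hs, x ∈ I) :
    hs.prod ∈ I ^ hs.length := by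
  induction hs with
  | nil => rw [List.length_nil, Submodule.pow_zero]; exact Submodule.one_le.1 le_rfl
  | cons x t ih =>
    rw [List.prod_cons, List.length_cons, Ideal.IsTwoSided.pow_succ]
    exact Ideal.mul_mem_mul (h x (by simp)) (ih fun y hy => h y (by simp [hy]))

theorem finite_range_word_of_finite_quotient [Finite ι] (p : ℕ) [Fact p.Prime]
    [Algebra (ZMod p) 𝔄] (I : Ideal 𝔄) [I.IsTwoSided] {e : ℕ} (hI : I ^ e = ⊥)
    (a : ι → 𝔄) (hunit : ∀ l : List ι, IsUnit (l.map a).prod)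
    (hfin : (Set.range fun l : List ι => Ideal.Quotient.mk I (l.map a).prod).Finite) :
    (Set.range fun l : List ι => (l.map a).prod).Finite := by
  classical
  set L := hfin.toFinset.card * e + 1 with hL
  have key : ∀ n : ℕ, ∀ l : List ι, l.length = n → (l.map a).prod ∈ shortSpan p a L := by
    intro n
    induction n using Nat.strong_induction_on with
    | _ n ih =>
      rintro l rfl
      rcases lt_or_ge l.length L with hlt | hge
      · exact prod_mem_shortSpan a hlt
      obtain ⟨y, -, hy⟩ := Finset.exists_lt_card_fiber_of_mul_lt_card_of_maps_to
        (s := Finset.range (l.length + 1)) (t := hfin.toFinset) (n := e)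
        (f := fun i => Ideal.Quotient.mk I ((l.take i).map a).prod)
        (fun i _ => hfin.mem_toFinset.2 ⟨l.take i, rfl⟩) (by rw [Finset.card_range]; omega)
      set P := (Finset.range (l.length + 1)).filter
        fun i => Ideal.Quotient.mk I ((l.take i).map a).prod = y with hP
      have hmem : ∀ j ∈ P.sort (· ≤ ·), j ≤ l.length ∧
          Ideal.Quotient.mk I ((l.take j).map a).prod = y := by
        intro j hj
        rw [Finset.mem_sort, hP, Finset.mem_filter, Finset.mem_range] at hj
        exact ⟨by omega, hj.2⟩
      have hsorted : (P.sort (· ≤ ·)).Pairwise (· < ·) := (Finset.sortedLT_sort P).pairwise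
      have hlen : e < (P.sort (· ≤ ·)).length := by rw [Finset.length_sort]; exact hy
      obtain ⟨i, is, his⟩ : ∃ i is, P.sort (· ≤ ·) = i :: is :=
        List.exists_cons_of_length_pos (by omega)
      rw [his] at hsorted hmem hlen
      obtain ⟨hs, b, hdrop, hhslen, hhs⟩ := List.exists_flatten_of_prefix_eq
        (Ideal.Quotient.mk I) a hunit l is i hsorted (fun j hj => (hmem j hj).1)
        fun j hj => by rw [(hmem j (by simp [hj])).2, (hmem i (by simp)).2]
      have hzero : (hs.map fun h => (h.map a).prod - 1).prod = 0 := by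
        have h1 := List.prod_mem_pow (I := I) (hs.map fun h => (h.map a).prod - 1) (by
          intro x hx
          obtain ⟨h, hh, rfl⟩ := List.mem_map.1 hx
          rw [← Ideal.Quotient.eq_zero_iff_mem, map_sub, (hhs h hh).2, map_one, sub_self])
        rw [List.length_map, hhslen] at h1
        have h2 := Ideal.pow_le_pow_right (I := I) (show e ≤ is.length by simp at hlen; omega) h1
        rw [hI] at h2
        exact h2
      have h1 := flatten_sub_prod_mem_shortSpan (p := p) a hs fun h hh => (hhs h hh).1
      rw [hzero, sub_zero] at h1
      have h2 := word_mul_mem_shortSpan a (l.take i) b h1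
      have h3 : ((l.take i).map a).prod * (hs.flatten.map a).prod * (b.map a).prod =
          (l.map a).prod := by
        rw [← List.prod_append, ← List.prod_append, ← List.map_append, ← List.map_append,
          List.append_assoc, ← hdrop, List.take_append_drop]
      rw [h3] at h2
      have hlen2 : (l.take i).length + hs.flatten.length + b.length = l.length := by
        rw [add_assoc, ← List.length_append, ← hdrop, ← List.length_append,
          List.take_append_drop]
      rw [hlen2] at h2
      refine Submodule.span_le.2 ?_ h2
      rintro _ ⟨l', hl', rfl⟩
      exact ih _ hl' l' rfl
  have hsp : Module.Finite (ZMod p) (shortSpan p a L) := Module.Finite.span_of_finite _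
    ((List.finite_length_lt ι L).image _)
  have hfin2 : Finite (shortSpan p a L) := Module.finite_of_finite (ZMod p)
  refine Set.Finite.subset (Set.toFinite (shortSpan p a L : Set 𝔄)) ?_
  rintro _ ⟨l, rfl⟩
  exact key _ l rfl

end Burnside

section Burnside
open scoped Matrix
variable {Ω : Type*} [Field Ω] {𝔄 : Type*} [Ring 𝔄] [Algebra Ω 𝔄]

/-- Left multiplication on the first factor of `𝔄 × Ω`. -/
def mulLeftProd (Ω 𝔄 : Type*) [Field Ω] [Ring 𝔄] [Algebra Ω 𝔄] : 𝔄 →* Module.End Ω (𝔄 × Ω) where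
  toFun a := (LinearMap.mulLeft Ω a).prodMap LinearMap.id
  map_one' := by ext <;> simp
  map_mul' a b := by ext <;> simp

variable {ι : Type*} [Finite ι] [IsAlgClosed Ω] [FiniteDimensional Ω 𝔄]

theorem exists_uniform_exponent (p : ℕ) [Fact p.Prime] [CharP Ω p] (a : ι → 𝔄)
    (h : ∀ l : List ι, l ≠ [] → ∃ k, 1 ≤ k ∧ (l.map a).prod ^ k = 1) :
    ∃ N, 1 ≤ N ∧ ∀ l : List ι, (l.map a).prod ^ N = 1 := by
  let b := Module.finBasis Ω (𝔄 × Ω)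
  let Φ : 𝔄 →* Matrix _ _ Ω :=
    (LinearMap.toMatrixAlgEquiv b).toAlgHom.toRingHom.toMonoidHom.comp (mulLeftProd Ω 𝔄)
  have hΦ : ∀ (c : 𝔄) (v : 𝔄 × Ω), Φ c *ᵥ b.repr v = b.repr (c * v.1, v.2) := fun c v =>
    LinearMap.toMatrix_mulVec_repr b b (mulLeftProd Ω 𝔄 c) v
  have hΦw : ∀ l : List ι, (l.map fun t => Φ (a t)).prod = Φ (l.map a).prod := fun l => by
    rw [map_list_prod, List.map_map]; rfl
  obtain ⟨N, hN, hw⟩ := Matrix.exists_uniform_word_exponent p (fun t => Φ (a t)) (fun t => by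
      obtain ⟨k, hk, h1⟩ := h [t] (by simp)
      refine IsUnit.map Φ (IsUnit.of_pow_eq_one (n := k) ?_ (by omega))
      simpa using h1) (b.repr (1, 1)) (by
      intro h0
      have : b.repr (1, 1) = 0 := DFunLike.coe_injective h0
      rw [map_eq_zero_iff _ b.repr.injective] at this
      exact one_ne_zero (congrArg Prod.snd this)) (fun l hl => by
      obtain ⟨k, hk, h1⟩ := h l hl
      refine ⟨k, hk, 1, ?_⟩
      rw [hΦw, ← map_pow, h1, map_one, Matrix.one_mulVec, one_smul])
  refine ⟨N, hN, fun l => ?_⟩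
  obtain ⟨c, hc⟩ := hw l []
  rw [List.map_nil, List.prod_nil, Matrix.one_mulVec, hΦw, ← map_pow, hΦ,
    ← Finsupp.coe_smul, ← map_smul] at hc
  have h2 := b.repr.injective (DFunLike.coe_injective hc)
  simp only [mul_one, Prod.smul_mk, Prod.mk.injEq, smul_eq_mul] at h2
  rw [h2.1, ← h2.2, one_smul]

theorem finite_range_word_of_span_eq_top (p : ℕ) [Fact p.Prime] [CharP Ω p] (a : ι → 𝔄)
    (h : ∀ l : List ι, l ≠ [] → ∃ k, 1 ≤ k ∧ (l.map a).prod ^ k = 1)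
    (hspan : Submodule.span Ω (Set.range fun l : List ι => (l.map a).prod) = ⊤) :
    (Set.range fun l : List ι => (l.map a).prod).Finite := by
  obtain ⟨N, hN, hw⟩ := exists_uniform_exponent (Ω := Ω) p a h
  have : IsArtinianRing 𝔄 := IsArtinianRing.of_finite Ω 𝔄
  let _ := ZMod.algebra Ω p
  let _ : Algebra (ZMod p) 𝔄 := Algebra.compHom 𝔄 (algebraMap (ZMod p) Ω)
  obtain ⟨e, he⟩ := IsSemiprimaryRing.isNilpotent (R := 𝔄)
  have hfin := finite_image_quotient_jacobson hN (Set.range fun l : List ι => (l.map a).prod)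
    (by rintro _ ⟨l, rfl⟩; exact hw l)
    (by rintro _ ⟨l, rfl⟩ _ ⟨l', rfl⟩; exact ⟨l ++ l', by simp⟩) hspan
  refine finite_range_word_of_finite_quotient p (Ring.jacobson 𝔄) (e := e) he a
    (fun l => IsUnit.of_pow_eq_one (hw l) (by omega)) ?_
  rw [← Set.range_comp] at hfin
  exact hfin

theorem finite_range_word (p : ℕ) [Fact p.Prime] [CharP Ω p] (a : ι → 𝔄)
    (h : ∀ l : List ι, l ≠ [] → ∃ k, 1 ≤ k ∧ (l.map a).prod ^ k = 1) :
    (Set.range fun l : List ι => (l.map a).prod).Finite := by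
  let B := Algebra.adjoin Ω (Set.range a)
  let a' : ι → B := fun t => ⟨a t, Algebra.subset_adjoin ⟨t, rfl⟩⟩
  have hW : ∀ l : List ι, ((l.map a').prod : 𝔄) = (l.map a).prod := fun l => by
    have := map_list_prod B.val (l.map a')
    rw [List.map_map] at this
    exact this
  have hsub : ∀ x : B, x ∈ Submodule.span Ω (Set.range fun l : List ι => (l.map a').prod) := by
    intro x
    have h1 : Submodule.map B.val.toLinearMap
        (Submodule.span Ω (Set.range fun l : List ι => (l.map a').prod)) =
        Submodule.span Ω (Set.range fun l : List ι => (l.map a).prod) := by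
      rw [Submodule.map_span, ← Set.range_comp]
      congr 2
      exact funext hW
    have h2 : (x : 𝔄) ∈ Submodule.span Ω (Set.range fun l : List ι => (l.map a).prod) := by
      have h3 : (x : 𝔄) ∈ Subalgebra.toSubmodule B := x.2
      rw [Algebra.adjoin_eq_span] at h3
      refine Submodule.span_mono ?_ h3
      intro y hy
      obtain ⟨l, hl, rfl⟩ := Submonoid.exists_list_of_mem_closure hy
      obtain ⟨l', rfl⟩ : l ∈ Set.range (List.map a) := by rw [Set.range_list_map]; exact hl
      exact ⟨l', rfl⟩
    rw [← h1] at h2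
    obtain ⟨y, hy, hyx⟩ := h2
    rwa [show y = x from Subtype.ext hyx] at hy
  have hfin := finite_range_word_of_span_eq_top p a' (fun l hl => by
    obtain ⟨k, hk, h1⟩ := h l hl
    exact ⟨k, hk, Subtype.ext (by rw [Subalgebra.coe_pow, hW, h1]; rfl)⟩)
    (Submodule.eq_top_iff'.2 hsub)
  refine (hfin.image Subtype.val).subset ?_
  rintro _ ⟨l, rfl⟩
  exact ⟨_, ⟨l, rfl⟩, hW l⟩

end Burnside

section ScalarLines
variable {Ω V ι : Type*} [Field Ω] [AddCommGroup V] [Module Ω V]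

/-- The endomorphisms acting as a scalar on every vector of `𝒱`. -/
def diagonalOn (Ω : Type*) {V : Type*} [Field Ω] [AddCommGroup V] [Module Ω V] (𝒱 : Set V) :
    Subalgebra Ω (Module.End Ω V) where
  carrier := {d | ∀ v ∈ 𝒱, ∃ c : Ω, d v = c • v}
  mul_mem' {a b} ha hb v hv := by
    obtain ⟨c, hc⟩ := ha v hv
    obtain ⟨c', hc'⟩ := hb v hv
    exact ⟨c' * c, by rw [Module.End.mul_apply, hc', map_smul, hc, smul_smul]⟩
  add_mem' {a b} ha hb v hv := by
    obtain ⟨c, hc⟩ := ha v hv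
    obtain ⟨c', hc'⟩ := hb v hv
    exact ⟨c + c', by rw [LinearMap.add_apply, hc, hc', add_smul]⟩
  algebraMap_mem' r v _ := ⟨r, rfl⟩

theorem exists_finite_diagonalOn_eq [FiniteDimensional Ω V] (𝒱 : Set V) :
    ∃ Q : Finset V, ↑Q ⊆ 𝒱 ∧ diagonalOn Ω (Q : Set V) ≤ diagonalOn Ω 𝒱 := by
  classical
  obtain ⟨_, ⟨Q, hQ, rfl⟩, hmin⟩ := IsArtinian.set_has_minimal (R := Ω) (M := Module.End Ω V)
    {s | ∃ Q : Finset V, ↑Q ⊆ 𝒱 ∧ s = Subalgebra.toSubmodule (diagonalOn Ω (Q : Set V))}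
    ⟨_, ∅, by simp, rfl⟩
  refine ⟨Q, hQ, fun d hd v hv => ?_⟩
  have hins : (↑(insert v Q) : Set V) ⊆ 𝒱 := by
    rw [Finset.coe_insert]; exact Set.insert_subset hv hQ
  have hle : Subalgebra.toSubmodule (diagonalOn Ω (↑(insert v Q) : Set V)) ≤
      Subalgebra.toSubmodule (diagonalOn Ω (Q : Set V)) := fun e he w hw =>
    he w (by simpa using Or.inr hw)
  have heq := (hle.lt_or_eq).resolve_left (hmin _ ⟨_, hins, rfl⟩)
  have : d ∈ Subalgebra.toSubmodule (diagonalOn Ω (↑(insert v Q) : Set V)) := heq ▸ hd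
  exact this v (by simp)

theorem exists_pow_mem_diagonalOn [FiniteDimensional Ω V] {𝒱 : Set V} (u : Module.End Ω V)
    (h : ∀ v ∈ 𝒱, ∃ k, 1 ≤ k ∧ ∃ c : Ω, (u ^ k) v = c • v) :
    ∃ k, 1 ≤ k ∧ u ^ k ∈ diagonalOn Ω 𝒱 := by
  classical
  obtain ⟨Q, hQ, hle⟩ := exists_finite_diagonalOn_eq (Ω := Ω) 𝒱
  choose! k hk c hc using h
  refine ⟨∏ v ∈ Q, k v, Finset.one_le_prod' fun v hv => hk v (hQ hv), hle fun v hv => ?_⟩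
  obtain ⟨m, hm⟩ := Finset.dvd_prod_of_mem k hv
  rw [hm, pow_mul]
  have h1 : u ^ k v ∈ diagonalOn Ω {v} := fun w hw => by
    rw [Set.mem_singleton_iff.1 hw]; exact ⟨c v, hc v (hQ hv)⟩
  exact pow_mem h1 m v rfl

/-- Conjugation by a unit mapping `𝒱` to itself, on the centralizer of `diagonalOn Ω 𝒱`. -/
def conjCentralizer {𝒱 : Set V} (u : (Module.End Ω V)ˣ) (hu : ∀ v ∈ 𝒱, u.1 v ∈ 𝒱) :
    Module.End Ω (Subalgebra.toSubmodule
      (Subalgebra.centralizer Ω (diagonalOn Ω 𝒱 : Set (Module.End Ω V)))) :=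
  LinearMap.restrict (LinearMap.mulLeft Ω u.1 ∘ₗ LinearMap.mulRight Ω (u⁻¹).1) (by
    intro w hw d hd
    have h1 : (u⁻¹).1 * d * u.1 ∈ diagonalOn Ω 𝒱 := fun v hv => by
      obtain ⟨c, hc⟩ := hd _ (hu v hv)
      refine ⟨c, ?_⟩
      simp only [Module.End.mul_apply, hc, map_smul]
      rw [← Module.End.mul_apply, Units.inv_mul, Module.End.one_apply]
    have h2 : (u⁻¹).1 * d * u.1 * w = w * ((u⁻¹).1 * d * u.1) := hw _ h1
    simp only [LinearMap.comp_apply, LinearMap.mulLeft_apply, LinearMap.mulRight_apply]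
    calc d * (u.1 * (w * (u⁻¹).1)) = u.1 * ((u⁻¹).1 * d * u.1 * w) * (u⁻¹).1 := by
          simp only [mul_assoc, Units.mul_inv_cancel_left]
      _ = _ := by rw [h2]; simp only [mul_assoc, Units.mul_inv, mul_one])

variable {𝒱 : Set V}

section Units
variable (A : ι → (Module.End Ω V)ˣ) (hst : ∀ t, ∀ v ∈ 𝒱, (A t).1 v ∈ 𝒱)

theorem prod_map_conjCentralizer (l : List ι) (w) :
    (((l.map fun t => conjCentralizer (A t) (hst t)).prod w : _) : Module.End Ω V) =
      (l.map A).prod.1 * w.1 * ((l.map A).prod⁻¹).1 := by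
  induction l with
  | nil => simp
  | cons t l ih =>
    simp only [List.map_cons, List.prod_cons, Module.End.mul_apply, mul_inv_rev, Units.val_mul]
    change (A t).1 * (Subtype.val _ * (A t)⁻¹.1) = _
    rw [ih]; simp only [mul_assoc]

theorem prod_map_conjCentralizer_pow (l : List ι) (k : ℕ) (w) :
    (((l.map fun t => conjCentralizer (A t) (hst t)).prod ^ k) w : Module.End Ω V) =
      ((l.map A).prod ^ k).1 * w.1 * (((l.map A).prod ^ k)⁻¹).1 := by
  induction k with
  | zero => simp
  | succ k ih =>
    rw [pow_succ', Module.End.mul_apply, prod_map_conjCentralizer, ih, pow_succ', mul_inv_rev,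
      Units.val_mul, Units.val_mul]
    simp only [mul_assoc]

end Units

theorem smulRight_mem_centralizer [FiniteDimensional Ω V] {β : Type*} (b : Module.Basis β Ω V)
    (hb : ∀ i, b i ∈ 𝒱) {v : V} (hv : v ∈ 𝒱) {i : β} (hi : b.repr v i ≠ 0) :
    (b.coord i).smulRight v ∈ Subalgebra.centralizer Ω (diagonalOn Ω 𝒱 : Set (Module.End Ω V)) := by
  intro d hd
  choose c hc using fun j => hd _ (hb j)
  have hcoord : ∀ z, b.coord i (d z) = c i * b.coord i z := by
    intro z
    have : (b.coord i).comp d = c i • b.coord i := b.ext fun j => by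
      simp only [LinearMap.comp_apply, hc, map_smul, LinearMap.smul_apply, smul_eq_mul,
        Module.Basis.coord_apply, Module.Basis.repr_self]
      obtain rfl | h := eq_or_ne j i
      · rfl
      · simp [h.symm]
    exact LinearMap.congr_fun this z
  obtain ⟨e, he⟩ := hd v hv
  have hec : e = c i := by
    have := hcoord v
    rw [he, map_smul, smul_eq_mul] at this
    exact mul_right_cancel₀ hi this
  ext z
  simp only [Module.End.mul_apply, LinearMap.smulRight_apply, map_smul, he, hcoord, hec, smul_smul,
    mul_comm]

theorem Function.exists_finite_representatives {α β : Type*} (f : α → β)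
    (hf : (Set.range f).Finite) :
    ∃ s : Set α, s.Finite ∧ ∀ a, ∃ a' ∈ s, f a = f a' := by
  choose g hg using fun b : Set.range f => b.2
  have := hf.to_subtype
  exact ⟨Set.range g, Set.finite_range g, fun a =>
    ⟨_, ⟨⟨f a, a, rfl⟩, rfl⟩, (hg ⟨f a, a, rfl⟩).symm⟩⟩

theorem exists_finite_word_representatives_of_span_eq_top [IsAlgClosed Ω] [FiniteDimensional Ω V]
    [Finite ι] (A : ι → (Module.End Ω V)ˣ) (hst : ∀ t, ∀ v ∈ 𝒱, (A t).1 v ∈ 𝒱)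
    (p : ℕ) [Fact p.Prime] [CharP Ω p]
    (hper : ∀ v ∈ 𝒱, ∀ l : List ι, l ≠ [] →
      ∃ k, 1 ≤ k ∧ ∃ c : Ω, ((l.map A).prod ^ k).1 v = c • v)
    (hspan : Submodule.span Ω 𝒱 = ⊤) :
    ∃ 𝓛 : Set (List ι), 𝓛.Finite ∧ ∀ l : List ι, ∃ l' ∈ 𝓛, ∀ v ∈ 𝒱, ∃ c : Ω,
      (l.map A).prod.1 v = c • (l'.map A).prod.1 v := by
  have hfin := finite_range_word (Ω := Ω) p (fun t => conjCentralizer (A t) (hst t))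
    (fun l hl => by
      obtain ⟨k, hk, hd⟩ := exists_pow_mem_diagonalOn (l.map A).prod.1 (fun v hv => by
        simpa only [Units.val_pow_eq_pow_val] using hper v hv l hl)
      refine ⟨k, hk, LinearMap.ext fun w => Subtype.ext ?_⟩
      rw [prod_map_conjCentralizer_pow, Module.End.one_apply]
      rw [← Units.val_pow_eq_pow_val] at hd
      have : _ * w.1 = w.1 * _ := w.2 _ hd
      rw [this, mul_assoc, Units.mul_inv, mul_one])
  obtain ⟨𝓛, h𝓛, hrep⟩ := Function.exists_finite_representatives _ hfin
  refine ⟨𝓛, h𝓛, fun l => ?_⟩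
  obtain ⟨l', hl', heq⟩ := hrep l
  refine ⟨l', hl', fun v hv => ?_⟩
  obtain rfl | hv0 := eq_or_ne v 0
  · exact ⟨0, by simp⟩
  let b := Module.Basis.ofSpan hspan.ge
  have hb : ∀ i, b i ∈ 𝒱 := fun i => Module.Basis.ofSpan_subset hspan.ge ⟨i, rfl⟩
  obtain ⟨i, hi⟩ := Finsupp.ne_iff.1 ((map_ne_zero_iff _ b.repr.injective).2 hv0)
  rw [Finsupp.zero_apply] at hi
  have h1 := congrArg Subtype.val
    (LinearMap.congr_fun heq ⟨_, smulRight_mem_centralizer b hb hv hi⟩)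
  simp only [prod_map_conjCentralizer] at h1
  have h2 := LinearMap.congr_fun h1 ((l.map A).prod.1 (b i))
  simp only [Module.End.mul_apply] at h2
  rw [← Module.End.mul_apply (f := ((l.map A).prod⁻¹).1), Units.inv_mul] at h2
  simp only [Module.End.one_apply, LinearMap.smulRight_apply, Module.Basis.coord_apply,
    Module.Basis.repr_self, Finsupp.single_eq_same, one_smul, map_smul] at h2
  exact ⟨_, h2⟩

theorem exists_finite_word_representatives [IsAlgClosed Ω] [FiniteDimensional Ω V]
    [Finite ι] (p : ℕ) [Fact p.Prime] [CharP Ω p] (A : ι → Module.End Ω V)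
    (hinj : ∀ t, Function.Injective (A t)) (hst : ∀ t, ∀ v ∈ 𝒱, A t v ∈ 𝒱)
    (hper : ∀ v ∈ 𝒱, ∀ l : List ι, l ≠ [] →
      ∃ k, 1 ≤ k ∧ ∃ c : Ω, ((l.map A).prod ^ k) v = c • v) :
    ∃ 𝓛 : Set (List ι), 𝓛.Finite ∧ ∀ l : List ι, ∃ l' ∈ 𝓛, ∀ v ∈ 𝒱, ∃ c : Ω,
      (l.map A).prod v = c • (l'.map A).prod v := by
  let U := Submodule.span Ω 𝒱
  have hU : ∀ t, ∀ v ∈ U, A t v ∈ U := fun t => by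
    change U ≤ U.comap (A t)
    exact Submodule.span_le.2 fun v hv => Submodule.subset_span (hst t v hv)
  have hunit : ∀ t, IsUnit ((A t).restrict (hU t)) := fun t => by
    rw [Module.End.isUnit_iff]
    have hi : Function.Injective ((A t).restrict (hU t)) := fun a b h =>
      Subtype.ext (hinj t (congrArg Subtype.val h))
    exact ⟨hi, LinearMap.surjective_of_injective hi⟩
  choose B hB using hunit
  have hW : ∀ (l : List ι) (u : U), ((l.map B).prod.1 u : V) = (l.map A).prod u := by
    intro l
    induction l with
    | nil => intro u; rfl
    | cons t l ih =>
      intro u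
      simp only [List.map_cons, List.prod_cons, Units.val_mul, Module.End.mul_apply, ← ih, hB]
      rfl
  have hWk : ∀ (l : List ι) (k : ℕ) (u : U),
      (((l.map B).prod ^ k).1 u : V) = ((l.map A).prod ^ k) u := by
    intro l k
    induction k with
    | zero => intro u; rfl
    | succ k ih =>
      intro u
      rw [pow_succ', pow_succ', Units.val_mul, Module.End.mul_apply, Module.End.mul_apply, hW, ih]
  obtain ⟨𝓛, h𝓛, hrep⟩ := exists_finite_word_representatives_of_span_eq_top
    (𝒱 := (Subtype.val ⁻¹' 𝒱 : Set U)) B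
    (fun t v hv => by
      have := hst t v hv
      rwa [Set.mem_preimage, hB])
    p (fun v hv l hl => by
      obtain ⟨k, hk, c, hc⟩ := hper v hv l hl
      exact ⟨k, hk, c, Subtype.ext (by rw [hWk]; exact hc)⟩)
    (Submodule.span_span_coe_preimage)
  refine ⟨𝓛, h𝓛, fun l => ?_⟩
  obtain ⟨l', hl', h⟩ := hrep l
  refine ⟨l', hl', fun v hv => ?_⟩
  obtain ⟨c, hc⟩ := h ⟨v, Submodule.subset_span hv⟩ hv
  refine ⟨c, ?_⟩
  have := congrArg Subtype.val hc
  rw [Submodule.coe_smul, hW, hW] at this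
  exact this

end ScalarLines

section FormMap
variable {κ R Ω : Type*}

/-- The self-map of affine space with coordinates the polynomials `F`. -/
def formMap [CommSemiring R] (F : κ → MvPolynomial κ R) : Function.End (κ → R) :=
  fun v i => eval v (F i)

theorem formMap_apply [CommSemiring R] (F : κ → MvPolynomial κ R) (v : κ → R) (i : κ) :
    formMap F v i = eval v (F i) := rfl

theorem MvPolynomial.IsHomogeneous.eval_smul [CommSemiring R] {p : MvPolynomial κ R} {d : ℕ}
    (hp : p.IsHomogeneous d) (c : R) (v : κ → R) : eval (c • v) p = c ^ d * eval v p := by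
  rw [eval_eq, eval_eq, Finset.mul_sum]
  refine Finset.sum_congr rfl fun m hm => ?_
  have hd : m.degree = d := by
    rw [Finsupp.degree_eq_weight_one]; exact hp (mem_support_iff.1 hm)
  simp only [Pi.smul_apply, smul_eq_mul, mul_pow, Finset.prod_mul_distrib,
    Finset.prod_pow_eq_pow_sum]
  rw [← hd, Finsupp.degree_apply]; ring

theorem formMap_smul [CommSemiring R] {F : κ → MvPolynomial κ R} {d : ℕ}
    (hF : ∀ i, (F i).IsHomogeneous d) (c : R) (v : κ → R) :
    formMap F (c • v) = c ^ d • formMap F v :=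
  funext fun i => (hF i).eval_smul c v

theorem MvPolynomial.homogeneousComponent_mul_of_isHomogeneous [CommSemiring R]
    {p q : MvPolynomial κ R} {d : ℕ} (hq : q.IsHomogeneous d) (n : ℕ) :
    homogeneousComponent (n + d) (p * q) = homogeneousComponent n p * q := by
  conv_lhs => rw [← sum_homogeneousComponent p, Finset.sum_mul, map_sum]
  have h : ∀ i, homogeneousComponent (n + d) (homogeneousComponent i p * q) =
      if n = i then homogeneousComponent i p * q else 0 := fun i => by
    rw [homogeneousComponent_of_mem ((homogeneousComponent_isHomogeneous i p).mul hq)]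
    simp only [add_left_inj]
  simp only [h, Finset.sum_ite_eq, Finset.mem_range]
  split_ifs with hn
  · rfl
  · rw [homogeneousComponent_eq_zero _ _ (by omega), zero_mul]

theorem exists_pow_eq_sum_mul [Fintype κ] [Field Ω] [IsAlgClosed Ω] {F : κ → MvPolynomial κ Ω}
    {d : ℕ} (hF : ∀ i, (F i).IsHomogeneous d) (h0 : ∀ v, v ≠ 0 → formMap F v ≠ 0) :
    ∃ M, ∃ G : κ → κ → MvPolynomial κ Ω, (∀ i j, (G i j).IsHomogeneous M) ∧
      ∀ i, ∑ j, G i j * F j = X i ^ (M + d) := by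
  let I := Ideal.span (Set.range F)
  have hrad : ∀ i, X i ∈ I.radical := fun i => by
    rw [← vanishingIdeal_zeroLocus_eq_radical (K := Ω), mem_vanishingIdeal_iff]
    intro v hv
    have : v = 0 := by
      by_contra hv0
      refine h0 v hv0 (funext fun j => ?_)
      simpa [formMap_apply] using hv (F j) (Ideal.subset_span ⟨j, rfl⟩)
    simp [this]
  choose m hm using hrad
  let M := ∑ i, m i
  have hmem : ∀ i, X i ^ (M + d) ∈ I := fun i =>
    I.pow_mem_of_pow_mem (hm i) ((Finset.single_le_sum (fun _ _ => Nat.zero_le _)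
      (Finset.mem_univ i)).trans (Nat.le_add_right _ _))
  choose H hH using fun i => Ideal.mem_span_range_iff_exists_fun.1 (hmem i)
  refine ⟨M, fun i j => homogeneousComponent M (H i j),
    fun i j => homogeneousComponent_isHomogeneous _ _, fun i => ?_⟩
  rw [← homogeneousComponent_eq_self ((isHomogeneous_X Ω i).pow (M + d)), ← hH, map_sum]
  refine Finset.sum_congr rfl fun j _ => ?_
  rw [one_mul, homogeneousComponent_mul_of_isHomogeneous (hF j)]

end FormMap

section Fibers
variable {κ Ω : Type*} [Fintype κ] [Field Ω] [IsAlgClosed Ω] {F : κ → MvPolynomial κ Ω} {d : ℕ}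

theorem MvPolynomial.totalDegree_monomial_le' {R : Type*} [CommSemiring R] (s : κ →₀ ℕ) (c : R) :
    (monomial s c).totalDegree ≤ s.degree := by
  simpa [Finsupp.degree_eq_sum, Finsupp.sum_fintype] using totalDegree_monomial_le s c

/-- Polynomial functions on a fibre of a morphism are polynomial functions of bounded degree. -/
theorem exists_restrict_fiber_eq (hd : 1 ≤ d) (hF : ∀ i, (F i).IsHomogeneous d)
    (h0 : ∀ v, v ≠ 0 → formMap F v ≠ 0) :
    ∃ D, ∀ w : κ → Ω, ∀ p : MvPolynomial κ Ω, ∃ q : MvPolynomial κ Ω, q.totalDegree ≤ D ∧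
      ∀ v, formMap F v = w → eval v p = eval v q := by
  obtain ⟨M, G, hG, hGF⟩ := exists_pow_eq_sum_mul hF h0
  refine ⟨Fintype.card κ * (M + d), fun w => ?_⟩
  suffices h : ∀ n, ∀ p : MvPolynomial κ Ω, p.totalDegree ≤ n → ∃ q : MvPolynomial κ Ω,
      q.totalDegree ≤ Fintype.card κ * (M + d) ∧ ∀ v, formMap F v = w → eval v p = eval v q from
    fun p => h _ p le_rfl
  intro n
  induction n using Nat.strong_induction_on with
  | _ n ih =>
    intro p hp
    have hmon : ∀ s ∈ p.support, ∃ q : MvPolynomial κ Ω, q.totalDegree ≤ Fintype.card κ * (M + d) ∧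
        ∀ v, formMap F v = w → eval v (monomial s (coeff s p)) = eval v q := by
      intro s hs
      have hsn : s.degree ≤ n := by
        rw [Finsupp.degree_eq_sum]
        simpa [Finsupp.sum_fintype] using (le_totalDegree hs).trans hp
      by_cases hsD : s.degree ≤ Fintype.card κ * (M + d)
      · exact ⟨_, (totalDegree_monomial_le' _ _).trans hsD, fun _ _ => rfl⟩
      obtain ⟨i, hi⟩ : ∃ i, M + d ≤ s i := by
        by_contra! hlt
        refine hsD ?_
        rw [Finsupp.degree_eq_sum]
        refine (Finset.sum_le_card_nsmul _ _ (M + d) fun i _ => (hlt i).le).trans ?_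
        simp
      let s' := s - Finsupp.single i (M + d)
      have hs' : s = s' + Finsupp.single i (M + d) := 
        (tsub_add_cancel_of_le (Finsupp.single_le_iff.2 hi)).symm
      have hdeg : s.degree = s'.degree + (M + d) := by
        conv_lhs => rw [hs', map_add, Finsupp.degree_single]
      let r := monomial s' (coeff s p) * ∑ j, C (w j) * G i j
      obtain ⟨q, hq, hqv⟩ := ih (s'.degree + M) (by omega) r (by
        refine (totalDegree_mul _ _).trans (add_le_add (totalDegree_monomial_le' _ _) ?_)
        refine totalDegree_finsetSum_le fun j _ => ?_
        refine (totalDegree_mul _ _).trans ?_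
        rw [totalDegree_C, zero_add]
        exact (hG i j).totalDegree_le)
      refine ⟨q, hq, fun v hv => ?_⟩
      rw [← hqv v hv, hs']
      have h1 : monomial (s' + Finsupp.single i (M + d)) (coeff (s' + Finsupp.single i (M + d)) p) =
          monomial s' (coeff s p) * X i ^ (M + d) := by
        rw [X_pow_eq_monomial, monomial_mul, mul_one, ← hs']
      rw [h1, ← hGF]
      simp only [r, map_mul, map_sum, eval_C, ← hv, formMap_apply, mul_comm]
    choose! q hq hqv using hmon
    refine ⟨∑ s ∈ p.support, q s, totalDegree_finsetSum_le hq, fun v hv => ?_⟩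
    conv_lhs => rw [p.as_sum]
    rw [map_sum, map_sum]
    exact Finset.sum_congr rfl fun s hs => hqv s hs v hv

theorem finite_fiber_formMap (hd : 1 ≤ d) (hF : ∀ i, (F i).IsHomogeneous d)
    (h0 : ∀ v, v ≠ 0 → formMap F v ≠ 0) (w : κ → Ω) : {v | formMap F v = w}.Finite := by
  obtain ⟨D, hD⟩ := exists_restrict_fiber_eq hd hF h0
  let Z := {v | formMap F v = w}
  let ev : MvPolynomial κ Ω →ₐ[Ω] (Z → Ω) := AlgHom.pi fun z => aeval z.1
  have hev : ∀ p z, ev p z = eval z.1 p := fun p z => rfl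
  have hrange : Subalgebra.toSubmodule ev.range =
      (restrictTotalDegree κ Ω D).map ev.toLinearMap := by
    refine le_antisymm ?_ ?_
    · rintro _ ⟨p, rfl⟩
      obtain ⟨q, hq, hqv⟩ := hD w p
      refine ⟨q, (mem_restrictTotalDegree κ D q).2 hq, funext fun z => (hqv z.1 z.2).symm⟩
    · rintro _ ⟨p, -, rfl⟩
      exact ⟨p, rfl⟩
  have hfin : FiniteDimensional Ω ev.range := by
    change Module.Finite Ω (Subalgebra.toSubmodule ev.range)
    rw [hrange]
    infer_instance
  refine (Set.Finite.pi' (t := fun i => (fun v : κ → Ω => v i) '' Z) fun i => ?_).subset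
    fun v hv i => ⟨v, hv, rfl⟩
  obtain ⟨q, hq, hq0⟩ := Algebra.IsIntegral.isIntegral (R := Ω) (⟨ev (X i), X i, rfl⟩ : ev.range)
  refine (q.rootSet_finite Ω).subset ?_
  rintro _ ⟨v, hv, rfl⟩
  rw [Polynomial.mem_rootSet]
  refine ⟨hq.ne_zero, ?_⟩
  have h1 : Polynomial.aeval (⟨ev (X i), X i, rfl⟩ : ev.range) q = 0 := hq0
  have h2 := congrArg
    (fun f : ev.range => ((Pi.evalAlgHom Ω (fun _ : Z => Ω) ⟨v, hv⟩).comp ev.range.val) f) h1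
  simp only [map_zero, ← Polynomial.aeval_algHom_apply] at h2
  simpa [hev] using h2

theorem finite_lines_fiber_formMap (hd : 1 ≤ d) (hF : ∀ i, (F i).IsHomogeneous d)
    (h0 : ∀ v, v ≠ 0 → formMap F v ≠ 0) (w : κ → Ω) :
    ((fun v => Submodule.span Ω {v}) ''
      {v : κ → Ω | v ≠ 0 ∧ Submodule.span Ω {formMap F v} = Submodule.span Ω {w}}).Finite := by
  refine ((finite_fiber_formMap hd hF h0 w).image fun v => Submodule.span Ω {v}).subset ?_
  rintro _ ⟨v, ⟨hv0, hv⟩, rfl⟩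
  obtain ⟨c, hc⟩ := Submodule.span_singleton_eq_span_singleton.1 hv
  obtain ⟨e, he⟩ := IsAlgClosed.exists_pow_nat_eq (c : Ω) hd
  have he0 : e ≠ 0 := by
    rintro rfl
    rw [zero_pow (by omega)] at he
    exact c.ne_zero he.symm
  refine ⟨e • v, ?_, Submodule.span_singleton_smul_eq (IsUnit.mk0 e he0) v⟩
  change formMap F (e • v) = w
  rw [formMap_smul hF, he, ← hc]
  rfl

end Fibers

section Words
variable {ι κ R S : Type*}

/-- The composite of the maps `formMap (f t)` along a word. -/
def wordMap [CommSemiring R] (f : ι → κ → MvPolynomial κ R) (l : List ι) : Function.End (κ → R) :=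
  (l.map fun t => formMap (f t)).prod

theorem wordMap_nil [CommSemiring R] (f : ι → κ → MvPolynomial κ R) (v : κ → R) :
    wordMap f [] v = v := rfl

theorem wordMap_cons [CommSemiring R] (f : ι → κ → MvPolynomial κ R) (t : ι) (l : List ι)
    (v : κ → R) : wordMap f (t :: l) v = formMap (f t) (wordMap f l v) := by
  simp only [wordMap, List.map_cons, List.prod_cons]; rfl

theorem wordMap_append [CommSemiring R] (f : ι → κ → MvPolynomial κ R) (l l' : List ι)
    (v : κ → R) : wordMap f (l ++ l') v = wordMap f l (wordMap f l' v) := by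
  simp only [wordMap, List.map_append, List.prod_append]; rfl

theorem wordMap_pow [CommSemiring R] (f : ι → κ → MvPolynomial κ R) (l : List ι) (k : ℕ) :
    wordMap f l ^ k = wordMap f (List.replicate k l).flatten := by
  induction k with
  | zero => rfl
  | succ k ih =>
    funext v
    rw [pow_succ', List.replicate_succ, List.flatten_cons, wordMap_append, ← ih]; rfl

/-- The degree of the composite along a word of forms of degrees `d t`. -/
def wordDegree (d : ι → ℕ) (l : List ι) : ℕ := (l.map d).prod

theorem wordMap_smul [CommSemiring R] {f : ι → κ → MvPolynomial κ R} {d : ι → ℕ}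
    (hf : ∀ t i, (f t i).IsHomogeneous (d t)) (l : List ι) (c : R) (v : κ → R) :
    wordMap f l (c • v) = c ^ wordDegree d l • wordMap f l v := by
  induction l with
  | nil => simp [wordMap_nil, wordDegree]
  | cons t l ih =>
    rw [wordMap_cons, ih, formMap_smul (hf t), wordMap_cons, ← pow_mul, mul_comm]
    simp [wordDegree]

theorem formMap_map [CommSemiring R] [CommSemiring S] (g : R →+* S) (F : κ → MvPolynomial κ R)
    (v : κ → R) : formMap (fun i => map g (F i)) (g ∘ v) = g ∘ formMap F v :=
  funext fun i => by simp [formMap_apply, eval_map, eval₂_comp]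

theorem wordMap_map [CommSemiring R] [CommSemiring S] (g : R →+* S)
    (f : ι → κ → MvPolynomial κ R) (l : List ι) (v : κ → R) :
    wordMap (fun t i => map g (f t i)) l (g ∘ v) = g ∘ wordMap f l v := by
  induction l with
  | nil => rfl
  | cons t l ih => rw [wordMap_cons, ih, formMap_map, wordMap_cons]

end Words

theorem eval_add_sub_mem {κ R : Type*} [CommRing R] (p : MvPolynomial κ R) {I : Ideal R}
    (v : κ → R) {h : κ → R}
    (hh : ∀ i, h i ∈ I) : eval (v + h) p - eval v p ∈ I := by
  rw [← Ideal.Quotient.eq, ← eval₂_id, ← eval₂_id, hom_eval₂, hom_eval₂]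
  congr 1
  funext i
  exact Ideal.Quotient.eq.2 (by simpa using hh i)

section Tangent
variable {ι κ R S : Type*} [Fintype κ] [CommRing R] [CommRing S]

/-- The Jacobian of `formMap F` at a point. -/
def jacobianMap (F : κ → MvPolynomial κ R) (v : κ → R) : (κ → R) →ₗ[R] (κ → R) :=
  (Matrix.of fun i j => eval v (pderiv j (F i))).mulVecLin

theorem jacobianMap_apply (F : κ → MvPolynomial κ R) (v h : κ → R) (i : κ) :
    jacobianMap F v h i = ∑ j, eval v (pderiv j (F i)) * h j := rfl

/-- The Jacobian of a composite along a word. -/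
def wordJacobian (f : ι → κ → MvPolynomial κ R) : List ι → (κ → R) → (κ → R) →ₗ[R] (κ → R)
  | [], _ => LinearMap.id
  | t :: l, v => jacobianMap (f t) (wordMap f l v) ∘ₗ wordJacobian f l v

/-- The tangent map of `formMap F`. -/
def formTangent (F : κ → MvPolynomial κ R) : Function.End ((κ → R) × (κ → R)) :=
  fun q => (formMap F q.1, jacobianMap F q.1 q.2)

/-- The tangent map of a composite along a word. -/
def wordTangent (f : ι → κ → MvPolynomial κ R) (l : List ι) :
    Function.End ((κ → R) × (κ → R)) :=
  (l.map fun t => formTangent (f t)).prod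

theorem wordTangent_apply (f : ι → κ → MvPolynomial κ R) (l : List ι) (q : (κ → R) × (κ → R)) :
    wordTangent f l q = (wordMap f l q.1, wordJacobian f l q.1 q.2) := by
  induction l with
  | nil => rfl
  | cons t l ih =>
    have : wordTangent f (t :: l) q = formTangent (f t) (wordTangent f l q) := by
      simp only [wordTangent, List.map_cons, List.prod_cons]; rfl
    rw [this, ih, wordMap_cons]; rfl

theorem wordTangent_append (f : ι → κ → MvPolynomial κ R) (l l' : List ι) :
    wordTangent f (l ++ l') = wordTangent f l * wordTangent f l' := by
  simp [wordTangent]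

theorem jacobianMap_smul {F : κ → MvPolynomial κ R} {d : ℕ} (hd : 1 ≤ d)
    (hF : ∀ i, (F i).IsHomogeneous d) (c : R) (v h : κ → R) :
    c • jacobianMap F (c • v) h = c ^ d • jacobianMap F v h := by
  funext i
  obtain ⟨e, rfl⟩ := Nat.exists_eq_add_of_le' hd
  simp only [Pi.smul_apply, smul_eq_mul, jacobianMap_apply, Finset.mul_sum]
  refine Finset.sum_congr rfl fun j _ => ?_
  rw [((hF i).pderiv (i := j)).eval_smul, Nat.add_sub_cancel]; ring

theorem jacobianMap_self {F : κ → MvPolynomial κ R} {d : ℕ}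
    (hF : ∀ i, (F i).IsHomogeneous d) (v : κ → R) :
    jacobianMap F v v = (d : R) • formMap F v := by
  funext i
  have := congrArg (eval v) (hF i).sum_X_mul_pderiv
  simp only [map_sum, map_mul, eval_X, nsmul_eq_mul, map_natCast] at this
  rw [Pi.smul_apply, smul_eq_mul, formMap_apply, ← this, jacobianMap_apply]
  exact Finset.sum_congr rfl fun j _ => mul_comm _ _

variable {f : ι → κ → MvPolynomial κ R} {d : ι → ℕ}

theorem wordJacobian_smul (hd : ∀ t, 1 ≤ d t) (hf : ∀ t i, (f t i).IsHomogeneous (d t))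
    (l : List ι) (c : R) (v h : κ → R) :
    c • wordJacobian f l (c • v) h = c ^ wordDegree d l • wordJacobian f l v h := by
  induction l with
  | nil => simp [wordJacobian, wordDegree]
  | cons t l ih =>
    have h1 : wordDegree d (t :: l) = wordDegree d l * d t := by simp [wordDegree, mul_comm]
    rw [wordJacobian, wordJacobian, LinearMap.comp_apply, LinearMap.comp_apply, ← map_smul, ih,
      wordMap_smul hf, map_smul, jacobianMap_smul (hd t) (hf t), h1, pow_mul]

theorem wordJacobian_self (hf : ∀ t i, (f t i).IsHomogeneous (d t)) (l : List ι) (v : κ → R) :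
    wordJacobian f l v v = (wordDegree d l : R) • wordMap f l v := by
  induction l with
  | nil => simp [wordJacobian, wordDegree, wordMap_nil]
  | cons t l ih =>
    rw [wordJacobian, LinearMap.comp_apply, ih, map_smul, jacobianMap_self (hf t), smul_smul,
      wordMap_cons]
    simp [wordDegree, mul_comm]

theorem jacobianMap_map (g : R →+* S) (F : κ → MvPolynomial κ R) (v h : κ → R) :
    jacobianMap (fun i => map g (F i)) (g ∘ v) (g ∘ h) = g ∘ jacobianMap F v h :=
  funext fun i => by
    simp [jacobianMap_apply, pderiv_map, eval_map, eval₂_comp]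

theorem wordJacobian_map (g : R →+* S) (l : List ι) (v h : κ → R) :
    wordJacobian (fun t i => map g (f t i)) l (g ∘ v) (g ∘ h) = g ∘ wordJacobian f l v h := by
  induction l with
  | nil => rfl
  | cons t l ih =>
    rw [wordJacobian, LinearMap.comp_apply, ih, wordMap_map, jacobianMap_map]; rfl

theorem LinearMap.apply_mem_mul {I J : Ideal R} (L : (κ → R) →ₗ[R] (κ → R))
    (hL : ∀ h i, L h i ∈ J) {h : κ → R} (hh : ∀ i, h i ∈ I) (i : κ) : L h i ∈ I * J := by
  classical
  have : h = ∑ j, h j • Pi.single j (1 : R) := by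
    funext k; simp [Finset.sum_apply, Pi.single_apply]
  rw [this, map_sum, Finset.sum_apply]
  refine Ideal.sum_mem _ fun j _ => ?_
  rw [map_smul, Pi.smul_apply, smul_eq_mul]
  exact Ideal.mul_mem_mul (hh j) (hL _ i)

theorem LinearMap.apply_mem_ideal {I : Ideal R} (L : (κ → R) →ₗ[R] (κ → R))
    {h : κ → R} (hh : ∀ i, h i ∈ I) (i : κ) : L h i ∈ I := by
  simpa using L.apply_mem_mul (J := ⊤) (fun _ _ => trivial) hh i

theorem eval_add_sub_sub_mem (p : MvPolynomial κ R) {I : Ideal R} (v : κ → R) {h : κ → R}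
    (hh : ∀ i, h i ∈ I) :
    eval (v + h) p - eval v p - ∑ j, eval v (pderiv j p) * h j ∈ I ^ 2 := by
  classical
  induction p using MvPolynomial.induction_on with
  | C a => simp
  | add p q hp hq =>
    have : eval (v + h) (p + q) - eval v (p + q) - ∑ j, eval v (pderiv j (p + q)) * h j =
        (eval (v + h) p - eval v p - ∑ j, eval v (pderiv j p) * h j) +
        (eval (v + h) q - eval v q - ∑ j, eval v (pderiv j q) * h j) := by
      simp only [map_add, add_mul, Finset.sum_add_distrib]; ring
    rw [this]; exact add_mem hp hq
  | mul_X p i hp =>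
    have h1 : ∑ j, eval v (pderiv j (p * X i)) * h j =
        (∑ j, eval v (pderiv j p) * h j) * v i + eval v p * h i := by
      simp only [pderiv_mul, pderiv_X, map_add, map_mul, eval_X, add_mul, Finset.sum_add_distrib,
        Finset.sum_mul]
      congr 1
      · exact Finset.sum_congr rfl fun j _ => by ring
      · rw [Finset.sum_eq_single i]
        · simp
        · intro j _ hj; simp [hj.symm]
        · simp
    have : eval (v + h) (p * X i) - eval v (p * X i) - ∑ j, eval v (pderiv j (p * X i)) * h j =
        (eval (v + h) p - eval v p - ∑ j, eval v (pderiv j p) * h j) * v i +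
          (eval (v + h) p - eval v p) * h i := by
      rw [h1]; simp only [map_mul, eval_X, Pi.add_apply]; ring
    rw [this, pow_two]
    refine add_mem (Ideal.mul_mem_right _ _ (by rwa [← pow_two])) (Ideal.mul_mem_mul ?_ (hh i))
    exact eval_add_sub_mem p v hh

/-- First-order expansion of a composite of polynomial maps. -/
theorem wordMap_add_sub_sub_mem {I : Ideal R} (l : List ι) (v : κ → R) {h : κ → R}
    (hh : ∀ i, h i ∈ I) (i : κ) :
    (wordMap f l (v + h) - wordMap f l v - wordJacobian f l v h) i ∈ I ^ 2 := by
  induction l generalizing i with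
  | nil => simp [wordMap_nil, wordJacobian]
  | cons t l ih =>
    obtain ⟨r, hr⟩ : ∃ r, r = wordMap f l (v + h) - wordMap f l v - wordJacobian f l v h := ⟨_, rfl⟩
    rw [← hr] at ih
    have he : ∀ i, (wordJacobian f l v h + r) i ∈ I := fun i =>
      add_mem ((wordJacobian f l v).apply_mem_ideal hh i) (Ideal.pow_le_self two_ne_zero (ih i))
    have h1 : wordMap f l (v + h) = wordMap f l v + (wordJacobian f l v h + r) := by rw [hr]; ring
    have h2 := eval_add_sub_sub_mem (f t i) (wordMap f l v) he
    rw [← jacobianMap_apply] at h2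
    convert add_mem h2 ((jacobianMap (f t) (wordMap f l v)).apply_mem_ideal ih i) using 1
    rw [wordMap_cons, wordMap_cons, h1]
    simp only [map_add, Pi.add_apply, Pi.sub_apply, wordJacobian, LinearMap.comp_apply,
      formMap_apply]
    ring

end Tangent

theorem exists_wordMap_notMem {ι κ A : Type*} [CommRing A] {m : Ideal A}
    {f : ι → κ → MvPolynomial κ A}
    (hnz : ∀ t v, (∃ i, v i ∉ m) → ∃ i, formMap (f t) v i ∉ m) (l : List ι) {v : κ → A}
    (hv : ∃ i, v i ∉ m) : ∃ i, wordMap f l v i ∉ m := by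
  induction l with
  | nil => exact hv
  | cons t l ih => rw [wordMap_cons]; exact hnz _ _ ih

section Rigidity
variable {ι κ A : Type*} [Fintype κ] [CommRing A] {m : Ideal A}

/-- A periodic sequence whose successive differences are, to first order, transported by a map
that is idempotent modulo `m` is constant, provided the period is a unit. -/
theorem eq_of_periodic_of_idempotent (hm : ∀ a ∉ m, IsUnit a) (hK : ⨅ n, m ^ n = ⊥)
    (L : (κ → A) →ₗ[A] (κ → A)) (hL : ∀ h i, (L (L h) - L h) i ∈ m)
    {P : ℕ → κ → A} {k : ℕ} (hk : (k : A) ∉ m) (hP : ∀ j, P (j + k) = P j)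
    (h1 : ∀ j i, (P (j + 1) - P j) i ∈ m)
    (hs : ∀ s, 1 ≤ s → (∀ j i, (P (j + 1) - P j) i ∈ m ^ s) →
      ∀ j i, (P (j + 2) - P (j + 1) - L (P (j + 1) - P j)) i ∈ m ^ (s + 1)) (j : ℕ) :
    P j = P 0 := by
  have hk0 : 1 ≤ k := Nat.one_le_iff_ne_zero.2 fun h => hk (by simp [h])
  have key : ∀ s, 1 ≤ s → ∀ j i, (P (j + 1) - P j) i ∈ m ^ s := by
    intro s hs1
    induction s, hs1 using Nat.le_induction with
    | base => simpa using h1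
    | succ s hs1 ih =>
      have h2 : ∀ j i,
          (P (j + 2 + 1) - P (j + 2) - (P (j + 1 + 1) - P (j + 1))) i ∈ m ^ (s + 1) := by
        intro j i
        have e1 := hs s hs1 ih j
        have e2 := hs s hs1 ih (j + 1) i
        have e3 := L.apply_mem_ideal e1 i
        have e4 := (L ∘ₗ L - L).apply_mem_mul (I := m ^ s) (J := m) (fun h i => hL h i) (ih j) i
        rw [← pow_succ] at e4
        convert sub_mem (add_mem (add_mem e2 e3) e4) (e1 i) using 1
        simp only [map_sub, LinearMap.sub_apply, LinearMap.comp_apply, Pi.sub_apply]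
        ring
      have h3 : ∀ j i, (P (j + 2) - P (j + 1) - (P 2 - P 1)) i ∈ m ^ (s + 1) := by
        intro j i
        induction j with
        | zero => simp
        | succ j ihj =>
          convert add_mem (h2 j i) ihj using 1
          simp only [Pi.sub_apply, add_assoc, Nat.reduceAdd]; ring
      have h4 : ∀ i, (P 2 - P 1) i ∈ m ^ (s + 1) := by
        intro i
        have e1 : ∑ j ∈ Finset.range k, (P (j + 2) - P (j + 1) - (P 2 - P 1)) i ∈ m ^ (s + 1) :=
          Ideal.sum_mem _ fun j _ => h3 j i
        have e2 : ∑ j ∈ Finset.range k, (P (j + 2) - P (j + 1)) = 0 := by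
          have := Finset.sum_range_sub (fun j => P (j + 1)) k
          simp only [add_assoc, Nat.reduceAdd] at this
          rw [this, add_comm k 1, hP]; simp
        have e3 : ∑ j ∈ Finset.range k, (P (j + 2) - P (j + 1) - (P 2 - P 1)) i =
            -(k * (P 2 - P 1) i) := by
          rw [← Finset.sum_apply, Finset.sum_sub_distrib, e2]; simp; ring
        rw [e3, neg_mem_iff] at e1
        exact (Ideal.unit_mul_mem_iff_mem _ (hm _ hk)).1 e1
      intro j i
      have h5 := add_mem (h3 (j + k - 1) i) (h4 i)
      have e1 : j + k - 1 + 2 = j + 1 + k := by omega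
      have e2 : j + k - 1 + 1 = j + k := by omega
      simpa [e1, e2, hP] using h5
  have hD : ∀ j, P (j + 1) = P j := fun j => funext fun i => sub_eq_zero.1 <| by
    have : (P (j + 1) - P j) i ∈ ⨅ n, m ^ n := by
      refine (Submodule.mem_iInf _).2 fun n => ?_
      rcases Nat.eq_zero_or_pos n with rfl | hn
      · simp
      · exact key n hn j i
    rw [hK] at this
    simpa using this
  induction j with
  | zero => rfl
  | succ j ih => rw [hD, ih]

variable {f : ι → κ → MvPolynomial κ A} {d : ι → ℕ}

theorem wordJacobian_sub_mem (l : List ι) {v v' : κ → A} (hv : ∀ i, (v - v') i ∈ m)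
    (h : κ → A) (i : κ) : (wordJacobian f l v h - wordJacobian f l v' h) i ∈ m := by
  have h1 : Ideal.Quotient.mk m ∘ v = Ideal.Quotient.mk m ∘ v' :=
    funext fun i => Ideal.Quotient.eq.2 (hv i)
  have h2 := wordJacobian_map (Ideal.Quotient.mk m) (f := f) l v h
  rw [h1, wordJacobian_map] at h2
  exact Ideal.Quotient.eq.1 (congrFun h2.symm i)

theorem one_le_wordDegree (hd : ∀ t, 1 ≤ d t) (l : List ι) : 1 ≤ wordDegree d l := by
  induction l with
  | nil => simp [wordDegree]
  | cons t l ih =>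
    simp only [wordDegree, List.map_cons, List.prod_cons]
    exact Nat.mul_pos (hd t) ih

/-- If the tangent map of a word is idempotent over the residue field, then a periodic line whose
period is prime to the residue characteristic is mapped to a fixed line. -/
theorem parallel_of_idempotent_tangent [IsDomain A] (hm : ∀ a ∉ m, IsUnit a)
    (hK : ⨅ n, m ^ n = ⊥) (hd : ∀ t, 1 ≤ d t) (hf : ∀ t i, (f t i).IsHomogeneous (d t))
    (hnz : ∀ t v, (∃ i, v i ∉ m) → ∃ i, formMap (f t) v i ∉ m) (l : List ι)
    (hg : ∀ v i, (wordMap f l (wordMap f l v) - wordMap f l v) i ∈ m)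
    (hJ : ∀ v h i, (wordJacobian f l (wordMap f l v) (wordJacobian f l v h) -
      wordJacobian f l v h) i ∈ m)
    {X : κ → A} (hX : ∃ i, X i ∉ m) {k : ℕ} (hk : (k : A) ∉ m) {c : A}
    (hper : (wordMap f l ^ k) X = c • X) : Parallel (wordMap f l X) X := by
  have hk0 : 1 ≤ k := Nat.one_le_iff_ne_zero.2 fun h => hk (by simp [h])
  obtain ⟨e, he⟩ := Nat.exists_eq_add_of_le' (one_le_wordDegree hd l)
  obtain ⟨Y, hYdef⟩ : ∃ Y : ℕ → κ → A, Y = fun j => (wordMap f l ^ (j + 1)) X := ⟨_, rfl⟩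
  have hYs : ∀ j, Y (j + 1) = wordMap f l (Y j) := fun j => by
    rw [hYdef]; simp only [pow_succ' _ (j + 1)]; rfl
  have hY1 : ∀ j i, (Y (j + 1) - Y j) i ∈ m := fun j i => by
    rw [hYs, hYdef]; simp only [pow_succ' _ j]; exact hg _ i
  have hY0 : ∀ j i, (Y j - Y 0) i ∈ m := fun j i => by
    induction j with
    | zero => simp
    | succ j ih => convert add_mem (hY1 j i) ih using 1; simp
  have hYX : Y 0 = wordMap f l X := by rw [hYdef]; simp
  obtain ⟨i₀, hi₀⟩ : ∃ i, Y 0 i ∉ m := hYX ▸ exists_wordMap_notMem hnz l hX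
  have hYn : ∀ j, Y j i₀ ∉ m := fun j h => hi₀ <| by
    convert sub_mem h (hY0 j i₀) using 1; simp
  have hu : ∀ j, ∃ u, u * Y j i₀ = 1 := fun j => (hm _ (hYn j)).exists_left_inv
  choose u hu using hu
  have hYper : ∀ j, ∃ a, Y (j + k) = a • Y j := fun j => by
    refine ⟨c ^ wordDegree d (List.replicate (j + 1) l).flatten, ?_⟩
    have : (wordMap f l ^ (j + k + 1)) X = (wordMap f l ^ (j + 1)) ((wordMap f l ^ k) X) := by
      rw [show j + k + 1 = j + 1 + k by ring, pow_add]; rfl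
    rw [hYdef]; simp only [this, hper]
    rw [wordMap_pow, wordMap_smul hf]
  obtain ⟨P, hPdef⟩ : ∃ P : ℕ → κ → A, P = fun j => u j • Y j := ⟨_, rfl⟩
  have hP1 : ∀ j, P j i₀ = 1 := fun j => by simp [hPdef, hu]
  have hPper : ∀ j, P (j + k) = P j := fun j => by
    obtain ⟨a, ha⟩ := hYper j
    have h1 := hu (j + k)
    rw [ha, Pi.smul_apply, smul_eq_mul, ← mul_assoc] at h1
    have h2 : u (j + k) * a = u j :=
      mul_right_cancel₀ (right_ne_zero_of_mul_eq_one h1) (h1.trans (hu j).symm)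
    simp only [hPdef, ha, smul_smul, h2]
  let q := Ideal.Quotient.mk m
  have hqY : ∀ j i, q (Y j i) = q (Y 0 i) := fun j i => Ideal.Quotient.eq.2 (hY0 j i)
  have hqu : ∀ j, q (u j) = q (u 0) := fun j => by
    have h1 : q (u j) * q (Y 0 i₀) = 1 := by rw [← hqY j, ← map_mul, hu, map_one]
    have h2 : q (u 0) * q (Y 0 i₀) = 1 := by rw [← map_mul, hu, map_one]
    exact left_inv_eq_right_inv h1 (by rw [mul_comm, h2])
  have hqP : ∀ j i, (P j - P 0) i ∈ m := fun j i => Ideal.Quotient.eq.1 <| by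
    change q _ = q _
    simp only [hPdef, Pi.smul_apply, smul_eq_mul, map_mul, hqu j, hqY j]
  obtain ⟨b, hbdef⟩ : ∃ b : ℕ → A, b = fun j => u j ^ (e + 1) * Y (j + 1) i₀ := ⟨_, rfl⟩
  have hb : ∀ j, b j - u 0 ^ e ∈ m := fun j => Ideal.Quotient.eq.1 <| by
    change q _ = q _
    have h2 : q (u 0) * q (Y 0 i₀) = 1 := by rw [← map_mul, hu, map_one]
    simp only [hbdef, map_mul, map_pow, hqu j, hqY (j + 1)]
    rw [pow_succ, mul_assoc, h2, mul_one]
  have hgP : ∀ j, wordMap f l (P j) = b j • P (j + 1) := fun j => by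
    simp only [hPdef, wordMap_smul hf, ← hYs, smul_smul, he, hbdef]
    rw [mul_assoc, mul_comm (Y _ _), hu, mul_one]
  have hJP : ∀ h, wordJacobian f l (P 0) h = u 0 ^ e • wordJacobian f l (Y 0) h := fun h => by
    have h1 := wordJacobian_smul hd hf l (u 0) (Y 0) h
    have hu0 : u 0 ≠ 0 := left_ne_zero_of_mul_eq_one (hu 0)
    rw [he, pow_succ', mul_smul] at h1
    simpa only [hPdef] using smul_right_injective _ hu0 h1
  obtain ⟨J, hJdef⟩ : ∃ J, J = wordJacobian f l (Y 0) := ⟨_, rfl⟩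
  have hJJ : ∀ h i, (J (J h) - J h) i ∈ m := fun h i => by
    have h1 := hJ (Y 0) h i
    rw [← hYs, ← hJdef] at h1
    have h2 := wordJacobian_sub_mem (f := f) l (hY1 0) (J h) i
    rw [← hJdef] at h2
    convert sub_mem h1 h2 using 1
    simp only [Pi.sub_apply, zero_add]; ring
  have hJy : ∀ i, (J (P 0) - (wordDegree d l : A) • P 0) i ∈ m := fun i => by
    have h1 : J (P 0) = (u 0 * wordDegree d l) • Y 1 := by
      simp only [hPdef, map_smul, hJdef, wordJacobian_self hf, ← hYs, smul_smul, zero_add]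
    convert Ideal.mul_mem_left m (u 0 * wordDegree d l) (hY1 0 i) using 1
    rw [h1]
    simp only [hPdef, Pi.sub_apply, Pi.smul_apply, smul_eq_mul, zero_add]; ring
  have huu : IsUnit (u 0 ^ e) := (IsUnit.of_mul_eq_one _ (hu 0)).pow _
  let L : (κ → A) →ₗ[A] (κ → A) := J - (LinearMap.proj i₀ ∘ₗ J).smulRight (P 0)
  have hLa : ∀ h i, L h i = J h i - J h i₀ * P 0 i := fun h i => rfl
  have hconst := eq_of_periodic_of_idempotent hm hK L ?_ hk hPper ?_ ?_
  · have h1 : Y (k - 1) = c • X := by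
      rw [hYdef]
      simp only [Nat.sub_add_cancel hk0, hper]
    have h2 := congrArg (Y 0 i₀ • ·) (hconst (k - 1))
    simp only [hPdef, h1, smul_smul, mul_comm (Y 0 i₀) (u 0), hu, one_smul] at h2
    rw [← hYX, ← h2]
    exact parallel_smul_left _ _
  · intro h i
    have e1 := hJJ h
    have hL : L h = J h - J h i₀ • P 0 := rfl
    rw [Pi.sub_apply, hLa, hLa, hL]
    convert add_mem (sub_mem (sub_mem (e1 i) (Ideal.mul_mem_left m (J h i₀) (hJy i)))
      (Ideal.mul_mem_right (P 0 i) m (e1 i₀))) (Ideal.mul_mem_right (P 0 i) m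
        (Ideal.mul_mem_left m (J h i₀) (hJy i₀))) using 1
    simp only [map_sub, map_smul, Pi.sub_apply, Pi.smul_apply, smul_eq_mul, hP1]
    ring
  · intro j i
    convert sub_mem (hqP (j + 1) i) (hqP j i) using 1
    simp
  · intro s hs hD j
    obtain ⟨h, hh⟩ : ∃ h, h = P (j + 1) - P j := ⟨_, rfl⟩
    have hhm : ∀ i, h i ∈ m ^ s := hh ▸ hD j
    have hle : (m ^ s) ^ 2 ≤ m ^ (s + 1) := by
      rw [← pow_mul]; exact Ideal.pow_le_pow_right (by omega)
    have e1 : ∀ i, (b (j + 1) • P (j + 2) - b j • P (j + 1) - u 0 ^ e • J h) i ∈ m ^ (s + 1) := by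
      intro i
      have h1 := hle (wordMap_add_sub_sub_mem (f := f) l (P j) hhm i)
      rw [show P j + h = P (j + 1) by rw [hh]; ring, hgP, hgP] at h1
      have h2 := (wordJacobian f l (P j) - wordJacobian f l (P 0)).apply_mem_mul (J := m)
        (fun h i => wordJacobian_sub_mem (f := f) l (hqP j) h i) hhm i
      rw [← pow_succ, LinearMap.sub_apply, hJP, ← hJdef] at h2
      convert add_mem h1 h2 using 1
      simp only [Pi.sub_apply]; ring
    have e2 := e1 i₀
    simp only [Pi.sub_apply, Pi.smul_apply, smul_eq_mul, hP1, mul_one] at e2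
    intro i
    rw [← Ideal.unit_mul_mem_iff_mem _ huu]
    have e3 := Ideal.mul_mem_mul (hD (j + 1) i) (hb (j + 1))
    have e4 := Ideal.mul_mem_mul (J.apply_mem_ideal hhm i₀) (hqP (j + 1) i)
    rw [← pow_succ] at e3 e4
    convert sub_mem (sub_mem (sub_mem (e1 i) e3) (Ideal.mul_mem_right (P (j + 1) i) _ e2))
      (Ideal.mul_mem_left _ (u 0 ^ e) e4) using 1
    simp only [← hh, Pi.sub_apply, Pi.smul_apply, smul_eq_mul, hLa]
    ring

end Rigidity

section LocalSubring

theorem Int.isJacobsonRing : IsJacobsonRing ℤ := by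
  refine isJacobsonRing_iff_prime_eq.2 fun P hP => ?_
  obtain rfl | hP0 := eq_or_ne P ⊥
  · refine (Submodule.eq_bot_iff _).2 fun x hx => ?_
    by_contra h
    have : 0 < x ^ 2 := by positivity
    rcases Int.isUnit_iff.1 (Ideal.mem_jacobson_bot.1 hx (3 * x)) with h | h <;> nlinarith
  · have := hP.isMaximal hP0
    exact Ideal.jacobson_eq_self_of_isMaximal

variable {Ω : Type*} [Field Ω]

theorem Field.finite_of_moduleFinite_int (k : Type*) [Field k] [Module.Finite ℤ k] : Finite k := by
  obtain ⟨p, hp⟩ := CharP.exists k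
  have hp0 : p ≠ 0 := by
    rintro rfl
    have := CharP.charP_to_charZero k
    exact Int.not_isField (isField_of_isIntegral_of_isField (S := k)
      (FaithfulSMul.algebraMap_injective ℤ k) (Field.toIsField k))
  refine Module.finite_of_fg_torsion k fun x => ⟨⟨p, mem_nonZeroDivisors_of_ne_zero ?_⟩, ?_⟩
  · exact_mod_cast hp0
  · simp [Submonoid.smul_def]

/-- A finitely generated subring of a field of characteristic zero sits in a local Noetherian
subring with finite residue field of characteristic prime to a given integer. -/
theorem exists_local_subring_finite_residue [CharZero Ω] {s : Set Ω} (hs : s.Finite) {N : ℕ}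
    (hN : N ≠ 0) :
    ∃ A : Subring Ω, s ⊆ A ∧ ∃ m : Ideal A, m ≠ ⊤ ∧ (∀ a ∉ m, IsUnit a) ∧ Finite (A ⧸ m) ∧
      ⨅ n, m ^ n = ⊥ ∧ (N : A) ∉ m := by
  let B : Subalgebra ℤ Ω := Algebra.adjoin ℤ (insert (N : Ω)⁻¹ s)
  have hft : Algebra.FiniteType ℤ B :=
    (Subalgebra.fg_iff_finiteType B).1 (Subalgebra.fg_def.2 ⟨_, hs.insert _, rfl⟩)
  have hNoeth : IsNoetherianRing B.toSubring := Algebra.FiniteType.isNoetherianRing ℤ B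
  obtain ⟨P, hP⟩ := Ideal.exists_maximal B
  let _ := Ideal.Quotient.field P
  have hft' : Algebra.FiniteType ℤ (B ⧸ P) := inferInstance
  have := Int.isJacobsonRing
  have hfin : Module.Finite ℤ (B ⧸ P) := finite_of_finite_type_of_isJacobsonRing ℤ (B ⧸ P)
  have hfin' : Finite (B ⧸ P) := Field.finite_of_moduleFinite_int _
  let Q : Ideal B.toSubring := P
  have hQ : Q.IsMaximal := hP
  let A := LocalSubring.ofPrime B.toSubring Q
  have hA : IsNoetherianRing A.toSubring := IsLocalization.isNoetherianRing Q.primeCompl _ hNoeth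
  have hBA : B.toSubring ≤ A.toSubring := LocalSubring.le_ofPrime _ _
  have hmem : ∀ a ∈ insert (N : Ω)⁻¹ s, a ∈ A.toSubring := fun a ha =>
    hBA (Algebra.subset_adjoin ha)
  refine ⟨A.toSubring, fun a ha => hmem a (Set.mem_insert_of_mem _ ha),
    IsLocalRing.maximalIdeal A.toSubring, Ideal.IsPrime.ne_top', fun a ha => by simpa using ha,
    ?_, Ideal.iInf_pow_eq_bot_of_isLocalRing _ Ideal.IsPrime.ne_top', ?_⟩
  · have : Finite (B.toSubring ⧸ Q) := hfin'
    exact Finite.of_equiv _ (IsLocalization.AtPrime.equivQuotMaximalIdeal Q A.toSubring).toEquiv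
  · rw [IsLocalRing.mem_maximalIdeal, mem_nonunits_iff, not_not]
    refine IsUnit.of_mul_eq_one ⟨(N : Ω)⁻¹, hmem _ (Set.mem_insert _ _)⟩ (Subtype.ext ?_)
    exact mul_inv_cancel₀ (Nat.cast_ne_zero.2 hN)

end LocalSubring

theorem exists_pow_isIdempotentElem {M : Type*} [Monoid M] [Finite M] (a : M) :
    ∃ n, 1 ≤ n ∧ IsIdempotentElem (a ^ n) := by
  obtain ⟨i, j, hij, h⟩ : ∃ i j : ℕ, i < j ∧ a ^ i = a ^ j := by
    obtain ⟨i, j, hne, h⟩ := Finite.exists_ne_map_eq_of_infinite (fun n : ℕ => a ^ n)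
    rcases hne.lt_or_gt with h1 | h1
    exacts [⟨i, j, h1, h⟩, ⟨j, i, h1, h.symm⟩]
  obtain ⟨e, rfl⟩ := Nat.exists_eq_add_of_lt hij
  have h1 : ∀ t, a ^ (i + t * (e + 1)) = a ^ i := fun t => by
    induction t with
    | zero => simp
    | succ t ih => rw [add_mul, one_mul, ← add_assoc, pow_add, ih, ← pow_add, ← add_assoc, ← h]
  refine ⟨(i + 1) * (e + 1), Nat.mul_pos (by simp) (by simp), ?_⟩
  have h2 : (i + 1) * (e + 1) = i + (i * e + e + 1) := by ring
  rw [IsIdempotentElem, ← pow_add]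
  nth_rewrite 1 [h2]
  rw [add_right_comm, pow_add, h1, ← pow_add, ← h2]

section Fibers
variable {ι κ Ω : Type*} [Fintype κ] [Field Ω] [IsAlgClosed Ω] {F : ι → κ → MvPolynomial κ Ω}
  {d : ι → ℕ}

theorem wordMap_ne_zero {ι κ Ω : Type*} [Field Ω] {F : ι → κ → MvPolynomial κ Ω}
    (h0 : ∀ t v, v ≠ 0 → formMap (F t) v ≠ 0) (l : List ι) {v : κ → Ω} (hv : v ≠ 0) :
    wordMap F l v ≠ 0 := by
  induction l with
  | nil => exact hv
  | cons t l ih => rw [wordMap_cons]; exact h0 t _ ih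

theorem finite_lines_fiber_wordMap (hd : ∀ t, 1 ≤ d t) (hF : ∀ t i, (F t i).IsHomogeneous (d t))
    (h0 : ∀ t v, v ≠ 0 → formMap (F t) v ≠ 0) (l : List ι) (w : κ → Ω) :
    ((fun v => Submodule.span Ω {v}) ''
      {v : κ → Ω | v ≠ 0 ∧ Submodule.span Ω {wordMap F l v} = Submodule.span Ω {w}}).Finite := by
  induction l generalizing w with
  | nil =>
    refine (Set.finite_singleton (Submodule.span Ω {w})).subset ?_
    rintro _ ⟨v, ⟨-, hv⟩, rfl⟩
    exact hv
  | cons t l ih =>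
    let S := {v : κ → Ω | v ≠ 0 ∧ Submodule.span Ω {formMap (F t) v} = Submodule.span Ω {w}}
    obtain ⟨s, hs, h⟩ := Function.exists_finite_representatives
      (fun v : S => Submodule.span Ω {v.1}) <| by
        have := finite_lines_fiber_formMap (hd t) (hF t) (h0 t) w
        rwa [Set.image_eq_range] at this
    refine (hs.biUnion fun v _ => ih v.1).subset ?_
    rintro _ ⟨v, ⟨hv, hvw⟩, rfl⟩
    rw [wordMap_cons] at hvw
    obtain ⟨v', hv's, hv'⟩ := h ⟨_, wordMap_ne_zero h0 l hv, hvw⟩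
    exact Set.mem_biUnion hv's ⟨v, ⟨hv, hv'⟩, rfl⟩

end Fibers

section CharZero
variable {ι : Type*} {κ : Type u} {Ω : Type v} [Fintype κ] [Field Ω]
  {F : ι → κ → MvPolynomial κ Ω} {d : ι → ℕ}

theorem MvPolynomial.exists_map_subtype_eq {κ Ω : Type*} [CommRing Ω] {A : Subring Ω}
    {p : MvPolynomial κ Ω} (h : (p.coeffs : Set Ω) ⊆ A) : ∃ q, map A.subtype q = p :=
  mem_range_map_iff_coeffs_subset.2 (by simpa using h)

theorem exists_idempotent_criterion [IsAlgClosed Ω] [CharZero Ω] [Finite ι] (hd : ∀ t, 1 ≤ d t)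
    (hF : ∀ t i, (F t i).IsHomogeneous (d t)) (h0 : ∀ t v, v ≠ 0 → formMap (F t) v ≠ 0)
    {X : κ → Ω} {i₁ : κ} (hX : X i₁ = 1) {N : ℕ} (hN : N ≠ 0) :
    ∃ (Q : Type (max u v)) (_ : Monoid Q) (_ : Finite Q) (σ : List ι → Q) (p : ℕ),
      p.Prime ∧ ¬ p ∣ N ∧
      σ [] = 1 ∧ (∀ l l', σ (l ++ l') = σ l * σ l') ∧
      ∀ l k (c : Ω), IsIdempotentElem (σ l) → ¬ p ∣ k → (wordMap F l ^ k) X = c • X →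
        Parallel (wordMap F l X) X := by
  choose M G hG hGF using fun t => exists_pow_eq_sum_mul (hF t) (h0 t)
  obtain ⟨A, hsA, m, hmt, hm, hfin, hK, hNm⟩ := exists_local_subring_finite_residue
    (s := Set.range X ∪ ((⋃ t, ⋃ i, ((F t i).coeffs : Set Ω)) ∪
      ⋃ t, ⋃ i, ⋃ j, ((G t i j).coeffs : Set Ω))) ((Set.finite_range X).union
      ((Set.finite_iUnion fun t => Set.finite_iUnion fun i => Finset.finite_toSet _).union
      (Set.finite_iUnion fun t => Set.finite_iUnion fun i => Set.finite_iUnion fun j =>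
        Finset.finite_toSet _))) hN
  obtain ⟨hXA, hFA, hGA⟩ : Set.range X ⊆ A ∧ (⋃ t, ⋃ i, ((F t i).coeffs : Set Ω)) ⊆ A ∧
      (⋃ t, ⋃ i, ⋃ j, ((G t i j).coeffs : Set Ω)) ⊆ A := by
    simpa only [Set.union_subset_iff] using hsA
  simp only [Set.iUnion_subset_iff] at hFA hGA
  choose f hf using fun t i => MvPolynomial.exists_map_subtype_eq (hFA t i)
  choose g hg using fun t i j => MvPolynomial.exists_map_subtype_eq (hGA t i j)
  have hinj : Function.Injective A.subtype := A.subtype_injective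
  have hfh : ∀ t i, (f t i).IsHomogeneous (d t) := fun t i =>
    IsHomogeneous.of_map hinj (by rw [hf]; exact hF t i)
  have hgf : ∀ t i, ∑ j, g t i j * f t j = MvPolynomial.X i ^ (M t + d t) := fun t i =>
    map_injective _ hinj (by simp only [map_sum, map_mul, hf, hg, hGF, map_pow, map_X])
  have hnz : ∀ t v, (∃ i, v i ∉ m) → ∃ i, formMap (f t) v i ∉ m := by
    rintro t v ⟨i, hi⟩
    by_contra! h
    have h1 := congrArg (eval v) (hgf t i)
    simp only [map_sum, map_mul, map_pow, eval_X] at h1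
    refine hmt (m.eq_top_of_isUnit_mem ?_ ((hm _ hi).pow (M t + d t)))
    rw [← h1]
    exact Ideal.sum_mem _ fun j _ => Ideal.mul_mem_left _ _ (h j)
  let x : κ → A := fun i => ⟨X i, hXA ⟨i, rfl⟩⟩
  have hx : A.subtype ∘ x = X := rfl
  have hwx : ∀ l, A.subtype ∘ wordMap f l x = wordMap F l X := fun l => by
    rw [← wordMap_map, hx]; simp only [hf]
  have hmax : m.IsMaximal := Ideal.isMaximal_def.2 ⟨hmt, fun J hJ => by
    obtain ⟨a, haJ, ham⟩ := Set.exists_of_ssubset hJ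
    exact J.eq_top_of_isUnit_mem haJ (hm a ham)⟩
  let _ := Ideal.Quotient.field m
  have hchar : ∀ k : ℕ, (k : A) ∈ m ↔ ringChar (A ⧸ m) ∣ k := fun k => by
    rw [← ringChar.spec, ← Ideal.Quotient.eq_zero_iff_mem, map_natCast]
  let fbar : ι → κ → MvPolynomial κ (A ⧸ m) := fun t i => map (Ideal.Quotient.mk m) (f t i)
  refine ⟨Function.End ((κ → A ⧸ m) × (κ → A ⧸ m)), inferInstance, ?_, wordTangent fbar,
    ringChar (A ⧸ m), CharP.char_is_prime (A ⧸ m) _, by rwa [← hchar],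
    rfl, wordTangent_append fbar, ?_⟩
  · exact inferInstanceAs (Finite ((κ → A ⧸ m) × (κ → A ⧸ m) → (κ → A ⧸ m) × (κ → A ⧸ m)))
  · intro l k c hl hk hper
    rw [← hchar] at hk
    have hl' : ∀ q, wordTangent fbar l (wordTangent fbar l q) = wordTangent fbar l q :=
      fun q => congrFun hl q
    simp only [wordTangent_apply, Prod.ext_iff] at hl'
    rw [wordMap_pow] at hper
    have hc : c ∈ A := by
      have h1 := congrFun hper i₁
      rw [← hwx, Pi.smul_apply, hX, smul_eq_mul, mul_one] at h1
      exact h1 ▸ (wordMap f _ x i₁).2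
    have hpar := parallel_of_idempotent_tangent (c := ⟨c, hc⟩) (X := x) hm hK hd hfh hnz l ?_ ?_
      ⟨i₁, ?_⟩ hk ?_
    · rwa [← parallel_map_iff hinj, hwx, hx] at hpar
    · intro v i
      have h1 := (hl' (Ideal.Quotient.mk m ∘ v, 0)).1
      simp only [fbar, wordMap_map] at h1
      exact Ideal.Quotient.eq.1 (congrFun h1 i)
    · intro v h i
      have h1 := (hl' (Ideal.Quotient.mk m ∘ v, Ideal.Quotient.mk m ∘ h)).2
      simp only [fbar, wordMap_map, wordJacobian_map] at h1
      exact Ideal.Quotient.eq.1 (congrFun h1 i)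
    · have : x i₁ = 1 := Subtype.ext hX
      rw [this]
      exact (Ideal.ne_top_iff_one m).1 hmt
    · rw [wordMap_pow]
      refine hinj.comp_left ((hwx _).trans (hper.trans ?_))
      rfl

end CharZero

section CharZeroOrbit
variable {ι κ Ω : Type*} [Fintype κ] [Field Ω] {F : ι → κ → MvPolynomial κ Ω} {d : ι → ℕ}

theorem map_flatten_replicate {ι Q : Type*} [Monoid Q] {σ : List ι → Q} (h1 : σ [] = 1)
    (h2 : ∀ l l', σ (l ++ l') = σ l * σ l') (n : ℕ) (l : List ι) :
    σ (List.replicate n l).flatten = σ l ^ n := by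
  induction n with
  | zero => simpa using h1
  | succ n ih => rw [List.replicate_succ, List.flatten_cons, h2, ih, pow_succ']

theorem finite_orbit_of_charZero [IsAlgClosed Ω] [CharZero Ω] [Finite ι] (hd : ∀ t, 1 ≤ d t)
    (hF : ∀ t i, (F t i).IsHomogeneous (d t)) (h0 : ∀ t v, v ≠ 0 → formMap (F t) v ≠ 0)
    {X : κ → Ω} (hX : X ≠ 0)
    (hper : ∀ l ≠ [], ∃ k, 1 ≤ k ∧ ∃ c : Ω, (wordMap F l ^ k) X = c • X) :
    (Set.range fun l => Submodule.span Ω {wordMap F l X}).Finite := by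
  wlog hX1 : ∃ i, X i = 1 generalizing X
  · obtain ⟨i, hi⟩ := Function.ne_iff.1 hX
    have hi : X i ≠ 0 := hi
    have hu := inv_ne_zero hi
    have h1 := this (X := (X i)⁻¹ • X) (smul_ne_zero hu hX) (fun l hl => ?_)
      ⟨i, by simp [hi]⟩
    · convert h1 using 3 with l
      rw [wordMap_smul hF]
      exact (Submodule.span_singleton_smul_eq (pow_ne_zero _ hu).isUnit _).symm
    · obtain ⟨k, hk, c, hc⟩ := hper l hl
      refine ⟨k, hk, (X i)⁻¹ ^ wordDegree d (List.replicate k l).flatten * c * X i, ?_⟩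
      rw [wordMap_pow] at hc ⊢
      rw [wordMap_smul hF, hc, smul_smul, smul_smul, mul_assoc _ (X i), mul_inv_cancel₀ hi, mul_one]
  obtain ⟨i₁, hi₁⟩ := hX1
  obtain ⟨Q, _, _, σ, p, hp, -, hσ1, hσm, hσ⟩ :=
    exists_idempotent_criterion hd hF h0 hi₁ one_ne_zero
  obtain ⟨Q', _, _, σ', p', hp', hpp', hσ1', hσm', hσ'⟩ :=
    exists_idempotent_criterion hd hF h0 hi₁ hp.ne_zero
  have hfix : ∀ l, IsIdempotentElem (σ l) → IsIdempotentElem (σ' l) →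
      Parallel (wordMap F l X) X := by
    intro l hl hl'
    obtain rfl | hne := eq_or_ne l []
    · exact fun i j => mul_comm _ _
    obtain ⟨k, hk, c, hc⟩ := hper l hne
    obtain ⟨a, k', hk', rfl⟩ := Nat.exists_eq_pow_mul_and_not_dvd (Nat.ne_of_gt hk) p hp.ne_one
    rw [pow_mul, wordMap_pow F l] at hc
    have h1 := hσ _ k' c (by rw [map_flatten_replicate hσ1 hσm]; exact hl.pow _) hk' hc
    rw [← wordMap_pow] at h1
    obtain ⟨c', hc'⟩ := (parallel_iff_exists_smul hX).1 h1
    exact hσ' l _ c' hl' (mt hp'.dvd_of_dvd_pow hpp') hc'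
  obtain ⟨s, hs, hrep⟩ := Function.exists_finite_representatives (fun l => (σ l, σ' l))
    (Set.toFinite _)
  choose n hn1 hn using fun l => exists_pow_isIdempotentElem (σ l, σ' l)
  refine (hs.biUnion fun u _ => finite_lines_fiber_wordMap hd hF h0
    (List.replicate (n u - 1) u).flatten X).subset ?_
  rintro _ ⟨l, rfl⟩
  obtain ⟨u, hu, hlu⟩ := hrep l
  obtain ⟨e1, e2⟩ := Prod.mk_inj.1 hlu
  refine Set.mem_biUnion hu ⟨_, ⟨wordMap_ne_zero h0 l hX, ?_⟩, rfl⟩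
  obtain ⟨i1, i2⟩ := Prod.ext_iff.1 (hn u)
  have hn2 : n u - 1 + 1 = n u := Nat.sub_add_cancel (hn1 u)
  obtain ⟨c, hc⟩ := (parallel_iff_exists_smul hX).1 <|
    hfix ((List.replicate (n u - 1) u).flatten ++ l)
      (by rw [hσm, map_flatten_replicate hσ1 hσm, e1, ← pow_succ, hn2]; exact i1)
      (by rw [hσm', map_flatten_replicate hσ1' hσm', e2, ← pow_succ, hn2]; exact i2)
  rw [← wordMap_append, hc]
  refine Submodule.span_singleton_smul_eq (IsUnit.mk0 c ?_) _
  rintro rfl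
  exact wordMap_ne_zero h0 _ hX (by simpa using hc)

end CharZeroOrbit

section AbsoluteValueExtension

/-- A nonarchimedean absolute value extends to every algebraic field extension. -/
theorem AbsoluteValue.exists_extension {E Ω : Type*} [Field E] [Field Ω] [Algebra E Ω]
    [Algebra.IsAlgebraic E Ω] (v : AbsoluteValue E ℝ) (hv : IsNonarchimedean v) :
    ∃ w : AbsoluteValue Ω ℝ, IsNonarchimedean w ∧ ∀ a, w (algebraMap E Ω a) = v a := by
  classical
  by_cases hnt : ∃ a, 1 < v a
  · obtain ⟨a₀, ha₀⟩ := hnt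
    let C := v.Completion
    let iC : NontriviallyNormedField C :=
      { (inferInstance : NormedField C) with
        non_trivial := ⟨((WithAbs.toAbs v a₀ : WithAbs v) : C), by
          rw [UniformSpace.Completion.norm_coe]; exact ha₀⟩ }
    have hcoe : ∀ a : E, ‖((WithAbs.toAbs v a : WithAbs v) : C)‖ = v a := fun a => by
      rw [UniformSpace.Completion.norm_coe]; rfl
    have hult : IsUltrametricDist C := by
      refine IsUltrametricDist.isUltrametricDist_of_forall_norm_add_le_max_norm fun x y => ?_
      refine UniformSpace.Completion.induction_on₂ x y ?_ fun a b => ?_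
      · exact isClosed_le (by fun_prop) (by fun_prop)
      · rw [← UniformSpace.Completion.coe_add]
        refine (UniformSpace.Completion.norm_coe _).trans_le ((hv _ _).trans_eq ?_)
        exact (congrArg₂ max (UniformSpace.Completion.norm_coe a)
          (UniformSpace.Completion.norm_coe b)).symm
    let j : E →+* C := (UniformSpace.Completion.coeRingHom : WithAbs v →+* C).comp
      (WithAbs.equiv v).symm.toRingHom
    let := j.toAlgebra
    let A := AlgebraicClosure C
    let := ((algebraMap C A).comp j).toAlgebra
    let τ : Ω →ₐ[E] A := IsAlgClosed.lift
    have hmul (a b : A) : spectralNorm C A (a * b) = spectralNorm C A a * spectralNorm C A b :=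
      (spectralMulAlgNorm C A).map_mul' a b
    have hna : IsNonarchimedean (spectralNorm C A) := isNonarchimedean_spectralNorm
    refine ⟨⟨⟨fun x => spectralNorm C A (τ x), fun x y => ?_⟩, fun x => spectralNorm_nonneg _,
      fun x => ⟨fun h => ?_, fun h => ?_⟩, fun x y => ?_⟩, fun x y => ?_, fun a => ?_⟩
    · rw [map_mul, hmul]
    · exact τ.injective (by
        rw [map_zero]
        exact eq_zero_of_map_spectralNorm_eq_zero h (Algebra.IsAlgebraic.isAlgebraic _))
    · simp [h, spectralNorm_zero]
    · change spectralNorm C A (τ (x + y)) ≤ spectralNorm C A (τ x) + spectralNorm C A (τ y)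
      rw [map_add]
      exact hna.add_le spectralNorm_nonneg
    · change spectralNorm C A (τ (x + y)) ≤ max (spectralNorm C A (τ x)) (spectralNorm C A (τ y))
      rw [map_add]
      exact hna _ _
    · change spectralNorm C A (τ (algebraMap E Ω a)) = _
      rw [τ.commutes]
      change spectralNorm C A (algebraMap C A (j a)) = _
      rw [spectralNorm_extends]
      exact hcoe a
  · push Not at hnt
    refine ⟨AbsoluteValue.trivial, fun x y => ?_, fun a => ?_⟩
    · by_cases hx : x = 0
      · simp [hx]
      by_cases hxy : x + y = 0
      · simp [hxy, hx]
      · simp [hx, hxy]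
    · by_cases ha : a = 0
      · simp [ha]
      have h1 := hnt a
      have h2 := hnt a⁻¹
      rw [map_inv₀, inv_le_one₀ (v.pos ha)] at h2
      simp [ha, le_antisymm h1 h2]

end AbsoluteValueExtension

section NorthcottFamily

open Function

/-- A family of nonarchimedean absolute values with a product formula and the Northcott property. -/
structure IsNorthcottFamily {I E : Type*} [Field E] (v : I → AbsoluteValue E ℝ) : Prop where
  nonarch : ∀ i, IsNonarchimedean (v i)
  finite : ∀ a, a ≠ 0 → HasFiniteSupport fun i => Real.log (v i a)
  sum_log : ∀ a, a ≠ 0 → ∑ᶠ i, Real.log (v i a) = 0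
  northcott : ∀ B : ℝ, {a : E | ∑ᶠ i, Real.log (max 1 (v i a)) ≤ B}.Finite

/-- The real absolute value attached to a valuation with values in the nonnegative reals. -/
def Valuation.toRealAbsoluteValue {E : Type*} [Field E] (v : Valuation E NNReal) :
    AbsoluteValue E ℝ where
  toFun a := v a
  map_mul' a b := by simp
  nonneg' a := NNReal.coe_nonneg _
  eq_zero' a := by simp
  add_le' a b := by
    have h := (v.map_add a b).trans (max_le_add_of_nonneg zero_le zero_le)
    exact_mod_cast h

theorem Valuation.toRealAbsoluteValue_apply {E : Type*} [Field E] (v : Valuation E NNReal) (a : E) :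
    v.toRealAbsoluteValue a = v a := rfl

theorem Valuation.isNonarchimedean_toRealAbsoluteValue {E : Type*} [Field E]
    (v : Valuation E NNReal) : IsNonarchimedean v.toRealAbsoluteValue := fun a b => by
  simp only [Valuation.toRealAbsoluteValue_apply]
  exact_mod_cast v.map_add a b

variable {R : Type*} [CommRing R] [IsDomain R]

/-- The valuation at infinity attached to a degree function. -/
def degreeValuation (deg : R → ℕ) (hmul : ∀ a b, a ≠ 0 → b ≠ 0 → deg (a * b) = deg a + deg b)
    (hadd : ∀ a b, deg (a + b) ≤ max (deg a) (deg b)) : Valuation R NNReal := by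
  classical
  exact
  { toFun := fun a => if a = 0 then 0 else 2 ^ deg a
    map_zero' := by simp
    map_one' := by
      have := hmul 1 1 one_ne_zero one_ne_zero
      simp only [mul_one] at this
      simp [show deg 1 = 0 by omega]
    map_mul' := fun a b => by
      by_cases ha : a = 0
      · simp [ha]
      by_cases hb : b = 0
      · simp [hb]
      simp [ha, hb, hmul a b ha hb, pow_add]
    map_add_le_max' := fun a b => by
      by_cases ha : a = 0
      · simp [ha]
      by_cases hb : b = 0
      · simp [hb]
      by_cases hab : a + b = 0
      · simp [hab]
      simp only [ha, hb, hab, if_false, le_max_iff]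
      rcases le_max_iff.1 (hadd a b) with h | h
      · exact .inl (pow_le_pow_right₀ one_le_two h)
      · exact .inr (pow_le_pow_right₀ one_le_two h) }

theorem degreeValuation_apply (deg : R → ℕ)
    (hmul : ∀ a b, a ≠ 0 → b ≠ 0 → deg (a * b) = deg a + deg b)
    (hadd : ∀ a b, deg (a + b) ≤ max (deg a) (deg b)) {a : R} (ha : a ≠ 0) :
    degreeValuation deg hmul hadd a = 2 ^ deg a := if_neg ha

/-- The valuation attached to a prime element, normalised by `m`. -/
def primeValuation [WfDvdMonoid R] {π : R} (hπ : Prime π) (m : ℕ) : Valuation R NNReal := by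
  classical
  exact
  { toFun := fun a => if a = 0 then 0 else (2⁻¹ ^ m) ^ multiplicity π a
    map_zero' := by simp
    map_one' := by simp [multiplicity_of_one_right hπ.not_isUnit]
    map_mul' := fun a b => by
      by_cases ha : a = 0
      · simp [ha]
      by_cases hb : b = 0
      · simp [hb]
      simp [ha, hb, pow_add, multiplicity_mul hπ
        (FiniteMultiplicity.of_prime_left hπ (mul_ne_zero ha hb))]
    map_add_le_max' := fun a b => by
      by_cases ha : a = 0
      · simp [ha]
      by_cases hb : b = 0
      · simp [hb]
      by_cases hab : a + b = 0
      · simp [hab]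
      simp only [ha, hb, hab, if_false, le_max_iff]
      have h2 : (2⁻¹ ^ m : NNReal) ≤ 1 := pow_le_one₀ zero_le (by
        rw [inv_le_one₀ two_pos]; exact one_le_two)
      have hdvd : π ^ min (multiplicity π a) (multiplicity π b) ∣ a + b :=
        dvd_add ((pow_dvd_pow _ (min_le_left _ _)).trans (pow_multiplicity_dvd _ _))
          ((pow_dvd_pow _ (min_le_right _ _)).trans (pow_multiplicity_dvd _ _))
      have hle := (FiniteMultiplicity.of_prime_left hπ hab).le_multiplicity_of_pow_dvd hdvd
      rcases min_le_iff.1 hle with h | h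
      · exact .inl (pow_le_pow_of_le_one zero_le h2 h)
      · exact .inr (pow_le_pow_of_le_one zero_le h2 h) }

theorem primeValuation_apply [WfDvdMonoid R] {π : R} (hπ : Prime π) (m : ℕ) {a : R} (ha : a ≠ 0) :
    primeValuation hπ m a = (2⁻¹ ^ m) ^ multiplicity π a := if_neg ha

end NorthcottFamily

section DegreePlaces

open Function UniqueFactorizationMonoid

variable {R : Type u} [CommRing R] [IsDomain R] [UniqueFactorizationMonoid R]

theorem degree_eq_sum_normalizedFactors [NormalizationMonoid R] {deg : R → ℕ}
    (hmul : ∀ a b, a ≠ 0 → b ≠ 0 → deg (a * b) = deg a + deg b) {a : R} (ha : a ≠ 0) :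
    deg a = ((normalizedFactors a).map deg).sum := by
  have h1 : deg 1 = 0 := by
    have := hmul 1 1 one_ne_zero one_ne_zero
    simp only [mul_one] at this
    omega
  have hprod (s : Multiset R) (hs : (0 : R) ∉ s) : deg s.prod = (s.map deg).sum := by
    induction s using Multiset.induction with
    | empty => simpa
    | cons b s ih =>
      simp only [Multiset.mem_cons, not_or] at hs
      rw [Multiset.prod_cons, hmul _ _ (Ne.symm hs.1) (Multiset.prod_ne_zero hs.2), ih hs.2,
        Multiset.map_cons, Multiset.sum_cons]
  obtain ⟨u, hu⟩ := prod_normalizedFactors ha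
  have hu0 : deg (u : R) = 0 := by
    have := hmul u (u⁻¹ : Rˣ) u.ne_zero (u⁻¹).ne_zero
    rw [Units.mul_inv, h1] at this
    omega
  conv_lhs => rw [← hu]
  rw [hmul _ _ (Multiset.prod_ne_zero (zero_notMem_normalizedFactors a)) u.ne_zero, hu0, add_zero,
    hprod _ (zero_notMem_normalizedFactors a)]

/-- The valuations attached to the normalized primes and to a degree function satisfy a product
formula, and they bound the degree of a denominator in lowest terms. -/
theorem exists_valuations_of_degree (deg : R → ℕ)
    (hmul : ∀ a b, a ≠ 0 → b ≠ 0 → deg (a * b) = deg a + deg b)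
    (hadd : ∀ a b, deg (a + b) ≤ max (deg a) (deg b)) :
    ∃ (I : Type u) (v : I → Valuation R NNReal), (∀ i a, a ≠ 0 → v i a ≠ 0) ∧
      (∀ a, a ≠ 0 → HasFiniteSupport fun i => Real.log (v i a)) ∧
      (∀ a, a ≠ 0 → ∑ᶠ i, Real.log (v i a) = 0) ∧
      ∀ a c, a ≠ 0 → c ≠ 0 → IsRelPrime a c →
        deg c * Real.log 2 ≤ ∑ᶠ i, Real.log (max 1 (v i a / v i c : ℝ)) := by
  classical
  let : StrongNormalizationMonoid R := UniqueFactorizationMonoid.strongNormalizationMonoid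
  let P := {π : R // Irreducible π ∧ normalize π = π}
  let v (i : Option P) : Valuation R NNReal := i.elim (degreeValuation deg hmul hadd)
    fun π => primeValuation π.2.1.prime (deg π)
  have hv_none {a : R} (ha : a ≠ 0) : Real.log (v none a) = deg a * Real.log 2 := by
    simp [v, degreeValuation_apply deg hmul hadd ha]
  have hv_some {a : R} (ha : a ≠ 0) (π : P) :
      Real.log (v (some π) a) = -(multiplicity π.1 a * deg π.1 * Real.log 2) := by
    simp only [v, Option.elim_some, primeValuation_apply π.2.1.prime _ ha]
    push_cast
    rw [Real.log_pow, Real.log_pow, Real.log_inv]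
    ring
  have hv0 (i : Option P) (a : R) (ha : a ≠ 0) : v i a ≠ 0 := by
    cases i with
    | none => simp [v, degreeValuation_apply deg hmul hadd ha]
    | some π => simp [v, primeValuation_apply π.2.1.prime _ ha]
  have hmult {a : R} (ha : a ≠ 0) (π : P) :
      multiplicity π.1 a = (normalizedFactors a).count π.1 := by
    have := emultiplicity_eq_count_normalizedFactors π.2.1 ha
    rw [π.2.2] at this
    rw [multiplicity, this]
    rfl
  let T (a : R) : Finset P := (normalizedFactors a).toFinset.subtype _
  have hT {a : R} (ha : a ≠ 0) (π : P) (hπ : multiplicity π.1 a ≠ 0) : π ∈ T a := by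
    rw [hmult ha, Multiset.count_ne_zero] at hπ
    exact Finset.mem_subtype.2 (Multiset.mem_toFinset.2 hπ)
  have hsum {a : R} (ha : a ≠ 0) : ∑ π ∈ T a, multiplicity π.1 a * deg π.1 = deg a := by
    rw [degree_eq_sum_normalizedFactors hmul ha, Finset.sum_multiset_map_count,
      ← Finset.sum_subtype_of_mem (p := fun π : R => Irreducible π ∧ normalize π = π)
        (fun π => Multiset.count π (normalizedFactors a) • deg π)]
    · exact Finset.sum_congr rfl fun π _ => by rw [hmult ha, smul_eq_mul]
    · intro π hπ
      rw [Multiset.mem_toFinset] at hπ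
      exact ⟨irreducible_of_normalized_factor _ hπ, normalize_normalized_factor _ hπ⟩
  have hsumR {a : R} (ha : a ≠ 0) :
      ∑ π ∈ T a, (multiplicity π.1 a * deg π.1 * Real.log 2 : ℝ) = deg a * Real.log 2 := by
    rw [← Finset.sum_mul, ← hsum ha]
    push_cast
    rfl
  have hsupp {a : R} (ha : a ≠ 0) :
      (support fun i => Real.log (v i a)) ⊆ ↑(Finset.insertNone (T a)) := by
    intro i hi
    cases i with
    | none => simp
    | some π =>
      simp only [mem_support, hv_some ha] at hi
      simpa using hT ha π fun h => hi (by simp [h])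
  have hfin {a : R} (ha : a ≠ 0) : HasFiniteSupport fun i => Real.log (v i a) :=
    (Finset.finite_toSet _).subset (hsupp ha)
  refine ⟨Option P, v, hv0, fun a ha => hfin ha, fun a ha => ?_, fun a c ha hc hac => ?_⟩
  · rw [finsum_eq_sum_of_support_subset _ (hsupp ha), Finset.sum_insertNone, hv_none ha]
    simp only [hv_some ha, Finset.sum_neg_distrib, hsumR ha]
    ring
  · have hlog (i : Option P) : Real.log (max 1 (v i a / v i c : ℝ)) =
        max 0 (Real.log (v i a) - Real.log (v i c)) := by
      have hi : (0 : ℝ) < v i a / v i c :=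
        div_pos (NNReal.coe_pos.2 (pos_iff_ne_zero.2 (hv0 i a ha)))
          (NNReal.coe_pos.2 (pos_iff_ne_zero.2 (hv0 i c hc)))
      rw [← Real.log_div (NNReal.coe_ne_zero.2 (hv0 i a ha)) (NNReal.coe_ne_zero.2 (hv0 i c hc)),
        ← Real.log_one]
      exact Real.strictMonoOn_log.monotoneOn.map_max (Set.mem_Ioi.2 one_pos) hi
    simp only [hlog]
    have hfinmax : HasFiniteSupport fun i => max 0 (Real.log (v i a) - Real.log (v i c)) :=
      HasFiniteSupport.max (by simp [HasFiniteSupport]) ((hfin ha).sub (hfin hc))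
    refine le_trans ?_ (finsum_le_finsum' (f := fun i : Option P => i.elim 0 fun π =>
      (multiplicity π.1 c * deg π.1 * Real.log 2 : ℝ)) ?_ hfinmax fun i => ?_)
    · rw [finsum_eq_sum_of_support_subset (s := Finset.insertNone (T c)), Finset.sum_insertNone]
      · simp [hsumR hc]
      · intro i hi
        cases i with
        | none => simp
        | some π => simpa using hT hc π fun h => hi (by simp [h])
    · refine (Finset.finite_toSet (Finset.insertNone (T c))).subset fun i hi => ?_
      cases i with
      | none => simp
      | some π => simpa using hT hc π fun h => hi (by simp [h])
    · cases i with
      | none => exact le_max_left _ _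
      | some π =>
        simp only [Option.elim_some, hv_some ha, hv_some hc]
        by_cases h : multiplicity π.1 c = 0
        · simp [h]
        · have h' : multiplicity π.1 a = 0 := by
            by_contra h''
            exact π.2.1.not_isUnit (hac (dvd_of_multiplicity_pos (Nat.pos_of_ne_zero h''))
              (dvd_of_multiplicity_pos (Nat.pos_of_ne_zero h)))
          simp [h']

/-- A degree function on a factorial ring with finitely many elements of bounded degree gives rise
to a Northcott family on the fraction field. -/
theorem exists_isNorthcottFamily_of_degree {E : Type*} [Field E] [Algebra R E] [IsFractionRing R E]
    (deg : R → ℕ)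
    (hmul : ∀ a b, a ≠ 0 → b ≠ 0 → deg (a * b) = deg a + deg b)
    (hadd : ∀ a b, deg (a + b) ≤ max (deg a) (deg b)) (hfin : ∀ n, {a | deg a ≤ n}.Finite) :
    ∃ (I : Type u) (v : I → AbsoluteValue E ℝ), IsNorthcottFamily v := by
  obtain ⟨I, v, hv0, hv1, hv2, hv3⟩ := exists_valuations_of_degree deg hmul hadd
  have hS (i : I) : nonZeroDivisors R ≤ (v i).supp.primeCompl := fun a ha h =>
    hv0 i a (nonZeroDivisors.ne_zero ha) ((Valuation.mem_supp_iff _ _).1 h)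
  let w (i : I) : AbsoluteValue E ℝ := ((v i).extendToLocalization (hS i) E).toRealAbsoluteValue
  have hw (i : I) (a : R) : w i (algebraMap R E a) = v i a := by
    simp [w, Valuation.toRealAbsoluteValue_apply]
  have hfrac (x : E) (hx : x ≠ 0) : ∃ a c : R, a ≠ 0 ∧ c ≠ 0 ∧ IsRelPrime a c ∧
      x = algebraMap R E a / algebraMap R E c := by
    obtain ⟨a, c, hac, rfl⟩ := IsFractionRing.exists_reduced_fraction R x
    refine ⟨a, c, ?_, nonZeroDivisors.coe_ne_zero c, hac, IsFractionRing.mk'_eq_div c⟩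
    rintro rfl
    exact hx (by simp)
  have hlog (i : I) {a c : R} (ha : a ≠ 0) (hc : c ≠ 0) :
      Real.log (w i (algebraMap R E a / algebraMap R E c)) =
        Real.log (v i a) - Real.log (v i c) := by
    rw [map_div₀, hw, hw, Real.log_div (NNReal.coe_ne_zero.2 (hv0 i a ha))
      (NNReal.coe_ne_zero.2 (hv0 i c hc))]
  have hfinite (x : E) (hx : x ≠ 0) : HasFiniteSupport fun i => Real.log (w i x) := by
    obtain ⟨a, c, ha, hc, -, rfl⟩ := hfrac x hx
    simp only [hlog _ ha hc]
    exact (hv1 a ha).sub (hv1 c hc)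
  have hprod (x : E) (hx : x ≠ 0) : ∑ᶠ i, Real.log (w i x) = 0 := by
    obtain ⟨a, c, ha, hc, -, rfl⟩ := hfrac x hx
    simp only [hlog _ ha hc]
    rw [finsum_sub_distrib (hv1 a ha) (hv1 c hc), hv2 a ha, hv2 c hc, sub_zero]
  have hmax (i : I) {x : E} (hx : x ≠ 0) :
      Real.log (max 1 (w i x)) = max 0 (Real.log (w i x)) := by
    rw [← Real.log_one]
    exact Real.strictMonoOn_log.monotoneOn.map_max (Set.mem_Ioi.2 one_pos) ((w i).pos hx)
  have hinv (x : E) (hx : x ≠ 0) :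
      ∑ᶠ i, Real.log (max 1 (w i x⁻¹)) = ∑ᶠ i, Real.log (max 1 (w i x)) := by
    have hf := hfinite x hx
    have hm : HasFiniteSupport fun i => max 0 (Real.log (w i x)) :=
      HasFiniteSupport.max (by simp [HasFiniteSupport]) hf
    simp only [hmax _ hx, hmax _ (inv_ne_zero hx)]
    refine Eq.trans ?_ ((finsum_sub_distrib hm hf).trans (by rw [hprod x hx, sub_zero]))
    refine finsum_congr fun i => ?_
    rw [map_inv₀, Real.log_inv]
    rcases le_total 0 (Real.log (w i x)) with h | h
    · rw [max_eq_left (by linarith), max_eq_right h, sub_self]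
    · rw [max_eq_right (by linarith), max_eq_left h, zero_sub]
  refine ⟨I, w, fun i => Valuation.isNonarchimedean_toRealAbsoluteValue _, hfinite, hprod,
    fun B => ?_⟩
  let D := {a : R | deg a ≤ ⌊B / Real.log 2⌋₊}
  have hD : D.Finite := hfin _
  refine (((hD.prod hD).image fun q : R × R =>
    algebraMap R E q.1 / algebraMap R E q.2).insert 0).subset fun x hx => ?_
  by_cases hx0 : x = 0
  · exact .inl hx0
  obtain ⟨a, c, ha, hc, hac, rfl⟩ := hfrac x hx0
  refine .inr ⟨(a, c), ?_, rfl⟩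
  have key {a c : R} (ha : a ≠ 0) (hc : c ≠ 0) (hac : IsRelPrime a c)
      (h : ∑ᶠ i, Real.log (max 1 (w i (algebraMap R E a / algebraMap R E c))) ≤ B) : c ∈ D := by
    refine Nat.le_floor ?_
    rw [le_div_iff₀ (Real.log_pos one_lt_two)]
    refine (hv3 a c ha hc hac).trans (le_trans (le_of_eq (finsum_congr fun i => ?_)) h)
    rw [map_div₀, hw, hw]
  refine ⟨key hc ha hac.symm ?_, key ha hc hac hx⟩
  rw [← inv_div, hinv _ hx0]
  exact hx

end DegreePlaces

section NorthcottExtension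

open Function

theorem AbsoluteValue.sum_le_of_isNonarchimedean {E ι : Type*} [Field E] {w : AbsoluteValue E ℝ}
    (hw : IsNonarchimedean w) {s : Finset ι} {f : ι → E} {M : ℝ} (hM : 0 ≤ M)
    (h : ∀ i ∈ s, w (f i) ≤ M) : w (∑ i ∈ s, f i) ≤ M :=
  Finset.sum_induction f (fun x => w x ≤ M) (fun _ _ ha hb => (hw _ _).trans (max_le ha hb))
    (by simpa) h

theorem AbsoluteValue.exists_one_lt_coeff {E : Type*} [Field E] {w : AbsoluteValue E ℝ}
    (hw : IsNonarchimedean w) {P : Polynomial E} (hP : P.Monic) {r : E} (hr : P.IsRoot r)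
    (h1 : 1 < w r) : ∃ j < P.natDegree, 1 < w (P.coeff j) := by
  by_contra! hcon
  have hroot := hr.eq_zero
  rw [Polynomial.eval_eq_sum_range, Finset.sum_range_succ, hP.coeff_natDegree, one_mul,
    add_comm, add_eq_zero_iff_eq_neg] at hroot
  rcases Nat.eq_zero_or_pos P.natDegree with h0 | h0
  · simp [h0] at hroot
  have hle : w (r ^ P.natDegree) ≤ w r ^ (P.natDegree - 1) := by
    rw [hroot, w.map_neg]
    refine w.sum_le_of_isNonarchimedean hw (by positivity) fun j hj => ?_
    rw [Finset.mem_range] at hj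
    rw [map_mul, map_pow]
    calc w (P.coeff j) * w r ^ j ≤ 1 * w r ^ j := by gcongr; exact hcon j hj
      _ ≤ w r ^ (P.natDegree - 1) := by
        rw [one_mul]
        exact pow_le_pow_right₀ h1.le (by omega)
  rw [map_pow] at hle
  exact absurd hle (not_le.2 (pow_lt_pow_right₀ h1 (by omega)))

theorem AbsoluteValue.coeff_prod_X_sub_C_le {E : Type*} [Field E] {w : AbsoluteValue E ℝ}
    (hw : IsNonarchimedean w) (s : Multiset E) (j : ℕ) :
    w ((s.map fun r => Polynomial.X - Polynomial.C r).prod.coeff j) ≤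
      (s.map fun r => max 1 (w r)).prod := by
  induction s using Multiset.induction generalizing j with
  | empty =>
    by_cases hj : j = 0
    · simp [hj]
    · simp [Polynomial.coeff_one, hj]
  | cons r s ih =>
    simp only [Multiset.map_cons, Multiset.prod_cons]
    have h0 : 0 ≤ (s.map fun r => max 1 (w r)).prod := (w.nonneg _).trans (ih 0)
    rw [sub_mul, Polynomial.coeff_sub, Polynomial.coeff_C_mul, sub_eq_add_neg]
    refine (hw _ _).trans (max_le ?_ ?_)
    · refine le_trans ?_ (le_mul_of_one_le_left h0 (le_max_left _ _))
      cases j with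
      | zero => simpa using h0
      | succ j => rw [Polynomial.coeff_X_mul]; exact ih j
    · rw [w.map_neg, map_mul]
      exact mul_le_mul (le_max_right _ _) (ih j) (w.nonneg _) (by positivity)

/-- A Northcott family on a field induces one on every finite separable extension. -/
theorem IsNorthcottFamily.exists_extension {I E L : Type*} [Field E] [Field L] [Algebra E L]
    [FiniteDimensional E L] [Algebra.IsSeparable E L] {v : I → AbsoluteValue E ℝ}
    (hv : IsNorthcottFamily v) :
    ∃ w : I × (L →ₐ[E] AlgebraicClosure E) → AbsoluteValue L ℝ, IsNorthcottFamily w := by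
  classical
  let A := AlgebraicClosure E
  choose W hW1 hW2 using fun i => (v i).exists_extension (Ω := A) (hv.nonarch i)
  let w (q : I × (L →ₐ[E] A)) : AbsoluteValue L ℝ := (W q.1).comp q.2.injective
  have hw (i : I) (σ : L →ₐ[E] A) (a : L) : w (i, σ) a = W i (σ a) := rfl
  have hlarge (a : L) : {q | 1 < w q a}.Finite := by
    have hfin : (⋃ j ∈ Finset.range (minpoly E a).natDegree,
        {i | 1 < v i ((minpoly E a).coeff j)}).Finite := by
      refine Set.Finite.biUnion (Finset.finite_toSet _) fun j _ => ?_
      by_cases hj : (minpoly E a).coeff j = 0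
      · simp [hj, not_lt.2 zero_le_one]
      · refine (hv.finite _ hj).subset fun i hi => ?_
        exact (Real.log_pos hi).ne'
    refine (hfin.prod (Set.finite_univ (α := L →ₐ[E] A))).subset ?_
    rintro ⟨i, σ⟩ hi
    have hroot : ((minpoly E a).map (algebraMap E A)).IsRoot (σ a) := by
      rw [Polynomial.IsRoot, Polynomial.eval_map_algebraMap, Polynomial.aeval_algHom_apply,
        minpoly.aeval, map_zero]
    obtain ⟨j, hj, hlt⟩ := (W i).exists_one_lt_coeff (hW1 i)
      ((minpoly.monic (Algebra.IsIntegral.isIntegral a)).map _) hroot hi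
    rw [Polynomial.natDegree_map] at hj
    rw [Polynomial.coeff_map, hW2] at hlt
    exact ⟨Set.mem_biUnion (Finset.mem_coe.2 (Finset.mem_range.2 hj)) hlt, Set.mem_univ _⟩
  have hfinite (a : L) (ha : a ≠ 0) : HasFiniteSupport fun q => Real.log (w q a) := by
    refine ((hlarge a).union (hlarge a⁻¹)).subset fun q hq => ?_
    by_contra! hcon
    rw [Set.mem_union, not_or] at hcon
    obtain ⟨h1, h2⟩ := hcon
    have h1 : w q a ≤ 1 := not_lt.1 h1
    have h2 : w q a⁻¹ ≤ 1 := not_lt.1 h2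
    rw [map_inv₀, inv_le_one₀ ((w q).pos ha)] at h2
    exact hq (by simp [le_antisymm h1 h2])
  have hfinmax (a : L) : HasFiniteSupport fun q => Real.log (max 1 (w q a)) := by
    refine (hlarge a).subset fun q hq => ?_
    by_contra hcon
    have hle : w q a ≤ 1 := not_lt.1 hcon
    exact hq (by simp [max_eq_left hle])
  refine ⟨w, fun q a b => ?_, hfinite, fun a ha => ?_, fun B => ?_⟩
  · change W q.1 (q.2 (a + b)) ≤ _
    rw [map_add]
    exact hW1 _ _ _
  · rw [finsum_curry _ (hfinite a ha)]
    refine Eq.trans (finsum_congr fun i => ?_) (hv.sum_log _ ((Algebra.norm_ne_zero_iff).2 ha))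
    rw [finsum_eq_sum_of_fintype, ← hW2, Algebra.norm_eq_prod_embeddings E A a, map_prod,
      Real.log_prod fun σ _ => (W i).ne_zero ((map_ne_zero σ).2 ha)]
    rfl
  · have hcoeff (a : L) (j : ℕ) : ∑ᶠ i, Real.log (max 1 (v i ((minpoly E a).coeff j))) ≤
        ∑ᶠ q, Real.log (max 1 (w q a)) := by
      rw [finsum_curry _ (hfinmax a)]
      have hsum : HasFiniteSupport fun i => ∑ᶠ σ, Real.log (max 1 (w (i, σ) a)) := by
        refine ((hfinmax a).image Prod.fst).subset fun i hi => ?_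
        rw [mem_support, finsum_eq_sum_of_fintype] at hi
        obtain ⟨σ, -, hσ⟩ := Finset.exists_ne_zero_of_sum_ne_zero hi
        exact ⟨(i, σ), hσ, rfl⟩
      have hpt (i : I) : Real.log (max 1 (v i ((minpoly E a).coeff j))) ≤
          ∑ᶠ σ, Real.log (max 1 (w (i, σ) a)) := by
        have hsplit := (IsAlgClosed.splits ((minpoly E a).map (algebraMap E A)))
        have hmonic := (minpoly.monic (Algebra.IsIntegral.isIntegral (R := E) a)).map
          (algebraMap E A)
        have hsep : ((minpoly E a).map (algebraMap E A)).roots.Nodup :=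
          Polynomial.nodup_roots (Polynomial.Separable.map (Algebra.IsSeparable.isSeparable E a))
        have hroots : ((minpoly E a).map (algebraMap E A)).roots.toFinset =
            Finset.univ.image fun σ : L →ₐ[E] A => σ a := by
          rw [← Finset.coe_inj, Finset.coe_image, Finset.coe_univ, Set.image_univ,
            Algebra.IsAlgebraic.range_eval_eq_rootSet_minpoly]
          rfl
        have hle := (W i).coeff_prod_X_sub_C_le (hW1 i)
          ((minpoly E a).map (algebraMap E A)).roots j
        rw [← hsplit.eq_prod_roots_of_monic hmonic, Polynomial.coeff_map, hW2] at hle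
        have hnn (r : A) : 0 ≤ Real.log (max 1 (W i r)) := Real.log_nonneg (le_max_left _ _)
        have hprod : ((((minpoly E a).map (algebraMap E A)).roots.map
            fun r => max 1 (W i r)).prod) =
            ∏ r ∈ ((minpoly E a).map (algebraMap E A)).roots.toFinset, max 1 (W i r) := by
          rw [Finset.prod, Multiset.toFinset_val, Multiset.dedup_eq_self.2 hsep]
        rw [hprod, hroots] at hle
        have hone : 1 ≤ ∏ r ∈ Finset.univ.image fun σ : L →ₐ[E] A => σ a, max 1 (W i r) :=
          Finset.prod_induction _ (1 ≤ ·) (fun _ _ => one_le_mul_of_one_le_of_one_le) le_rfl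
            fun r _ => le_max_left _ _
        rw [finsum_eq_sum_of_fintype]
        refine (Real.log_le_log (by positivity) (max_le hone hle)).trans ?_
        rw [Real.log_prod fun r _ => (lt_max_of_lt_left one_pos).ne']
        exact Finset.sum_image_le_of_nonneg fun r _ => hnn r
      refine finsum_le_finsum' ?_ hsum hpt
      by_cases hj : (minpoly E a).coeff j = 0
      · simp [hj, HasFiniteSupport]
      · refine (hv.finite _ hj).subset fun i hi h0 => hi ?_
        rcases Real.log_eq_zero.1 h0 with h | h | h
        · exact absurd h ((v i).ne_zero hj)
        · simp [h]
        · exact absurd ((v i).nonneg _) (by rw [h]; norm_num)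
    refine (Polynomial.bUnion_roots_finite (algebraMap E L) (Module.finrank E L)
      (hv.northcott B)).subset fun a ha => ?_
    refine Set.mem_biUnion (x := minpoly E a) ⟨minpoly.natDegree_le a, fun j =>
      (hcoeff a j).trans ha⟩ ?_
    rw [Finset.mem_coe, Multiset.mem_toFinset, Polynomial.mem_roots
      (Polynomial.map_ne_zero (minpoly.ne_zero (Algebra.IsIntegral.isIntegral a))),
      Polynomial.IsRoot, Polynomial.eval_map_algebraMap, minpoly.aeval]

end NorthcottExtension

section NorthcottExists

/-- Every finite subset of a field of positive characteristic lies in a subfield with a Northcott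
family of absolute values. -/
theorem exists_subfield_isNorthcottFamily {Ω : Type u} [Field Ω] (p : ℕ) [Fact p.Prime] [CharP Ω p]
    (s : Finset Ω) :
    ∃ L : Subfield Ω, (s : Set Ω) ⊆ L ∧ ∃ (I : Type u) (w : I → AbsoluteValue L ℝ),
      IsNorthcottFamily w := by
  let := ZMod.algebra Ω p
  let L := IntermediateField.adjoin (ZMod p) (s : Set Ω)
  have hess : Algebra.EssFiniteType (ZMod p) L :=
    IntermediateField.essFiniteType_iff.2 ⟨s, rfl⟩
  obtain ⟨t, ht, hsep⟩ := exists_isTranscendenceBasis_and_isSeparable_of_perfectField (ZMod p) L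
  let E₀ := IntermediateField.adjoin (ZMod p) (t : Set L)
  have hess₀ : Algebra.EssFiniteType E₀ L := .of_comp (ZMod p) E₀ L
  have hfin₀ : FiniteDimensional E₀ L := by
    obtain ⟨r, hr⟩ := IntermediateField.fg_top E₀ L
    have := IntermediateField.finiteDimensional_adjoin (K := E₀) (S := (r : Set L))
      fun x _ => Algebra.IsIntegral.isIntegral x
    rw [hr] at this
    exact Module.Finite.equiv (IntermediateField.topEquiv (F := E₀) (E := L)).toLinearEquiv
  let R := MvPolynomial t (ZMod p)
  let E := FractionRing R
  let e : E ≃ₐ[ZMod p] E₀ := ht.1.aevalEquivField.trans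
    (IntermediateField.equivOfEq (by rw [Subtype.range_coe]))
  let := ((algebraMap E₀ L).comp (e : E →+* E₀)).toAlgebra
  have hsepE : Algebra.IsSeparable E L :=
    .of_equiv_equiv (e.symm : E₀ ≃+* E) (.refl L) (by ext x; simp [RingHom.algebraMap_toAlgebra])
  have hfinE : FiniteDimensional E L :=
    .of_equiv_equiv (e.symm : E₀ ≃+* E) (.refl L) (by ext x; simp [RingHom.algebraMap_toAlgebra])
  obtain ⟨I, v, hv⟩ := exists_isNorthcottFamily_of_degree (R := R) (E := E) totalDegree
    (fun a b ha hb => totalDegree_mul_of_isDomain ha hb) totalDegree_add fun n => by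
      have := Module.finite_of_finite (ZMod p) (M := restrictTotalDegree t (ZMod p) n)
      exact (Set.toFinite (restrictTotalDegree t (ZMod p) n : Set R)).subset fun a ha =>
        (mem_restrictTotalDegree _ _ _).2 ha
  obtain ⟨w, hw⟩ := hv.exists_extension (L := L)
  exact ⟨L.toSubfield, IntermediateField.subset_adjoin _ _, _, w, hw⟩

end NorthcottExists

section Heights

open Function

/-- The logarithmic height of a vector with respect to a family of absolute values. -/
def logHeight {I E κ : Type*} [Field E] (w : I → AbsoluteValue E ℝ) (X : κ → E) : ℝ :=
  ∑ᶠ i, Real.log (⨆ j, w i (X j))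

/-- The logarithmic height of an element with respect to a family of absolute values. -/
def elementLogHeight {I E : Type*} [Field E] (w : I → AbsoluteValue E ℝ) (a : E) : ℝ :=
  ∑ᶠ i, Real.log (max 1 (w i a))

variable {I E κ : Type*} [Field E] [Finite κ] {w : I → AbsoluteValue E ℝ}

theorem AbsoluteValue.le_iSup_apply (v : AbsoluteValue E ℝ) (X : κ → E) (j : κ) :
    v (X j) ≤ ⨆ j, v (X j) :=
  le_ciSup (Set.finite_range fun j => v (X j)).bddAbove j

theorem AbsoluteValue.iSup_apply_pos (v : AbsoluteValue E ℝ) {X : κ → E} (hX : X ≠ 0) :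
    0 < ⨆ j, v (X j) := by
  obtain ⟨j, hj⟩ := Function.ne_iff.mp hX
  exact (v.pos hj).trans_le (v.le_iSup_apply X j)

theorem hasFiniteSupport_log_max_one {w : I → AbsoluteValue E ℝ}
    (hw : IsNorthcottFamily w) (a : E) :
    HasFiniteSupport fun i => Real.log (max 1 (w i a)) := by
  rcases eq_or_ne a 0 with rfl | ha
  · simp [HasFiniteSupport]
  · refine (hw.finite a ha).subset fun i hi h => hi ?_
    have h1 : w i a = 1 := Real.eq_one_of_pos_of_log_eq_zero ((w i).pos ha) h
    simp [h1]

theorem hasFiniteSupport_log_iSup (hw : IsNorthcottFamily w) {X : κ → E} (hX : X ≠ 0) :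
    HasFiniteSupport fun i => Real.log (⨆ j, w i (X j)) := by
  have hfin : (⋃ j : {j // X j ≠ 0}, support fun i => Real.log (w i (X j))).Finite :=
    Set.finite_iUnion fun j => hw.finite _ j.2
  refine hfin.subset fun i hi => ?_
  by_contra hcon
  simp only [Set.mem_iUnion, mem_support, not_exists, not_not] at hcon
  have h1 : ∀ j, X j ≠ 0 → w i (X j) = 1 := fun j hj =>
    Real.eq_one_of_pos_of_log_eq_zero ((w i).pos hj) (hcon ⟨j, hj⟩)
  obtain ⟨j, hj⟩ := Function.ne_iff.mp hX
  have : Nonempty κ := ⟨j⟩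
  apply hi
  have : ⨆ j, w i (X j) = 1 := by
    refine le_antisymm (ciSup_le fun k => ?_) ((h1 j hj).symm.le.trans ((w i).le_iSup_apply X j))
    by_cases hk : X k = 0
    · simp [hk]
    · exact (h1 k hk).le
  simp [this]

theorem logHeight_smul (hw : IsNorthcottFamily w) {c : E} (hc : c ≠ 0) {X : κ → E} (hX : X ≠ 0) :
    logHeight w (c • X) = logHeight w X := by
  have h : ∀ i, Real.log (⨆ j, w i ((c • X) j)) =
      Real.log (w i c) + Real.log (⨆ j, w i (X j)) := fun i => by
    simp only [Pi.smul_apply, smul_eq_mul, map_mul]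
    rw [← Real.mul_iSup_of_nonneg ((w i).nonneg c),
      Real.log_mul ((w i).pos hc).ne' ((w i).iSup_apply_pos hX).ne']
  rw [logHeight, finsum_congr h,
    finsum_add_distrib (hw.finite c hc) (hasFiniteSupport_log_iSup hw hX), hw.sum_log c hc,
    zero_add, logHeight]

theorem elementLogHeight_le_logHeight (hw : IsNorthcottFamily w) {X : κ → E} {i : κ}
    (hi : X i = 1) (j : κ) : elementLogHeight w (X j) ≤ logHeight w X := by
  have hX : X ≠ 0 := Function.ne_iff.mpr ⟨i, by simp [hi]⟩
  refine finsum_le_finsum' (hasFiniteSupport_log_max_one hw _) (hasFiniteSupport_log_iSup hw hX)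
    fun k => Real.log_le_log (by positivity) (max_le ?_ ((w k).le_iSup_apply X j))
  simpa [hi] using (w k).le_iSup_apply X i

theorem elementLogHeight_nonneg (w : I → AbsoluteValue E ℝ) (a : E) : 0 ≤ elementLogHeight w a :=
  finsum_nonneg fun _ => Real.log_nonneg (le_max_left _ _)

theorem elementLogHeight_pow (w : I → AbsoluteValue E ℝ) (a : E) (n : ℕ) :
    elementLogHeight w (a ^ n) = n * elementLogHeight w a := by
  rw [elementLogHeight, elementLogHeight, mul_finsum]
  refine finsum_congr fun i => ?_
  rw [map_pow, ← Real.log_pow]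
  congr 1
  rcases le_total 1 (w i a) with h | h
  · rw [max_eq_right h, max_eq_right (one_le_pow₀ h)]
  · rw [max_eq_left h, max_eq_left (pow_le_one₀ ((w i).nonneg a) h), one_pow]

theorem exists_pow_eq_one_of_elementLogHeight_eq_zero (hw : IsNorthcottFamily w) {a : E}
    (ha : a ≠ 0) (h : elementLogHeight w a = 0) : ∃ n, 1 ≤ n ∧ a ^ n = 1 := by
  have hfin : (Set.range fun n : ℕ => a ^ n).Finite := by
    refine (hw.northcott 0).subset ?_
    rintro _ ⟨n, rfl⟩
    exact (by simp [elementLogHeight_pow, h] : elementLogHeight w (a ^ n) = 0).le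
  obtain ⟨m, n, hmn, he⟩ := Set.Finite.exists_lt_map_eq_of_forall_mem
    (fun n : ℕ => Set.mem_range_self n) hfin
  refine ⟨n - m, by omega, mul_left_cancel₀ (pow_ne_zero m ha) ?_⟩
  rw [← pow_add, mul_one, Nat.add_sub_cancel' hmn.le]
  exact he.symm

theorem exists_smul_eq_one {κ : Type*} {X : κ → E} (hX : X ≠ 0) :
    ∃ i, ∃ c : E, c ≠ 0 ∧ (c • X) i = 1 := by
  obtain ⟨i, hi⟩ := Function.ne_iff.mp hX
  exact ⟨i, (X i)⁻¹, inv_ne_zero hi, by simpa using inv_mul_cancel₀ hi⟩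

theorem logHeight_nonneg (hw : IsNorthcottFamily w) {X : κ → E} (hX : X ≠ 0) :
    0 ≤ logHeight w X := by
  obtain ⟨i, c, hc, h1⟩ := exists_smul_eq_one hX
  rw [← logHeight_smul hw hc hX]
  exact (elementLogHeight_nonneg w _).trans (elementLogHeight_le_logHeight hw h1 i)

theorem exists_finite_of_logHeight_le (hw : IsNorthcottFamily w) (B : ℝ) :
    ∃ s : Set (κ → E), s.Finite ∧
      ∀ X, X ≠ 0 → logHeight w X ≤ B → ∃ c : E, c ≠ 0 ∧ c • X ∈ s := by
  refine ⟨_, Set.Finite.pi' fun _ => hw.northcott B, fun X hX hB => ?_⟩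
  obtain ⟨i, c, hc, h1⟩ := exists_smul_eq_one hX
  refine ⟨c, hc, fun j => (elementLogHeight_le_logHeight hw h1 j).trans ?_⟩
  rwa [logHeight_smul hw hc hX]

theorem exists_uniform_bound (hw : IsNorthcottFamily w) (s : Finset E) :
    ∃ b : I → ℝ, HasFiniteSupport b ∧ ∀ i, ∀ a ∈ s, w i a ≤ Real.exp (b i) := by
  refine ⟨fun i => ∑ a ∈ s, Real.log (max 1 (w i a)), ?_, fun i a ha => ?_⟩
  · refine (s.finite_toSet.biUnion fun a _ => hasFiniteSupport_log_max_one hw a).subset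
      fun i hi => ?_
    by_contra hcon
    refine hi (Finset.sum_eq_zero fun a ha => ?_)
    by_contra h
    exact hcon (Set.mem_biUnion ha h)
  · calc w i a ≤ max 1 (w i a) := le_max_right _ _
      _ = Real.exp (Real.log (max 1 (w i a))) := (Real.exp_log (by positivity)).symm
      _ ≤ _ := Real.exp_le_exp.mpr (Finset.single_le_sum
          (f := fun a => Real.log (max 1 (w i a)))
          (fun a _ => Real.log_nonneg (le_max_left _ _)) ha)

theorem exists_mul_logHeight_le {κ : Type*} [Fintype κ] (hw : IsNorthcottFamily w) {d M : ℕ}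
    {F : κ → MvPolynomial κ E} {G : κ → κ → MvPolynomial κ E}
    (hG : ∀ i j, (G i j).IsHomogeneous M) (hGF : ∀ i, ∑ j, G i j * F j = X i ^ (M + d)) :
    ∃ C, ∀ X, X ≠ 0 → formMap F X ≠ 0 → d * logHeight w X ≤ logHeight w (formMap F X) + C := by
  classical
  obtain ⟨b, hb, hle⟩ := exists_uniform_bound hw
    (Finset.univ.biUnion fun i => Finset.univ.biUnion fun j => (G i j).coeffs)
  refine ⟨∑ᶠ i, b i, fun X hX hF => ?_⟩
  have hfX := hasFiniteSupport_log_iSup hw hX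
  have hfF := hasFiniteSupport_log_iSup hw hF
  rw [logHeight, logHeight, mul_finsum, ← finsum_add_distrib hfF hb]
  refine finsum_le_finsum' (hfX.subset fun i => by simp +contextual)
    (hfF.add hb) fun i => ?_
  set m := ⨆ j, w i (X j)
  set n := ⨆ j, w i (formMap F X j)
  have hm : 0 < m := (w i).iSup_apply_pos hX
  have hn : 0 < n := (w i).iSup_apply_pos hF
  have hcoord : ∀ k, w i (X k) ^ (M + d) ≤ Real.exp (b i) * m ^ M * n := fun k => by
    have hk : X k ^ (M + d) = ∑ j, MvPolynomial.eval X (G k j) * formMap F X j := by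
      have := congrArg (MvPolynomial.eval X) (hGF k)
      simpa [formMap_apply] using this.symm
    rw [← map_pow, hk]
    refine (w i).sum_le_of_isNonarchimedean (hw.nonarch i) (by positivity) fun j _ => ?_
    rw [map_mul]
    refine mul_le_mul ?_ ((w i).le_iSup_apply _ j) ((w i).nonneg _) (by positivity)
    refine ((hw.nonarch i).eval_mvPolynomial_le (hG k j) X).trans
      (mul_le_mul_of_nonneg_right ?_ (by positivity))
    refine Real.iSup_le (fun s => hle i _ ?_) (Real.exp_pos _).le
    simp only [Finset.mem_biUnion, Finset.mem_univ, true_and]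
    exact ⟨k, j, coeff_mem_coeffs _ (mem_support_iff.mp s.2)⟩
  have hpow : m ^ d ≤ Real.exp (b i) * n := by
    obtain ⟨k, _⟩ := Function.ne_iff.mp hX
    have : Nonempty κ := ⟨k⟩
    obtain ⟨k, hk⟩ := exists_eq_ciSup_of_finite (f := fun j => w i (X j))
    have := hcoord k
    rw [hk, pow_add] at this
    refine le_of_mul_le_mul_left (this.trans_eq ?_) (pow_pos hm M)
    ring
  calc d * Real.log m = Real.log (m ^ d) := (Real.log_pow m d).symm
    _ ≤ Real.log (Real.exp (b i) * n) := Real.log_le_log (by positivity) hpow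
    _ = Real.log n + b i := by
      rw [Real.log_mul (Real.exp_ne_zero _) hn.ne', Real.log_exp, add_comm]

theorem exists_elementLogHeight_div_le {κ : Type*} [Fintype κ] (hw : IsNorthcottFamily w)
    (a b : κ → E) :
    ∃ C, ∀ X : κ → E, b ⬝ᵥ X ≠ 0 →
      elementLogHeight w (a ⬝ᵥ X / b ⬝ᵥ X) ≤ logHeight w X + C := by
  classical
  obtain ⟨e, he, hle⟩ := exists_uniform_bound hw (Finset.univ.image a ∪ Finset.univ.image b)
  refine ⟨∑ᶠ i, e i, fun X hX => ?_⟩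
  have hX0 : X ≠ 0 := by rintro rfl; simp at hX
  have hfX := hasFiniteSupport_log_iSup hw hX0
  have hq := hasFiniteSupport_log_max_one hw (a ⬝ᵥ X / b ⬝ᵥ X)
  have hb := hw.finite _ hX
  rw [elementLogHeight, logHeight, ← add_zero (∑ᶠ i, Real.log (max 1 _)), ← hw.sum_log _ hX,
    ← finsum_add_distrib hq hb, ← finsum_add_distrib hfX he]
  refine finsum_le_finsum' (hq.add hb) (hfX.add he) fun i => ?_
  have hm := (w i).iSup_apply_pos hX0
  have hdot : ∀ c : κ → E, (∀ j, w i (c j) ≤ Real.exp (e i)) →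
      w i (c ⬝ᵥ X) ≤ Real.exp (e i) * ⨆ j, w i (X j) := fun c hc =>
    (w i).sum_le_of_isNonarchimedean (hw.nonarch i) (by positivity) fun j _ => by
      rw [map_mul]
      exact mul_le_mul (hc j) ((w i).le_iSup_apply X j) ((w i).nonneg _) (Real.exp_pos _).le
  have hpos := (w i).pos hX
  rw [← Real.log_mul (by positivity) hpos.ne', max_mul_of_nonneg _ _ hpos.le, one_mul, ← map_mul,
    div_mul_cancel₀ _ hX, add_comm, ← Real.log_exp (e i),
    ← Real.log_mul (Real.exp_ne_zero _) hm.ne']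
  exact Real.log_le_log (lt_max_of_lt_left hpos)
    (max_le (hdot b fun j => hle i _ (by simp)) (hdot a fun j => hle i _ (by simp)))

end Heights

section LinearForms

theorem exists_linearMap_eq_formMap {κ R : Type*} [CommSemiring R] {F : κ → MvPolynomial κ R}
    (hF : ∀ i, (F i).IsHomogeneous 1) : ∃ A : Module.End R (κ → R), ∀ v, A v = formMap F v := by
  have key : ∀ i, ∀ s ∈ (F i).support, ∃ j, s = Finsupp.single j 1 := fun i s hs =>
    (Finsupp.sum_eq_one_iff s).mp (by
      simpa [Finsupp.weight_apply] using hF i (mem_support_iff.mp hs))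
  refine ⟨{ toFun := formMap F, map_add' := fun v v' => funext fun i => ?_,
            map_smul' := fun c v => by rw [formMap_smul hF, pow_one, RingHom.id_apply] },
    fun _ => rfl⟩
  simp only [formMap_apply, Pi.add_apply, eval_eq, ← Finset.sum_add_distrib]
  refine Finset.sum_congr rfl fun s hs => ?_
  obtain ⟨j, rfl⟩ := key i s hs
  rw [Finsupp.support_single _ one_ne_zero]
  simp [mul_add]

/-- In positive characteristic, a suitable power of an endomorphism acts diagonalisably. -/
theorem Module.End.exists_diagonal_pow {Ω V : Type*} [Field Ω] [IsAlgClosed Ω] [AddCommGroup V]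
    [Module Ω V] [FiniteDimensional Ω V] (p : ℕ) [Fact p.Prime] [CharP Ω p]
    {A : Module.End Ω V} (hA : Function.Injective A) (y : V) :
    ∃ q, 1 ≤ q ∧ ∃ s : Finset Ω, ∃ D : s → V →ₗ[Ω] Ω,
      (∀ μ : s, (μ : Ω) ≠ 0 ∧ ∀ j, D μ (((A ^ q) ^ j) y) = (μ : Ω) ^ j) ∧
      ∀ (j : ℕ) (c : Ω), (∀ μ : s, (μ : Ω) ^ j = c) → ((A ^ q) ^ j) y = c • y := by
  have hp : p.Prime := Fact.out
  have hnt : Nontrivial (Module.End Ω V) ∨ Subsingleton V := by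
    rcases subsingleton_or_nontrivial V with h | h
    · exact Or.inr h
    · exact Or.inl inferInstance
  rcases hnt with hnt | hsub
  swap
  · exact ⟨1, le_rfl, ∅, fun _ => 0, fun μ => absurd μ.2 (Finset.notMem_empty _),
      fun _ _ _ => Subsingleton.elim _ _⟩
  have : CharP (Module.End Ω V) p := charP_of_injective_algebraMap
    (FaithfulSMul.algebraMap_injective Ω (Module.End Ω V)) p
  set n := Module.finrank Ω V
  set B := A ^ p ^ n with hB
  have hle : ∀ μ : Ω, A.maxGenEigenspace μ ≤ B.eigenspace (μ ^ p ^ n) := fun μ v hv => by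
    rw [A.maxGenEigenspace_eq_genEigenspace_finrank μ, Module.End.mem_genEigenspace_nat,
      LinearMap.mem_ker] at hv
    have h1 : ((A - μ • (1 : Module.End Ω V)) ^ p ^ n) v = 0 := by
      rw [← Nat.sub_add_cancel (Nat.lt_pow_self hp.one_lt : n < p ^ n).le, pow_add,
        Module.End.mul_apply, hv, map_zero]
    rw [sub_pow_char_pow_of_commute _ _ ((Commute.one_right A).smul_right μ), smul_pow, one_pow,
      LinearMap.sub_apply, sub_eq_zero] at h1
    rw [Module.End.mem_eigenspace_iff, hB, h1]
    simp
  have htop : y ∈ ⨆ ν, B.eigenspace ν := by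
    have h := iSup_le fun μ => (hle μ).trans (le_iSup B.eigenspace _)
    rw [A.iSup_maxGenEigenspace_eq_top] at h
    exact h trivial
  obtain ⟨f, hf, hfy⟩ := (Submodule.mem_iSup_iff_exists_finsupp _ _).mp htop
  have hBinj : Function.Injective B := by
    rw [hB, Module.End.coe_pow]
    exact hA.iterate _
  have hpow : ∀ ν (j : ℕ), (B ^ j) (f ν) = ν ^ j • f ν := fun ν j => by
    induction j with
    | zero => simp
    | succ j ih =>
      rw [pow_succ', Module.End.mul_apply, ih, map_smul, Module.End.mem_eigenspace_iff.mp (hf ν),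
        smul_smul, pow_succ]
  have hBy : ∀ j : ℕ, (B ^ j) y = ∑ ν : f.support, (ν : Ω) ^ j • f ν := fun j => by
    rw [← hfy, Finsupp.sum, map_sum, ← Finset.sum_coe_sort]
    exact Finset.sum_congr rfl fun ν _ => hpow ν j
  have hne : ∀ ν : f.support, f ν ≠ 0 := fun ν => Finsupp.mem_support_iff.mp ν.2
  have hli : LinearIndependent Ω fun ν : f.support => f ν :=
    B.eigenvectors_linearIndependent' (fun ν : f.support => (ν : Ω)) Subtype.coe_injective _
      fun ν => ⟨hf ν, hne ν⟩
  obtain ⟨Φ, hΦ⟩ := LinearMap.exists_extend hli.repr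
  have hΦf : ∀ ν : f.support, Φ (f ν) = Finsupp.single ν 1 := fun ν => by
    have h := LinearMap.congr_fun hΦ ⟨f ν, Submodule.subset_span ⟨ν, rfl⟩⟩
    simpa using h.trans (hli.repr_eq_single ν _ rfl)
  refine ⟨p ^ n, Nat.pow_pos hp.pos, f.support, fun ν => Finsupp.lapply ν ∘ₗ Φ,
    fun ν => ⟨fun h0 => hne ν (hBinj ?_), fun j => ?_⟩, fun j c hc => ?_⟩
  · rw [map_zero, Module.End.mem_eigenspace_iff.mp (hf ν), h0, zero_smul]
  · rw [← hB, hBy, map_sum]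
    simp only [map_smul, hΦf, LinearMap.comp_apply, Finsupp.lapply_apply, smul_eq_mul]
    rw [Finset.sum_eq_single ν (fun ν' _ h => by simp [h])
      (fun h => absurd (Finset.mem_univ _) h)]
    simp
  · rw [← hB, hBy]
    simp only [hc]
    rw [← Finset.smul_sum, Finset.sum_coe_sort f.support (fun ν => f ν)]
    exact congrArg _ hfy

end LinearForms

section DegreeOneWords

open scoped Matrix

variable {ι κ Ω : Type*} [Field Ω] {F : ι → κ → MvPolynomial κ Ω} {d : ι → ℕ}

theorem formMap_injective_of_degree_one {κ : Type*} {F : κ → MvPolynomial κ Ω}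
    (hF : ∀ i, (F i).IsHomogeneous 1) (h0 : ∀ v, v ≠ 0 → formMap F v ≠ 0) :
    Function.Injective (formMap F) := by
  obtain ⟨A, hA⟩ := exists_linearMap_eq_formMap hF
  refine fun v v' h => sub_eq_zero.mp (not_ne_iff.mp fun hv => h0 _ hv ?_)
  rw [← hA, map_sub, hA, hA, h, sub_self]

/-- The linear maps along words in the letters of degree one. -/
theorem exists_linearMap_eq_wordMap (hF : ∀ t i, (F t i).IsHomogeneous (d t))
    (h0 : ∀ t v, v ≠ 0 → formMap (F t) v ≠ 0) :
    ∃ A : {t // d t = 1} → Module.End Ω (κ → Ω), (∀ t, Function.Injective (A t)) ∧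
      ∀ (l : List {t // d t = 1}) v, (l.map A).prod v = wordMap F (l.map Subtype.val) v := by
  have hF1 : ∀ t : {t // d t = 1}, ∀ i, (F t i).IsHomogeneous 1 := fun t i => by
    simpa only [t.2] using hF t i
  choose A hA using fun t : {t // d t = 1} => exists_linearMap_eq_formMap (hF1 t)
  refine ⟨A, fun t => ?_, fun l v => ?_⟩
  · rw [show ⇑(A t) = formMap (F t) from funext (hA t)]
    exact formMap_injective_of_degree_one (hF1 t) (h0 t)
  · induction l with
    | nil => rfl
    | cons t l ih =>
      rw [List.map_cons, List.prod_cons, Module.End.mul_apply, ih, hA, List.map_cons, wordMap_cons]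

variable [Fintype κ]

theorem exists_finite_degree_one_representatives [IsAlgClosed Ω] [Finite ι] (p : ℕ)
    [Fact p.Prime] [CharP Ω p] (hF : ∀ t i, (F t i).IsHomogeneous (d t))
    (h0 : ∀ t v, v ≠ 0 → formMap (F t) v ≠ 0) {X : κ → Ω}
    (hper : ∀ s, ∀ l : List {t // d t = 1}, l ≠ [] → ∃ k, 1 ≤ k ∧ ∃ c : Ω,
      (wordMap F (l.map Subtype.val) ^ k) (wordMap F s X) = c • wordMap F s X) :
    ∃ 𝓛 : Set (List {t // d t = 1}), 𝓛.Finite ∧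
      ∀ l : List {t // d t = 1}, ∃ l' ∈ 𝓛, ∀ s, ∃ c : Ω,
        wordMap F (l.map Subtype.val) (wordMap F s X) =
          c • wordMap F (l'.map Subtype.val) (wordMap F s X) := by
  obtain ⟨A, hinj, hA⟩ := exists_linearMap_eq_wordMap hF h0
  have hst : ∀ t, ∀ v ∈ Set.range fun s => wordMap F s X,
      A t v ∈ Set.range fun s => wordMap F s X := by
    rintro t _ ⟨s, rfl⟩
    refine ⟨t :: s, ?_⟩
    simpa [wordMap_cons, wordMap_nil] using (hA [t] (wordMap F s X)).symm
  obtain ⟨𝓛, hfin, h𝓛⟩ := exists_finite_word_representatives p A hinj hst (by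
    rintro _ ⟨s, rfl⟩ l hl
    obtain ⟨k, hk, c, hc⟩ := hper s l hl
    refine ⟨k, hk, c, ?_⟩
    rwa [← map_flatten_replicate (σ := fun l : List {t // d t = 1} => (l.map A).prod) rfl
      (fun l l' => by simp), hA, List.map_flatten, List.map_replicate, ← wordMap_pow])
  refine ⟨𝓛, hfin, fun l => ?_⟩
  obtain ⟨l', hl', h⟩ := h𝓛 l
  exact ⟨l', hl', fun s => by simpa only [hA] using h _ ⟨s, rfl⟩⟩

theorem finite_orbit_of_degree_one [IsAlgClosed Ω] [Finite ι] (p : ℕ)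
    [Fact p.Prime] [CharP Ω p] (hd : ∀ t, d t = 1) (hF : ∀ t i, (F t i).IsHomogeneous (d t))
    (h0 : ∀ t v, v ≠ 0 → formMap (F t) v ≠ 0) {X : κ → Ω} (hX : X ≠ 0)
    (hper : ∀ l ≠ [], ∃ k, 1 ≤ k ∧ ∃ c : Ω, (wordMap F l ^ k) X = c • X) :
    (Set.range fun l => Submodule.span Ω {wordMap F l X}).Finite := by
  classical
  have hsub : ∀ l : List ι, ∃ l' : List {t // d t = 1}, l = l'.map Subtype.val := fun l =>
    ⟨l.map fun t => ⟨t, hd t⟩, by simp [Function.comp_def]⟩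
  obtain ⟨A, hinj, hA⟩ := exists_linearMap_eq_wordMap hF h0
  have hmat : ∀ (l : List {t // d t = 1}) v,
      (l.map fun t => LinearMap.toMatrix' (A t)).prod *ᵥ v = wordMap F (l.map Subtype.val) v :=
    fun l v => by
      rw [← hA]
      induction l with
      | nil => simp
      | cons t l ih =>
        rw [List.map_cons, List.prod_cons, ← Matrix.mulVec_mulVec, ih, LinearMap.toMatrix'_mulVec,
          List.map_cons, List.prod_cons, Module.End.mul_apply]
  have hmatpow : ∀ (l : List {t // d t = 1}) (k : ℕ) v,
      ((l.map fun t => LinearMap.toMatrix' (A t)).prod ^ k) *ᵥ v =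
        (wordMap F (l.map Subtype.val) ^ k) v := fun l k v => by
    rw [← map_flatten_replicate (σ := fun l : List {t // d t = 1} =>
      (l.map fun t => LinearMap.toMatrix' (A t)).prod) rfl (fun l l' => by simp), hmat,
      List.map_flatten, List.map_replicate, ← wordMap_pow]
  have hunit : ∀ t, IsUnit (LinearMap.toMatrix' (A t)) := fun t => by
    rw [← Matrix.mulVec_injective_iff_isUnit]
    intro v v' h
    rw [LinearMap.toMatrix'_mulVec, LinearMap.toMatrix'_mulVec] at h
    exact hinj t h
  obtain ⟨N, hN, hword⟩ := Matrix.exists_uniform_word_exponent p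
    (fun t => LinearMap.toMatrix' (A t)) hunit X hX fun l hl => by
      obtain ⟨k, hk, c, hc⟩ := hper (l.map Subtype.val) (mt List.map_eq_nil_iff.mp hl)
      exact ⟨k, hk, c, by rw [hmatpow, hc]⟩
  obtain ⟨𝓛, hfin, h𝓛⟩ := exists_finite_degree_one_representatives p hF h0 (X := X) fun s l _ => by
    obtain ⟨s, rfl⟩ := hsub s
    obtain ⟨c, hc⟩ := hword l s
    exact ⟨N, hN, c, by rwa [hmatpow, hmat] at hc⟩
  refine (hfin.image fun l => Submodule.span Ω {wordMap F (l.map Subtype.val) X}).subset ?_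
  rintro _ ⟨l, rfl⟩
  obtain ⟨l, rfl⟩ := hsub l
  obtain ⟨l', hl', h⟩ := h𝓛 l
  obtain ⟨c, hc⟩ : ∃ c : Ω, _ = c • _ := h []
  refine ⟨l', hl', ?_⟩
  simp only [wordMap_nil] at hc
  beta_reduce
  rw [hc]
  refine (Submodule.span_singleton_smul_eq (IsUnit.mk0 c ?_) _).symm
  rintro rfl
  exact wordMap_ne_zero h0 _ hX (by simpa using hc)

end DegreeOneWords

section HeightDynamics

variable {ι κ I E : Type*} [Field E] {w : I → AbsoluteValue E ℝ}
  {F : ι → κ → MvPolynomial κ E} {d : ι → ℕ}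

theorem wordMap_pow_succ_apply {R : Type*} [CommSemiring R] (F : ι → κ → MvPolynomial κ R)
    (l : List ι) (m : ℕ) (v : κ → R) :
    (wordMap F l ^ (m + 1)) v = wordMap F l ((wordMap F l ^ m) v) := by
  rw [pow_succ']; rfl

theorem exists_wordMap_pow_eq_smul (hF : ∀ t i, (F t i).IsHomogeneous (d t)) {l : List ι}
    {X : κ → E} {c : E} (h : wordMap F l X = c • X) (m : ℕ) :
    ∃ c' : E, (wordMap F l ^ m) X = c' • X := by
  induction m with
  | zero => exact ⟨1, (one_smul E X).symm⟩
  | succ m ih =>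
    obtain ⟨c', hc'⟩ := ih
    refine ⟨c' ^ wordDegree d l * c, ?_⟩
    rw [wordMap_pow_succ_apply, hc', wordMap_smul hF, h, smul_smul]

theorem exists_wordDegree_mul_logHeight_le
    (h0 : ∀ t v, v ≠ 0 → formMap (F t) v ≠ 0)
    (hH : ∀ t, ∃ C, ∀ v, v ≠ 0 → d t * logHeight w v ≤ logHeight w (formMap (F t) v) + C)
    (l : List ι) :
    ∃ C, ∀ v, v ≠ 0 → wordDegree d l * logHeight w v ≤ logHeight w (wordMap F l v) + C := by
  induction l with
  | nil => exact ⟨0, fun v _ => by simp [wordDegree, wordMap_nil]⟩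
  | cons t l ih =>
    obtain ⟨C, hC⟩ := ih
    obtain ⟨C', hC'⟩ := hH t
    refine ⟨C' + d t * C, fun v hv => ?_⟩
    have h1 := hC' _ (wordMap_ne_zero h0 l hv)
    have h2 := mul_le_mul_of_nonneg_left (hC v hv) (Nat.cast_nonneg (α := ℝ) (d t))
    rw [wordMap_cons]
    simp only [wordDegree, List.map_cons, List.prod_cons, Nat.cast_mul] at h2 ⊢
    linarith

variable [Finite κ]

/-- In the presence of a letter of degree at least two, heights along the orbit of a point which is
periodic under all words do not grow linearly under iteration of a word. -/
theorem exists_logHeight_pow_lt (hw : IsNorthcottFamily w) (hd : ∀ t, 1 ≤ d t)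
    (hF : ∀ t i, (F t i).IsHomogeneous (d t)) (h0 : ∀ t v, v ≠ 0 → formMap (F t) v ≠ 0)
    (hH : ∀ t, ∃ C, ∀ v, v ≠ 0 → d t * logHeight w v ≤ logHeight w (formMap (F t) v) + C)
    {X : κ → E} (hX : X ≠ 0)
    (hper : ∀ l ≠ [], ∃ k, 1 ≤ k ∧ ∃ c : E, (wordMap F l ^ k) X = c • X)
    {f : ι} (hf : 2 ≤ d f) (s u : List ι) {η : ℝ} (hη : 0 < η) (B : ℝ) :
    ∃ j : ℕ, logHeight w ((wordMap F u ^ j) (wordMap F s X)) < j * η - B := by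
  by_contra! hgrow
  have hne : ∀ l v, v ≠ 0 → wordMap F l v ≠ 0 := fun l v hv => wordMap_ne_zero h0 l hv
  obtain ⟨c, hc0, hc⟩ : ∃ c, 0 ≤ c ∧
      ∀ v, v ≠ 0 → logHeight w v ≤ logHeight w (wordMap F u v) + c := by
    obtain ⟨c, hc⟩ := exists_wordDegree_mul_logHeight_le h0 hH u
    refine ⟨max 0 c, le_max_left _ _, fun v hv => ?_⟩
    have h1 : (1 : ℝ) ≤ wordDegree d u := by exact_mod_cast one_le_wordDegree hd u
    have h2 := le_mul_of_one_le_left (logHeight_nonneg hw hv) h1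
    linarith [hc v hv, le_max_right 0 c]
  have hupow : ∀ (j : ℕ) v, v ≠ 0 →
      logHeight w v ≤ logHeight w ((wordMap F u ^ j) v) + j * c := fun j v hv => by
    induction j with
    | zero => exact (by simp : logHeight w v ≤ logHeight w v + (0 : ℕ) * c)
    | succ j ih =>
      have h1 := hc ((wordMap F u ^ j) v) (by rw [wordMap_pow]; exact hne _ _ hv)
      rw [wordMap_pow_succ_apply]
      push_cast
      linarith
  obtain ⟨m, hm⟩ := pow_unbounded_of_one_lt ((c + 1) / η + 1) one_lt_two
  obtain ⟨k, hk, a, ha⟩ := hper [f] (by simp)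
  rw [wordMap_pow] at ha
  obtain ⟨b, hb⟩ := exists_wordMap_pow_eq_smul hF ha m
  rw [wordMap_pow] at hb
  set r := (List.replicate m (List.replicate k [f]).flatten).flatten
  have hr : (2 : ℝ) ^ m ≤ wordDegree d r := by
    have happ : ∀ l l', wordDegree d (l ++ l') = wordDegree d l * wordDegree d l' := fun l l' => by
      simp [wordDegree]
    have h1 : wordDegree d r = (d f ^ k) ^ m := by
      rw [map_flatten_replicate (σ := wordDegree d) rfl happ,
        map_flatten_replicate (σ := wordDegree d) rfl happ]
      simp [wordDegree]
    rw [h1]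
    exact_mod_cast Nat.pow_le_pow_left (hf.trans (Nat.le_self_pow (by omega) _)) m
  set D : ℝ := ((wordDegree d (s ++ r) : ℕ) : ℝ)
  have hDm : (c + 1) / η + 1 < D := by
    refine hm.trans_le (hr.trans ?_)
    have h1 : wordDegree d r ≤ wordDegree d (s ++ r) := by
      simp only [wordDegree, List.map_append, List.prod_append]
      exact Nat.le_mul_of_pos_left _ (one_le_wordDegree hd s)
    exact Nat.cast_le.mpr h1
  have hDη : c + 1 ≤ (D - 1) * η := by
    rw [← div_le_iff₀ hη]; linarith
  have hD1 : 1 < D := by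
    have : 0 ≤ (c + 1) / η := by positivity
    linarith
  obtain ⟨C, hC⟩ := exists_wordDegree_mul_logHeight_le h0 hH (s ++ r)
  obtain ⟨j, hj⟩ := exists_nat_gt ((D - 1) * B + C)
  set g := (List.replicate j u).flatten ++ (s ++ r) with hg
  have hgv : ∀ v, wordMap F g v = (wordMap F u ^ j) (wordMap F (s ++ r) v) := fun v => by
    rw [hg, wordMap_append, wordMap_pow]
  have hstep : ∀ v, v ≠ 0 → j * η - B ≤ logHeight w v →
      logHeight w v < logHeight w (wordMap F g v) := fun v hv hvB => by
    have h1 := hupow j _ (hne (s ++ r) v hv)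
    have h2 := hC v hv
    have h3 := mul_le_mul_of_nonneg_left hvB (sub_nonneg.mpr hD1.le)
    have h4 := mul_le_mul_of_nonneg_left hDη (Nat.cast_nonneg (α := ℝ) j)
    rw [hgv]
    nlinarith
  have h1 : j * η - B ≤ logHeight w (wordMap F g X) := by
    have hb0 : b ^ wordDegree d s ≠ 0 := fun h => by
      have := hne (s ++ r) X hX
      rw [wordMap_append, hb, wordMap_smul hF, h, zero_smul] at this
      exact this rfl
    rw [hgv, wordMap_append, hb, wordMap_smul hF, wordMap_pow, wordMap_smul hF,
      logHeight_smul hw (pow_ne_zero _ hb0) (hne _ _ (hne _ _ hX)), ← wordMap_pow]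
    exact hgrow j
  have hgne : ∀ i : ℕ, (wordMap F g ^ i) X ≠ 0 := fun i => by
    rw [wordMap_pow]; exact hne _ _ hX
  have hiter : ∀ i : ℕ, j * η - B ≤ logHeight w ((wordMap F g ^ (i + 1)) X) := fun i => by
    induction i with
    | zero => rwa [zero_add, pow_one]
    | succ i ih =>
      rw [wordMap_pow_succ_apply F g (i + 1)]
      exact ih.trans (hstep _ (hgne _) ih).le
  have hmono : StrictMono fun i : ℕ => logHeight w ((wordMap F g ^ (i + 1)) X) :=
    strictMono_nat_of_lt_succ fun i => by
      rw [wordMap_pow_succ_apply F g (i + 1)]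
      exact hstep _ (hgne _) (hiter i)
  obtain ⟨k', hk', a', ha'⟩ := hper g (fun hg0 => by
    have h2 := (List.append_eq_nil_iff.mp hg0).2
    simp [D, h2, wordDegree] at hD1)
  have ha0 : a' ≠ 0 := by
    rintro rfl
    exact hgne k' (by rw [ha', zero_smul])
  refine (hmono (Nat.lt_of_lt_of_le one_pos hk')).ne' ?_
  beta_reduce
  rw [wordMap_pow_succ_apply, ha', wordMap_smul hF,
    logHeight_smul hw (pow_ne_zero _ ha0) (hne g X hX), zero_add, pow_one]

end HeightDynamics

section BoundedHeights

variable {ι κ I E : Type*} [Field E] [Finite κ] [Finite ι] {w : I → AbsoluteValue E ℝ}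
  {F : ι → κ → MvPolynomial κ E} {d : ι → ℕ}

/-- If the words in the letters of degree one act on an orbit through finitely many maps, up to
scalars, then the heights on the orbit of a periodic point are bounded. -/
theorem exists_logHeight_orbit_le (hw : IsNorthcottFamily w) (hd : ∀ t, 1 ≤ d t)
    (hF : ∀ t i, (F t i).IsHomogeneous (d t)) (h0 : ∀ t v, v ≠ 0 → formMap (F t) v ≠ 0)
    (hH : ∀ t, ∃ C, ∀ v, v ≠ 0 → d t * logHeight w v ≤ logHeight w (formMap (F t) v) + C)
    {X : κ → E} (hX : X ≠ 0)
    (hper : ∀ l ≠ [], ∃ k, 1 ≤ k ∧ ∃ c : E, (wordMap F l ^ k) X = c • X)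
    {f : ι} (hf : 2 ≤ d f) {𝓛 : Set (List {t // d t = 1})} (hfin : 𝓛.Finite)
    (hrep : ∀ l : List {t // d t = 1}, ∃ l' ∈ 𝓛, ∀ s, ∃ c : E,
      wordMap F (l.map Subtype.val) (wordMap F s X) =
        c • wordMap F (l'.map Subtype.val) (wordMap F s X)) :
    ∃ B, ∀ s, logHeight w (wordMap F s X) ≤ B := by
  have hne : ∀ l v, v ≠ 0 → wordMap F l v ≠ 0 := fun l v hv => wordMap_ne_zero h0 l hv
  have hscale : ∀ {c : E} {v v' : κ → E}, v ≠ 0 → v = c • v' →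
      c ≠ 0 ∧ v' ≠ 0 := fun hv h => by
    constructor <;> rintro rfl <;> simp [h] at hv
  choose C₁ hC₁ using exists_wordDegree_mul_logHeight_le (w := w) h0 hH
  choose C₂ hC₂ using hH
  obtain ⟨C, hC0, hCl, hCt⟩ : ∃ C : ℝ, 0 ≤ C ∧ (∀ l ∈ 𝓛, C₁ (l.map Subtype.val) ≤ C) ∧
      ∀ t, C₂ t ≤ C := by
    obtain ⟨a, ha⟩ := (hfin.image fun l => C₁ (l.map Subtype.val)).bddAbove
    obtain ⟨b, hb⟩ := (Set.finite_range C₂).bddAbove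
    exact ⟨max 0 (max a b), le_max_left _ _,
      fun l hl => (ha ⟨l, hl, rfl⟩).trans ((le_max_left a b).trans (le_max_right _ _)),
      fun t => (hb ⟨t, rfl⟩).trans ((le_max_right a b).trans (le_max_right _ _))⟩
  have hone : ∀ (l : List {t // d t = 1}) s,
      logHeight w (wordMap F s X) ≤
        logHeight w (wordMap F (l.map Subtype.val) (wordMap F s X)) + C := fun l s => by
    obtain ⟨l', hl', h⟩ := hrep l
    obtain ⟨c, hc⟩ := h s
    obtain ⟨hc0, hv⟩ := hscale (hne _ _ (hne s X hX)) hc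
    have h1 := hC₁ (l'.map Subtype.val) _ (hne s X hX)
    have h2 : wordDegree d (l'.map Subtype.val) = 1 := List.prod_eq_one (by
      simp only [List.mem_map]
      rintro _ ⟨_, ⟨t, _, rfl⟩, rfl⟩
      exact t.2)
    rw [h2, Nat.cast_one, one_mul] at h1
    rw [hc, logHeight_smul hw hc0 hv]
    linarith [hCl l' hl']
  let Q (M : ℝ) (v : κ → E) : Prop :=
    ∀ l : List {t // d t = 1}, M ≤ logHeight w (wordMap F (l.map Subtype.val) v)
  have hQ2 : ∀ {M s t}, 2 ≤ d t → Q M (wordMap F s X) → Q (2 * M - 2 * C) (wordMap F (t :: s) X) :=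
    fun {M s t} ht hQ l => by
    have h1 := hone l (t :: s)
    have h2 := hC₂ t _ (hne s X hX)
    have h3 : M ≤ logHeight w (wordMap F s X) := hQ []
    have h4 : 2 * logHeight w (wordMap F s X) ≤ d t * logHeight w (wordMap F s X) :=
      mul_le_mul_of_nonneg_right (by exact_mod_cast ht) (logHeight_nonneg hw (hne s X hX))
    rw [← wordMap_cons] at h2
    linarith [hCt t]
  have hQstep : ∀ {M s} t, 2 * C ≤ M → Q M (wordMap F s X) → Q M (wordMap F (t :: s) X) :=
    fun {M s} t hM hQ => by
    rcases (hd t).eq_or_lt with h1 | h2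
    · intro l
      have := hQ (l ++ [⟨t, h1.symm⟩])
      rwa [List.map_append, wordMap_append] at this
    · exact fun l => by linarith [hQ2 h2 hQ l]
  have hQword : ∀ {M s} l, 2 * C ≤ M → Q M (wordMap F s X) → Q M (wordMap F (l ++ s) X) :=
    fun {M s} l hM hQ => by
    induction l with
    | nil => exact hQ
    | cons t l ih => exact hQstep t hM ih
  have hQloop : ∀ {M} s, 2 * C ≤ M → Q M (wordMap F s X) →
      Q (2 * M - 2 * C) (wordMap F s X) := fun {M} s hM hQ => by
    obtain ⟨k, hk, c, hc⟩ := hper (f :: s) (by simp)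
    obtain ⟨k, rfl⟩ := Nat.exists_eq_add_of_le' hk
    have hc0 : c ≠ 0 := (hscale (by rw [wordMap_pow]; exact hne _ _ hX) hc).1
    have h1 := hQword (s ++ (List.replicate k (f :: s)).flatten) (by linarith) (hQ2 hf hQ)
    rw [List.append_assoc, wordMap_append, wordMap_append, ← wordMap_pow] at h1
    have h2 : (wordMap F (f :: s) ^ k) (wordMap F (f :: s) X) = c • X := by
      rw [← hc, pow_succ]; rfl
    rw [h2, wordMap_smul hF] at h1
    intro l
    have h3 := h1 l
    rwa [wordMap_smul hF, logHeight_smul hw (pow_ne_zero _ (pow_ne_zero _ hc0))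
      (hne _ _ (hne s X hX))] at h3
  refine ⟨3 * C + 1, fun s => ?_⟩
  by_contra! hlt
  have hall : ∀ n : ℕ, Q (2 * C + 2 ^ n) (wordMap F s X) := fun n => by
    induction n with
    | zero => exact fun l => by rw [pow_zero]; linarith [hone l s]
    | succ n ih =>
      have h1 := hQloop s (by linarith [pow_pos (zero_lt_two' ℝ) n]) ih
      rwa [show 2 * (2 * C + 2 ^ n) - 2 * C = 2 * C + 2 ^ (n + 1) by ring] at h1
  obtain ⟨n, hn⟩ := pow_unbounded_of_one_lt (logHeight w (wordMap F s X)) (one_lt_two : (1 : ℝ) < 2)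
  have h1 : 2 * C + 2 ^ n ≤ logHeight w (wordMap F s X) := hall n []
  linarith

end BoundedHeights

section CharPOrbit

variable {ι κ : Type*} {Ω : Type u} [Field Ω] {F : ι → κ → MvPolynomial κ Ω}
  {d : ι → ℕ}

theorem Subfield.exists_eq_smul {L : Subfield Ω} {Y Z : κ → L} (hZ : Z ≠ 0) {c : Ω}
    (h : L.subtype ∘ Y = c • (L.subtype ∘ Z)) : ∃ c' : L, Y = c' • Z := by
  have hinj : Function.Injective L.subtype := L.subtype_injective
  have hZ' : L.subtype ∘ Z ≠ 0 := fun h0 => hZ (funext fun i => hinj (congrFun h0 i))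
  exact (parallel_iff_exists_smul hZ).mp
    ((parallel_map_iff hinj).mp ((parallel_iff_exists_smul hZ').mpr ⟨c, h⟩))

variable [Fintype κ]

/-- A system of forms with a point periodic under all words descends to a subfield with heights. -/
theorem exists_northcott_model [IsAlgClosed Ω] [Finite ι] (p : ℕ) [Fact p.Prime] [CharP Ω p]
    (hF : ∀ t i, (F t i).IsHomogeneous (d t)) (h0 : ∀ t v, v ≠ 0 → formMap (F t) v ≠ 0)
    {X : κ → Ω} (hX : X ≠ 0)
    (hper : ∀ l ≠ [], ∃ k, 1 ≤ k ∧ ∃ c : Ω, (wordMap F l ^ k) X = c • X) (s : Finset Ω) :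
    ∃ L : Subfield Ω, (s : Set Ω) ⊆ L ∧ ∃ (I : Type u) (w : I → AbsoluteValue L ℝ),
      IsNorthcottFamily w ∧ ∃ (f : ι → κ → MvPolynomial κ L) (Y : κ → L), Y ≠ 0 ∧
        (∀ t i, (f t i).IsHomogeneous (d t)) ∧ (∀ t v, v ≠ 0 → formMap (f t) v ≠ 0) ∧
        (∀ t, ∃ C, ∀ v, v ≠ 0 → d t * logHeight w v ≤ logHeight w (formMap (f t) v) + C) ∧
        (∀ l ≠ [], ∃ k, 1 ≤ k ∧ ∃ c : L, (wordMap f l ^ k) Y = c • Y) ∧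
        ∀ l, L.subtype ∘ wordMap f l Y = wordMap F l X := by
  classical
  have := Fintype.ofFinite ι
  choose M G hG hGF using fun t => exists_pow_eq_sum_mul (hF t) (h0 t)
  obtain ⟨L, hL, I, w, hw⟩ := exists_subfield_isNorthcottFamily p
    (s ∪ Finset.univ.image X ∪ (Finset.univ.biUnion fun t => Finset.univ.biUnion fun i =>
      (F t i).coeffs ∪ Finset.univ.biUnion fun j => (G t i j).coeffs))
  have hinj : Function.Injective L.subtype := L.subtype_injective
  have hrange : ∀ {q : MvPolynomial κ Ω}, (∀ a ∈ q.coeffs, a ∈ L) → ∃ q', map L.subtype q' = q :=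
    fun h => mem_range_map_iff_coeffs_subset.mpr fun a ha => ⟨⟨a, h a ha⟩, rfl⟩
  choose f hf using fun t i => hrange (q := F t i) fun a ha => hL (by
    simp only [Finset.coe_union, Set.mem_union, Finset.mem_coe, Finset.mem_biUnion,
      Finset.mem_univ, true_and, Finset.mem_union]
    exact Or.inr ⟨t, i, Or.inl ha⟩)
  choose g hg using fun t i j => hrange (q := G t i j) fun a ha => hL (by
    simp only [Finset.coe_union, Set.mem_union, Finset.mem_coe, Finset.mem_biUnion,
      Finset.mem_univ, true_and, Finset.mem_union]
    exact Or.inr ⟨t, i, Or.inr ⟨j, ha⟩⟩)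
  let Y : κ → L := fun i => ⟨X i, hL (by simp)⟩
  have hYX : L.subtype ∘ Y = X := rfl
  have hfF : (fun t i => map L.subtype (f t i)) = F := funext fun t => funext fun i => hf t i
  have hword : ∀ l, L.subtype ∘ wordMap f l Y = wordMap F l X := fun l => by
    rw [← wordMap_map, hfF, hYX]
  have hmap0 : ∀ {v : κ → L}, L.subtype ∘ v = 0 → v = 0 := fun h =>
    funext fun i => hinj (congrFun h i)
  have hY : Y ≠ 0 := fun h => hX (by rw [← hYX, h]; rfl)
  have hf0 : ∀ t v, v ≠ 0 → formMap (f t) v ≠ 0 := fun t v hv h => by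
    refine h0 t (L.subtype ∘ v) (mt hmap0 hv) ?_
    rw [← funext (hf t), formMap_map, h]
    rfl
  refine ⟨L, fun a ha => hL (by simp [Finset.mem_coe.mp ha]), I, w, hw, f, Y, hY,
    fun t i => IsHomogeneous.of_map hinj (by rw [hf]; exact hF t i), hf0, fun t => ?_,
    fun l hl => ?_, hword⟩
  · obtain ⟨C, hC⟩ := exists_mul_logHeight_le hw (F := f t) (G := g t) (d := d t) (M := M t)
      (fun i j => IsHomogeneous.of_map hinj (by rw [hg]; exact hG t i j))
      fun i => map_injective _ hinj (by simp only [map_sum, map_mul, hf, hg, hGF, map_pow, map_X])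
    exact ⟨C, fun v hv => hC v hv (hf0 t v hv)⟩
  · obtain ⟨k, hk, c, hc⟩ := hper l hl
    refine ⟨k, hk, Subfield.exists_eq_smul hY (c := c) ?_⟩
    rw [wordMap_pow, hword, hYX, ← wordMap_pow, hc]

/-- In the presence of a letter of degree at least two, every word in the letters of degree one
acts periodically on the orbit of a point which is periodic under all words. -/
theorem exists_pow_degree_one_word_eq_smul [IsAlgClosed Ω] [Finite ι] (p : ℕ) [Fact p.Prime]
    [CharP Ω p] (hd : ∀ t, 1 ≤ d t)
    (hF : ∀ t i, (F t i).IsHomogeneous (d t)) (h0 : ∀ t v, v ≠ 0 → formMap (F t) v ≠ 0)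
    {X : κ → Ω} (hX : X ≠ 0)
    (hper : ∀ l ≠ [], ∃ k, 1 ≤ k ∧ ∃ c : Ω, (wordMap F l ^ k) X = c • X)
    {t : ι} (ht : 2 ≤ d t) (s : List ι) (l : List {t // d t = 1}) :
    ∃ k, 1 ≤ k ∧ ∃ c : Ω,
      (wordMap F (l.map Subtype.val) ^ k) (wordMap F s X) = c • wordMap F s X := by
  classical
  obtain ⟨A, hinj, hA⟩ := exists_linearMap_eq_wordMap hF h0
  have hAl : Function.Injective (l.map A).prod := by
    induction l with
    | nil => exact Function.injective_id
    | cons t l ih =>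
      rw [List.map_cons, List.prod_cons, Module.End.mul_eq_comp, LinearMap.coe_comp]
      exact (hinj t).comp ih
  have hApow : ∀ (k : ℕ) v, ((l.map A).prod ^ k) v = (wordMap F (l.map Subtype.val) ^ k) v :=
    fun k v => by
      induction k with
      | zero => rfl
      | succ k ih =>
        rw [pow_succ', Module.End.mul_apply, ih, hA, wordMap_pow_succ_apply]
  obtain ⟨q, hq, S, D, hD, hpow⟩ := Module.End.exists_diagonal_pow p hAl (wordMap F s X)
  have hroot : ∀ μ ν : S, ∃ n, 1 ≤ n ∧ (μ : Ω) ^ n = (ν : Ω) ^ n := by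
    obtain ⟨L, hL, I, w, hw, f, Y, hY, hf, hf0, hH, hfper, hword⟩ :=
      exists_northcott_model p hF h0 hX hper
        (S ∪ Finset.univ.biUnion fun μ =>
          Finset.univ.image fun i => D μ fun j => if i = j then 1 else 0)
    let a (μ : S) (i : κ) : L := ⟨D μ fun j => if i = j then 1 else 0,
      hL (by simp)⟩
    let b (μ : S) : L := ⟨μ, hL (by simp)⟩
    let u := (List.replicate q (l.map Subtype.val)).flatten
    have hb0 : ∀ μ, b μ ≠ 0 := fun μ h => (hD μ).1 (congrArg Subtype.val h)
    have hdot : ∀ μ (j : ℕ), a μ ⬝ᵥ (wordMap f u ^ j) (wordMap f s Y) = b μ ^ j := fun μ j => by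
      refine L.subtype_injective ?_
      rw [map_pow]
      refine Eq.trans ?_ ((hD μ).2 j)
      have hv : L.subtype ∘ (wordMap f u ^ j) (wordMap f s Y) =
          (((l.map A).prod ^ q) ^ j) (wordMap F s X) := by
        rw [← pow_mul, hApow, pow_mul, wordMap_pow, wordMap_pow, wordMap_pow, ← wordMap_append,
          hword, wordMap_append]
      rw [← hv, LinearMap.pi_apply_eq_sum_univ (D μ), dotProduct, map_sum]
      refine Finset.sum_congr rfl fun i _ => ?_
      rw [map_mul, mul_comm]
      rfl
    intro μ ν
    obtain ⟨C, hC⟩ := exists_elementLogHeight_div_le hw (a μ) (a ν)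
    rcases (elementLogHeight_nonneg w (b μ / b ν)).eq_or_lt with h | hη
    · obtain ⟨n, hn, hn1⟩ := exists_pow_eq_one_of_elementLogHeight_eq_zero hw
        (div_ne_zero (hb0 μ) (hb0 ν)) h.symm
      rw [div_pow, div_eq_one_iff_eq (pow_ne_zero _ (hb0 ν))] at hn1
      exact ⟨n, hn, congrArg Subtype.val hn1⟩
    · obtain ⟨j, hj⟩ := exists_logHeight_pow_lt hw hd hf hf0 hH hY hfper ht s u hη C
      have h1 := hC ((wordMap f u ^ j) (wordMap f s Y))
        (by rw [hdot]; exact pow_ne_zero _ (hb0 ν))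
      rw [hdot, hdot, ← div_pow, elementLogHeight_pow] at h1
      linarith
  choose n hn hroot using hroot
  let N := ∏ μ, ∏ ν, n μ ν
  have hN : 0 < N := Finset.prod_pos fun μ _ => Finset.prod_pos fun ν _ => hn μ ν
  have hNeq : ∀ μ ν : S, (μ : Ω) ^ N = (ν : Ω) ^ N := fun μ ν => by
    obtain ⟨m, hm⟩ : n μ ν ∣ N := (Finset.dvd_prod_of_mem (n μ) (Finset.mem_univ ν)).trans
      (Finset.dvd_prod_of_mem (fun μ => ∏ ν, n μ ν) (Finset.mem_univ μ))
    rw [hm, pow_mul, pow_mul, hroot]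
  obtain ⟨c, hc⟩ : ∃ c, ∀ μ : S, (μ : Ω) ^ N = c := by
    rcases isEmpty_or_nonempty S with h | ⟨⟨ν⟩⟩
    · exact ⟨0, fun μ => h.elim μ⟩
    · exact ⟨_, fun μ => hNeq μ ν⟩
  exact ⟨q * N, Nat.mul_pos hq hN, c, by rw [← hApow, pow_mul, hpow N c hc]⟩

theorem finite_orbit_of_charP [IsAlgClosed Ω] [Finite ι] (p : ℕ) [Fact p.Prime] [CharP Ω p]
    (hd : ∀ t, 1 ≤ d t)
    (hF : ∀ t i, (F t i).IsHomogeneous (d t)) (h0 : ∀ t v, v ≠ 0 → formMap (F t) v ≠ 0)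
    {X : κ → Ω} (hX : X ≠ 0)
    (hper : ∀ l ≠ [], ∃ k, 1 ≤ k ∧ ∃ c : Ω, (wordMap F l ^ k) X = c • X) :
    (Set.range fun l => Submodule.span Ω {wordMap F l X}).Finite := by
  by_cases hd1 : ∀ t, d t = 1
  · exact finite_orbit_of_degree_one p hd1 hF h0 hX hper
  push Not at hd1
  obtain ⟨t, ht⟩ := hd1
  have ht : 2 ≤ d t := by have := hd t; omega
  obtain ⟨𝓛, hfin, hrep⟩ := exists_finite_degree_one_representatives p hF h0 (X := X)
    fun s l _ => exists_pow_degree_one_word_eq_smul p hd hF h0 hX hper ht s l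
  obtain ⟨L, -, I, w, hw, f, Y, hY, hf, hf0, hH, hfper, hword⟩ :=
    exists_northcott_model p hF h0 hX hper ∅
  obtain ⟨B, hB⟩ := exists_logHeight_orbit_le hw hd hf hf0 hH hY hfper ht hfin fun l => by
    obtain ⟨l', hl', h⟩ := hrep l
    refine ⟨l', hl', fun s => ?_⟩
    obtain ⟨c, hc⟩ := h s
    refine Subfield.exists_eq_smul (c := c)
      (wordMap_ne_zero hf0 _ (wordMap_ne_zero hf0 _ hY)) ?_
    rw [← wordMap_append, ← wordMap_append, hword, hword, wordMap_append, wordMap_append, hc]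
  obtain ⟨𝓕, h𝓕, hmem⟩ := exists_finite_of_logHeight_le (κ := κ) hw B
  refine (h𝓕.image fun v => Submodule.span Ω {L.subtype ∘ v}).subset ?_
  rintro _ ⟨l, rfl⟩
  obtain ⟨c, hc0, hc⟩ := hmem _ (wordMap_ne_zero hf0 l hY) (hB l)
  refine ⟨_, hc, ?_⟩
  have h1 : L.subtype ∘ (c • wordMap f l Y) = (c : Ω) • wordMap F l X := by
    rw [← hword]; rfl
  beta_reduce
  rw [h1]
  exact Submodule.span_singleton_smul_eq
    (IsUnit.mk0 (c : Ω) fun h => hc0 (Subtype.ext h)) _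

end CharPOrbit

section ProjectiveOrbit

theorem finite_orbit {ι κ Ω : Type*} [Finite ι] [Fintype κ] [Field Ω] [IsAlgClosed Ω]
    {F : ι → κ → MvPolynomial κ Ω} {d : ι → ℕ} (hd : ∀ t, 1 ≤ d t)
    (hF : ∀ t i, (F t i).IsHomogeneous (d t)) (h0 : ∀ t v, v ≠ 0 → formMap (F t) v ≠ 0)
    {X : κ → Ω} (hX : X ≠ 0)
    (hper : ∀ l ≠ [], ∃ k, 1 ≤ k ∧ ∃ c : Ω, (wordMap F l ^ k) X = c • X) :
    (Set.range fun l => Submodule.span Ω {wordMap F l X}).Finite := by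
  obtain ⟨p, hp⟩ := CharP.exists Ω
  rcases CharP.char_is_prime_or_zero Ω p with h | rfl
  · have := Fact.mk h
    exact finite_orbit_of_charP p hd hF h0 hX hper
  · have := CharP.charP_to_charZero Ω
    exact finite_orbit_of_charZero hd hF h0 hX hper

theorem aeval_eq_of_isHomogeneous_zero {σ R A : Type*} [CommSemiring R]
    [CommSemiring A] [Algebra R A] {q : MvPolynomial σ R} (hq : q.IsHomogeneous 0) (v w : σ → A) :
    aeval v q = aeval w q := by
  rw [totalDegree_eq_zero_iff_eq_C.mp (Nat.le_zero.mp hq.totalDegree_le), aeval_C, aeval_C]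

/-- A product of maps given by forms acts on lines through the word in those forms. -/
theorem prod_map_apply_mk {ι κ Ω : Type*} [Field Ω] {F : ι → κ → MvPolynomial κ Ω}
    (h0 : ∀ t v, v ≠ 0 → formMap (F t) v ≠ 0) {φ : ι → Function.End (Projectivization Ω (κ → Ω))}
    (hφ : ∀ t v hv, φ t (.mk Ω v hv) = .mk Ω (formMap (F t) v) (h0 t v hv))
    (l : List ι) {v : κ → Ω} (hv : v ≠ 0) :
    (l.map φ).prod (.mk Ω v hv) = .mk Ω (wordMap F l v) (wordMap_ne_zero h0 l hv) := by
  induction l with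
  | nil => rfl
  | cons t l ih =>
    rw [List.map_cons, List.prod_cons]
    exact (congrArg (φ t) ih).trans (hφ t _ _)

theorem Subsemigroup.list_prod_mem {M : Type*} [Monoid M] (S : Subsemigroup M) {l : List M}
    (hl : l ≠ []) (h : ∀ a ∈ l, a ∈ S) : l.prod ∈ S := by
  induction l with
  | nil => exact absurd rfl hl
  | cons a l ih =>
    rcases eq_or_ne l [] with rfl | hl'
    · simpa using h
    · rw [List.prod_cons]
      exact mul_mem (h a (by simp)) (ih hl' fun b hb => h b (by simp [hb]))

end ProjectiveOrbit

/-- **Theorem (polar-burn).** Let `S` be a finitely generated semigroup (under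
composition) of morphisms `ℙ^n_K → ℙ^n_K`.  If `x ∈ ℙ^n(K̄)` is periodic under every
element of `S`, then the orbit `S·x` is finite. -/
theorem orbit_finite_of_periodic_under_semigroup (K : Type*) [Field K] (n : ℕ)
    (S : Subsemigroup
      (Function.End (Projectivization (AlgebraicClosure K) (Fin (n + 1) → AlgebraicClosure K))))
    -- `S` is finitely generated
    (hSfg : ∃ T : Finset
        (Function.End (Projectivization (AlgebraicClosure K) (Fin (n + 1) → AlgebraicClosure K))),
      Subsemigroup.closure (T : Set _) = S)
    -- every element of `S` is a morphism of `ℙ^n` defined over `K`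
    (hmor : ∀ φ ∈ S, IsProjMorphism K n φ)
    (x : Projectivization (AlgebraicClosure K) (Fin (n + 1) → AlgebraicClosure K))
    -- `x` is periodic under every element of `S`
    (hx : ∀ g ∈ S, ∃ k, 1 ≤ k ∧ (g ^ k) x = x) :
    {y | ∃ g ∈ S, y = g x}.Finite := by
  obtain ⟨T, rfl⟩ := hSfg
  have hT : ∀ t : T, t.1 ∈ Subsemigroup.closure (T : Set _) :=
    fun t => Subsemigroup.mem_closure_of_mem t.2
  choose d ps hps hps0 happly using fun t : T => hmor t (hT t)
  let F (t : {t // 1 ≤ d t}) (i : Fin (n + 1)) : MvPolynomial (Fin (n + 1)) (AlgebraicClosure K) :=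
    map (algebraMap K _) (ps t i)
  have hFps : ∀ t v, formMap (F t) v = fun i => aeval v (ps t i) := fun t v => by
    funext i
    rw [formMap_apply, eval_map, aeval_def]
  have h0 : ∀ t v, v ≠ 0 → formMap (F t) v ≠ 0 := fun t v hv => by
    rw [hFps]
    exact hps0 t v hv
  have hφ : ∀ (t : {t // 1 ≤ d t}) v hv, (t : T).1 (.mk (AlgebraicClosure K) v hv) =
      .mk (AlgebraicClosure K) (formMap (F t) v) (h0 t v hv) := fun t v hv => by
    simp only [hFps]
    exact happly t v hv _
  have hword := fun l => prod_map_apply_mk h0 hφ l x.rep_nonzero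
  have hfin := finite_orbit (F := F) (fun t => t.2) (fun t i => (hps t i).map _) h0 x.rep_nonzero
    fun l hl => by
      obtain ⟨k, hk, h⟩ := hx (l.map fun t => t.1.1).prod <|
        Subsemigroup.list_prod_mem _ (mt List.map_eq_nil_iff.mp hl) fun a ha => by
          obtain ⟨t, -, rfl⟩ := List.mem_map.mp ha
          exact hT t
      have h1 := hword (List.replicate k l).flatten
      rw [List.map_flatten, List.map_replicate, List.prod_flatten, List.map_replicate,
        List.prod_replicate, x.mk_rep, h] at h1
      conv_lhs at h1 => rw [← x.mk_rep]
      obtain ⟨c, hc⟩ := (Projectivization.mk_eq_mk_iff' _ _ _ _ _).mp h1.symm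
      exact ⟨k, hk, c, by rw [wordMap_pow, hc]⟩
  let O := Set.range fun l => Submodule.span (AlgebraicClosure K) {wordMap F l x.rep}
  have hxO : x.submodule ∈ O :=
    ⟨[], (Projectivization.submodule_mk _ x.rep_nonzero).symm.trans (by rw [x.mk_rep])⟩
  have hO : ∀ g ∈ Subsemigroup.closure (T : Set (Function.End _)), ∀ y : Projectivization _ _,
      y.submodule ∈ O → (g y).submodule ∈ O := by
    intro g hg
    induction hg using Subsemigroup.closure_induction with
    | mul f g _ _ hf hg => exact fun y hy => hf _ (hg y hy)
    | mem t ht =>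
      rintro y ⟨l, hl⟩
      obtain rfl : .mk _ _ (wordMap_ne_zero h0 l x.rep_nonzero) = y :=
        Projectivization.submodule_injective hl
      rcases Nat.eq_zero_or_pos (d ⟨t, ht⟩) with hd | hd
      · have hconst : ∀ y z, t y = t z := fun y z => by
          induction y with | h v hv =>
          induction z with | h w hw =>
          refine (happly ⟨t, ht⟩ v hv (hps0 _ v hv)).trans
            (Eq.trans ?_ (happly ⟨t, ht⟩ w hw (hps0 _ w hw)).symm)
          congr 1
          funext i
          exact aeval_eq_of_isHomogeneous_zero (hd ▸ hps ⟨t, ht⟩ i) v w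
        obtain ⟨k, hk, h⟩ := hx t (hT ⟨t, ht⟩)
        obtain ⟨k, rfl⟩ := Nat.exists_eq_add_of_le' hk
        rwa [hconst _ ((t ^ k) x), show t ((t ^ k) x) = x by rwa [pow_succ'] at h]
      · exact ⟨⟨⟨t, ht⟩, hd⟩ :: l,
          (congrArg Projectivization.submodule (hφ ⟨⟨t, ht⟩, hd⟩ _ _)).symm⟩
  refine Set.Finite.of_finite_image (hfin.subset ?_)
    (Projectivization.submodule_injective.injOn)
  rintro _ ⟨_, ⟨g, hg, rfl⟩, rfl⟩
  exact hO g hg x hxO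
end
end

section
/- Let A be a group of automorphisms of a quasiprojective variety X, let A' = [A, A] be its commutator subgroup, let x be a point of X, and let g, h ∈ A. Suppose that the orbit A'·x is finite and that x ∈ Per(h). Then g(x) ∈ Per(h). -/
open AlgebraicGeometry CategoryTheory

attribute [local instance] MvPolynomial.gradedAlgebra

noncomputable section

/-- The action of a scheme automorphism on topological points. -/
def autMap {X : Scheme} (g : Aut X) : X → X := fun x => g.hom.base x

/-- `Per_n(g)`: the points fixed by the `n`-th iterate of `g` (a Zariski closed subset). -/
def PerN {X : Scheme} (g : Aut X) (n : ℕ) : Set X := {x | (autMap g)^[n] x = x}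

/-- `Per(g)`: the periodic points of `g`. -/
def Per {X : Scheme} (g : Aut X) : Set X := {x | ∃ n, 1 ≤ n ∧ (autMap g)^[n] x = x}

/-- `C` is an irreducible component of the subset `Z`: an irreducible subset of `Z`
that is maximal among irreducible subsets of `Z`. -/
def IsIrredComponentOf {α : Type*} [TopologicalSpace α] (C Z : Set α) : Prop :=
  C ⊆ Z ∧ IsIrreducible C ∧ ∀ C', C ⊆ C' → C' ⊆ Z → IsIrreducible C' → C' = C

/-- `Per_n^*(g)`: the points lying in a zero-dimensional (i.e. singleton) irreducible
component of `Per_n(g)`, where `n` is the least positive integer with `g^n(x) = x`. -/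
def PerNStar {X : Scheme} (g : Aut X) (n : ℕ) : Set X :=
  {x | 1 ≤ n ∧ (autMap g)^[n] x = x ∧ (∀ m, 1 ≤ m → m < n → (autMap g)^[m] x ≠ x) ∧
    IsIrredComponentOf {x} (PerN g n)}

/-- `Per^*(g) = ⋃ₙ Per_n^*(g)`. -/
def PerStar {X : Scheme} (g : Aut X) : Set X := {x | ∃ n, x ∈ PerNStar g n}

/-- `Per^{**}(g)`: the periodic points of `g` that do not lie in any positive-dimensional
(i.e. non-singleton) irreducible component of any `Per_n(g) = Fix(g^n)`. -/
def PerStarStar {X : Scheme} (g : Aut X) : Set X :=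
  {x | x ∈ Per g ∧ ∀ n, 1 ≤ n → ∀ C : Set X, IsIrredComponentOf C (PerN g n) → x ∈ C →
    C.Subsingleton}

open scoped commutatorElement in
/-- In a group action, if the orbit of `x` under `⁅A, A⁆` is finite and `h ∈ A` has a positive power
fixing `x`, then for every `g ∈ A` some positive power of `h` fixes `g • x`. -/
theorem exists_pow_smul_smul_eq_of_finite_commutator_orbit {G α : Type*} [Group G] [MulAction G α]
    (A : Subgroup G) {x : α} {g h : G} (hg : g ∈ A) (hh : h ∈ A)
    (hfin : {y : α | ∃ a ∈ ⁅A, A⁆, y = a • x}.Finite) (hx : ∃ n, 1 ≤ n ∧ h ^ n • x = x) :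
    ∃ n, 1 ≤ n ∧ h ^ n • g • x = g • x := by
  obtain ⟨N, hN, hNx⟩ := hx
  have hmem (k : ℕ) : g⁻¹ • (h ^ N) ^ k • g • x ∈ {y : α | ∃ a ∈ ⁅A, A⁆, y = a • x} := by
    have hk : (h ^ N) ^ k • x = x := by
      induction k with
      | zero => simp
      | succ k ih => rw [pow_succ, mul_smul, hNx, ih]
    refine ⟨⁅g⁻¹, (h ^ N) ^ k⁆, Subgroup.commutator_mem_commutator (A.inv_mem hg)
      (A.pow_mem (A.pow_mem hh N) k), ?_⟩
    rw [commutatorElement_def, inv_inv, mul_smul, mul_smul, mul_smul,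
      inv_smul_eq_iff.mpr hk.symm]
  obtain ⟨k, l, hkl, heq⟩ := hfin.exists_lt_map_eq_of_forall_mem hmem
  refine ⟨N * (l - k), Nat.mul_pos hN (Nat.sub_pos_of_lt hkl), ?_⟩
  rw [smul_left_cancel_iff, ← Nat.add_sub_of_le hkl.le, pow_add, mul_smul,
    smul_left_cancel_iff] at heq
  rw [pow_mul]
  exact heq.symm

/-- The left action of the automorphism group of a scheme on its points. -/
@[reducible]
def autMulAction (X : Scheme) : MulAction (Aut X) X where
  smul a x := autMap a x
  one_smul _ := rfl
  mul_smul a b x := by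
    change (b.hom ≫ a.hom).base x = _
    simp
    rfl

theorem autMap_pow {X : Scheme} (a : Aut X) (n : ℕ) (x : X) :
    let := autMulAction X
    (autMap a)^[n] x = a ^ n • x := by
  let := autMulAction X
  exact smul_iterate_apply a n x

/-- **Lemma (commutator).** Let `A` be a group of automorphisms of a quasiprojective
variety `X`, let `A' = [A,A]`, let `x ∈ X` and `g, h ∈ A`.  If the orbit `A'x` is finite
and `x ∈ Per(h)`, then `g(x) ∈ Per(h)`. -/
theorem commutator_orbit_per (K : Type) [Field K] (X : Scheme)
    -- `X` is a variety over `K`: reduced, separated and of finite type over `K`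
    (st : X ⟶ Spec (CommRingCat.of K)) [LocallyOfFiniteType st] [QuasiCompact st]
    [IsSeparated st] [IsReduced X]
    -- `X` is quasiprojective: it admits an immersion into some projective space over `K`
    (hqproj : ∃ (m : ℕ) (i : X ⟶ Proj (MvPolynomial.homogeneousSubmodule (Fin m) K)),
      IsImmersion i)
    -- `A` is a group of automorphisms of `X`
    (A : Subgroup (Aut X)) (hAK : ∀ a ∈ A, a.hom ≫ st = st)
    (x : X) (g h : Aut X) (hg : g ∈ A) (hh : h ∈ A)
    -- the orbit of `x` under the commutator subgroup `A' = [A, A]` is finite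
    (hfin : {y : X | ∃ a ∈ ⁅A, A⁆, y = autMap a x}.Finite)
    (hx : x ∈ Per h) :
    autMap g x ∈ Per h := by
  let := autMulAction X
  simp only [Per, Set.mem_ofPred_eq, autMap_pow] at hx ⊢
  exact exists_pow_smul_smul_eq_of_finite_commutator_orbit A hg hh hfin hx
end
end
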